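/- arXiv:math/0209074 — 3 statements merged into one kernel-verified Lean document; each statement's English description precedes it below -/
import Mathlib

section
/- Let X be a paracompact Hausdorff space and H = ⋃_{i=1}^∞ H_i a subset of X with covering dimension dim H ≤ n, where each H_i is closed in X. Let E be a Banach space, Y ⊂ E a closed convex subset, and K a σZ_n-set in Y. Then the set of all g ∈ C(X, Y) with g(H) ∩ K = ∅ is dense and G_δ in C(X, Y) with the source limitation topology. -/
open Set Topology

noncomputable section

/-- The `k`-dimensional cube `I^k`, viewed inside Euclidean space with the Euclidean metric. -/
def cube (k : ℕ) : Set (EuclideanSpace ℝ (Fin k)) := {x | ∀ i, x i ∈ Set.Icc (0:ℝ) 1}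

/-- The Hilbert cube `I^∞`, embedded in `ℓ²` as a closed convex subset; its metric `d_∞` is the
one induced by the `ℓ²` norm. -/
def HilbertCube : Set (lp (fun _ : ℕ => ℝ) 2) :=
  {x | ∀ i : ℕ, (x : ℕ → ℝ) i ∈ Set.Icc (0:ℝ) (1 / 2 ^ i)}

/-- Covering dimension of a topological space is at most `n` (as an integer, so that `n ≤ -1`
means the space is empty): every finite open cover admits an open shrinking of order `≤ n + 1`. -/
def CovDimLE (X : Type*) [TopologicalSpace X] (n : ℤ) : Prop :=
  ∀ (ι : Type) (U : ι → Set X), Finite ι → (∀ i, IsOpen (U i)) → (⋃ i, U i) = Set.univ →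
    ∃ V : ι → Set X, (∀ i, IsOpen (V i)) ∧ (∀ i, V i ⊆ U i) ∧ (⋃ i, V i) = Set.univ ∧
      ∀ x : X, (({i | x ∈ V i}).ncard : ℤ) ≤ n + 1

/-- A perfect map: continuous, closed, with compact fibers. -/
def IsPerfectMap {X Y : Type*} [TopologicalSpace X] [TopologicalSpace Y] (f : X → Y) : Prop :=
  Continuous f ∧ IsClosedMap f ∧ ∀ y : Y, IsCompact (f ⁻¹' {y})

/-- `f` has countable (functional) weight: there is a continuous `h : X → I^∞` such that the
diagonal product `f × h` embeds `X` into `Y × I^∞`. -/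
def HasCountableFunctionalWeight {X Y : Type*} [TopologicalSpace X] [TopologicalSpace Y]
    (f : X → Y) : Prop :=
  ∃ h : C(X, ↥HilbertCube), IsEmbedding (fun x => (f x, h x) : X → Y × ↥HilbertCube)

/-- `h` restricted to `A` is an `ω`-map: every point of `A` has a neighborhood `V` of its image
whose preimage within `A` is contained in some member of `ω`. -/
def IsOmegaMapOn {X Z : Type*} [TopologicalSpace X] [TopologicalSpace Z]
    (ω : Set (Set X)) (h : X → Z) (A : Set X) : Prop :=
  ∀ x ∈ A, ∃ V ∈ nhds (h x), ∃ W ∈ ω, A ∩ h ⁻¹' V ⊆ W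

/-- A set `U ⊆ C(X, M)` is open in the source limitation (fine) topology: every `g ∈ U` admits a
continuous `α : X → (0, ∞)` with `B̄(g, α) ⊆ U`. -/
def SLOpen {X M : Type*} [TopologicalSpace X] [PseudoMetricSpace M] (U : Set C(X, M)) : Prop :=
  ∀ g ∈ U, ∃ α : C(X, ℝ), (∀ x, 0 < α x) ∧
    {h : C(X, M) | ∀ x, dist (g x) (h x) ≤ α x} ⊆ U

/-- A set `D ⊆ C(X, M)` is dense in the source limitation topology. -/
def SLDense {X M : Type*} [TopologicalSpace X] [PseudoMetricSpace M] (D : Set C(X, M)) : Prop :=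
  ∀ U : Set C(X, M), SLOpen U → U.Nonempty → (U ∩ D).Nonempty

/-- A set `D ⊆ C(X, M)` is a `G_δ`-set in the source limitation topology. -/
def SLGdelta {X M : Type*} [TopologicalSpace X] [PseudoMetricSpace M] (D : Set C(X, M)) : Prop :=
  ∃ F : ℕ → Set C(X, M), (∀ i, SLOpen (F i)) ∧ D = ⋂ i, F i

/-- `Y` is a `C`-space: for every sequence `ω` of open covers there are pairwise disjoint open
families `γ i`, with `γ i` refining `ω i`, whose union covers `Y`. -/
def IsCSpace (Y : Type*) [TopologicalSpace Y] : Prop :=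
  ∀ ω : ℕ → Set (Set Y), (∀ i, ∀ U ∈ ω i, IsOpen U) → (∀ i, ⋃₀ ω i = Set.univ) →
    ∃ γ : ℕ → Set (Set Y),
      (∀ i, ∀ U ∈ γ i, IsOpen U) ∧
      (∀ i, (γ i).Pairwise Disjoint) ∧
      (∀ i, ∀ U ∈ γ i, ∃ W ∈ ω i, U ⊆ W) ∧
      ⋃₀ (⋃ i, γ i) = Set.univ

/-- A closed set `F` in a metric space `M` is a `Z_m`-set: the maps `I^m → M` avoiding `F` are
dense in the space of maps `I^m → M` with the uniform convergence (sup-metric) topology. -/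
def IsZSet {M : Type*} [PseudoMetricSpace M] (m : ℕ) (F : Set M) : Prop :=
  IsClosed F ∧ Dense {u : BoundedContinuousFunction ↥(cube m) M | ∀ z, u z ∉ F}

/-- A `σZ_m`-set: a countable union of closed `Z_m`-sets. -/
def IsSigmaZSet {M : Type*} [PseudoMetricSpace M] (m : ℕ) (S : Set M) : Prop :=
  ∃ F : ℕ → Set M, (∀ i, IsZSet m (F i)) ∧ S = ⋃ i, F i

/-- A `k`-plane in `ℝ^p`: the set where `p - k` fixed coordinates take fixed real values. -/
def IsPlane (p k : ℕ) (P : Set (EuclideanSpace ℝ (Fin p))) : Prop :=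
  ∃ (s : Finset (Fin p)) (r : Fin p → ℝ), s.card = p - k ∧
    P = {x | ∀ i ∈ s, x i = r i}

/-- A rational `k`-plane in `ℝ^p`: the fixed coordinate values are rational. -/
def IsRatPlane (p k : ℕ) (P : Set (EuclideanSpace ℝ (Fin p))) : Prop :=
  ∃ (s : Finset (Fin p)) (r : Fin p → ℚ), s.card = p - k ∧
    P = {x | ∀ i ∈ s, x i = (r i : ℝ)}

/-- Condition (R): `dim (g(f⁻¹(y)) ∩ Π) ≤ k - n - 1` for every `y ∈ Y` and every rational
`k`-plane `Π` in `ℝ^{2n+1+m}` with `0 ≤ k ≤ 2n`. -/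
def ConditionR {X Y : Type*} [TopologicalSpace X] [TopologicalSpace Y]
    (f : X → Y) (n m : ℕ) (g : X → ↥(cube (2*n+1+m))) : Prop :=
  ∀ y : Y, ∀ k : ℕ, k ≤ 2*n → ∀ P : Set (EuclideanSpace ℝ (Fin (2*n+1+m))),
    IsRatPlane (2*n+1+m) k P →
    CovDimLE ↥(((fun x => ((g x : EuclideanSpace ℝ (Fin (2*n+1+m))))) '' (f ⁻¹' {y})) ∩ P)
      ((k : ℤ) - n - 1)

/-- The restriction `f|B` is σ-perfect with countable weight: `B = ⋃ᵢ Bᵢ` with `Bᵢ ⊆ X` closed,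
`f(Bᵢ) ⊆ Y` closed, and each `f|Bᵢ : Bᵢ → f(Bᵢ)` a perfect map of countable weight. -/
def SigmaPerfectCW {X Y : Type*} [TopologicalSpace X] [TopologicalSpace Y]
    (f : X → Y) (B : Set X) : Prop :=
  ∃ Bi : ℕ → Set X, B = ⋃ i, Bi i ∧ ∀ i : ℕ,
    IsClosed (Bi i) ∧ IsClosed (f '' Bi i) ∧
    IsPerfectMap ((Set.mapsTo_image f (Bi i)).restrict f (Bi i) (f '' Bi i)) ∧
    HasCountableFunctionalWeight ((Set.mapsTo_image f (Bi i)).restrict f (Bi i) (f '' Bi i))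

lemma dim_closed {X S : Type*} [TopologicalSpace X] {n : ℕ} {H : Set X} (hdim : CovDimLE ↥H n)
    {C : Set X} (hC : IsClosed C) (hCH : C ⊆ H) (T : Finset S) (U : S → Set X)
    (hU : ∀ s, IsOpen (U s)) (hcov : ∀ x ∈ C, ∃ s ∈ T, x ∈ U s) :
    ∃ V : S → Set X, (∀ s, IsOpen (V s)) ∧ (∀ s, V s ⊆ U s) ∧ (∀ x ∈ C, ∃ s ∈ T, x ∈ V s) ∧
      ∀ x ∈ C, {s | x ∈ V s}.ncard ≤ n + 1 := by
  classical
  let e := T.equivFin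
  let U' : Option (Fin T.card) → Set H := fun o => match o with
    | none => Subtype.val ⁻¹' Cᶜ
    | some j => Subtype.val ⁻¹' (U (e.symm j))
  obtain ⟨V', hV'o, hV'U, hV'c, hV'n⟩ := hdim (Option (Fin T.card)) U' inferInstance (by
    intro i
    rcases i with _ | j
    · exact hC.isOpen_compl.preimage continuous_subtype_val
    · exact (hU _).preimage continuous_subtype_val) (by
    refine Set.eq_univ_of_forall fun x => ?_
    rw [Set.mem_iUnion]
    by_cases hx : (x : X) ∈ C
    · obtain ⟨s, hs, hxs⟩ := hcov x hx
      refine ⟨some (e ⟨s, hs⟩), ?_⟩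
      simp only [U', Set.mem_preimage, Equiv.symm_apply_apply]
      exact hxs
    · exact ⟨none, hx⟩)
  have : ∀ i, ∃ O : Set X, IsOpen O ∧ Subtype.val ⁻¹' O = V' i := fun i => isOpen_induced_iff.1 (hV'o i)
  choose O hO hOV using this
  have hmem : ∀ (x : X) (hx : x ∈ H) i, x ∈ O i ↔ (⟨x, hx⟩ : H) ∈ V' i := by
    intro x hx i
    rw [← hOV i]; rfl
  let V : S → Set X := fun s => if h : s ∈ T then O (some (e ⟨s, h⟩)) ∩ U s else ∅
  refine ⟨V, ?_, ?_, ?_, ?_⟩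
  · intro s
    by_cases h : s ∈ T
    · simp only [V, h, dif_pos]; exact (hO _).inter (hU s)
    · simp only [V, h, dif_neg, not_false_eq_true]; exact isOpen_empty
  · intro s
    by_cases h : s ∈ T
    · simp only [V, h, dif_pos]; exact Set.inter_subset_right
    · simp only [V, h, dif_neg, not_false_eq_true]; exact Set.empty_subset _
  · intro x hx
    have : (⟨x, hCH hx⟩ : H) ∈ ⋃ i, V' i := by rw [hV'c]; trivial
    obtain ⟨i, hi⟩ := Set.mem_iUnion.1 this
    rcases i with _ | j
    · exact absurd hx (hV'U _ hi)
    · refine ⟨(e.symm j : S), (e.symm j).2, ?_⟩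
      simp only [V, (e.symm j).2, dif_pos, Subtype.coe_eta, Equiv.apply_symm_apply]
      exact ⟨(hmem x (hCH hx) _).2 hi, hV'U _ hi⟩
  · intro x hx
    have h1 := hV'n ⟨x, hCH hx⟩
    have h2 : {s | x ∈ V s}.ncard ≤ {i | (⟨x, hCH hx⟩ : H) ∈ V' i}.ncard := by
      refine Set.ncard_le_ncard_of_injOn
        (fun s => if h : s ∈ T then some (e ⟨s, h⟩) else none) ?_ ?_ (Set.toFinite _)
      · intro s hs
        by_cases h : s ∈ T
        · simp only [V, h, dif_pos, Set.mem_ofPred_eq] at hs ⊢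
          exact (hmem x (hCH hx) _).1 hs.1
        · simp [V, h] at hs
      · intro s hs s' hs' hss
        by_cases h : s ∈ T
        · by_cases h' : s' ∈ T
          · simp only [h, h', dif_pos, Option.some.injEq, EmbeddingLike.apply_eq_iff_eq,
              Subtype.mk.injEq] at hss
            exact hss
          · simp [V, h'] at hs'
        · simp [V, h] at hs
    have : (({i | (⟨x, hCH hx⟩ : H) ∈ V' i}.ncard : ℤ)) ≤ n + 1 := h1
    omega

/-- One shrinking step. -/
lemma shrink_step {X S : Type*} [TopologicalSpace X] [NormalSpace X] {n : ℕ} {H : Set X}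
    (hdim : CovDimLE ↥H n) (P : S → Set X) (hPlf : LocallyFinite P)
    (K : Finset S → Set X) (hKc : ∀ T, IsClosed (K T)) (hKH : ∀ T, K T ⊆ H)
    (hKd : ∀ T T' x, x ∈ K T → x ∈ K T' → T = T') (hKP : ∀ T, ∀ s ∉ T, ∀ x ∈ K T, x ∉ P s)
    (hKlf : LocallyFinite K)
    (U : S → Set X) (hUo : ∀ s, IsOpen (U s)) (hUP : ∀ s, U s ⊆ P s)
    (hUc : ⋃ s, U s = Set.univ) :
    ∃ U' : S → Set X, (∀ s, IsOpen (U' s)) ∧ (∀ s, closure (U' s) ⊆ U s) ∧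
      (⋃ s, U' s = Set.univ) ∧ ∀ T, ∀ x ∈ K T, {s | x ∈ closure (U' s)}.ncard ≤ n + 1 := by
  have h1 : ∀ T, ∀ x ∈ K T, ∃ s ∈ T, x ∈ U s := by
    intro T x hx
    have : x ∈ ⋃ s, U s := by rw [hUc]; trivial
    obtain ⟨s, hs⟩ := Set.mem_iUnion.1 this
    refine ⟨s, ?_, hs⟩
    by_contra h
    exact hKP T s h x hx (hUP s hs)
  choose V hVo hVU hVc hVn using fun T => dim_closed hdim (hKc T) (hKH T) T U hUo (h1 T)
  have hN : ∀ s, IsClosed (⋃ T, (K T \ V T s)) := by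
    intro s
    refine LocallyFinite.isClosed_iUnion (hKlf.subset fun T => Set.sdiff_subset) ?_
    intro T
    exact (hKc T).sdiff (hVo T s)
  let W : S → Set X := fun s => U s \ ⋃ T, (K T \ V T s)
  have hWo : ∀ s, IsOpen (W s) := fun s => (hUo s).sdiff (hN s)
  have hWc : ⋃ s, W s = Set.univ := by
    refine Set.eq_univ_of_forall fun x => ?_
    by_cases hx : ∃ T, x ∈ K T
    · obtain ⟨T, hT⟩ := hx
      obtain ⟨s, hs, hxs⟩ := hVc T x hT
      refine Set.mem_iUnion.2 ⟨s, hVU T s hxs, ?_⟩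
      rintro h
      obtain ⟨T', h'⟩ := Set.mem_iUnion.1 h
      obtain rfl := hKd _ _ _ hT h'.1
      exact h'.2 hxs
    · have : x ∈ ⋃ s, U s := by rw [hUc]; trivial
      obtain ⟨s, hs⟩ := Set.mem_iUnion.1 this
      refine Set.mem_iUnion.2 ⟨s, hs, ?_⟩
      intro h
      obtain ⟨T', h'⟩ := Set.mem_iUnion.1 h
      exact hx ⟨T', h'.1⟩
  obtain ⟨U', hU'c, hU'o, hU'W⟩ := exists_iUnion_eq_closure_subset hWo (fun x => by
    refine (hPlf.point_finite x).subset ?_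
    intro s hs
    exact hUP s hs.1) hWc
  refine ⟨U', hU'o, fun s => (hU'W s).trans Set.sdiff_subset, hU'c, ?_⟩
  intro T x hx
  refine le_trans (Set.ncard_le_ncard ?_ ?_) (hVn T x hx)
  · intro s hs
    have hs' := hU'W s hs
    by_contra h
    exact hs'.2 (Set.mem_iUnion.2 ⟨T, hx, h⟩)
  · refine (hPlf.point_finite x).subset ?_
    intro s hs
    exact hUP s (hVU T s hs)

/-- Swelling of a locally finite closed cover. -/
lemma swelling {X S : Type*} [TopologicalSpace X] [T2Space X] [ParacompactSpace X] {n : ℕ}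
    {A : Set X} (hA : IsClosed A) (F : S → Set X) (hFc : ∀ s, IsClosed (F s))
    (hFlf : LocallyFinite F) (hn : ∀ x ∈ A, {s | x ∈ F s}.ncard ≤ n + 1) :
    ∃ W : S → Set X, (∀ s, IsOpen (W s)) ∧ (∀ s, F s ⊆ W s) ∧
      ∀ x ∈ A, {s | x ∈ W s}.Finite ∧ {s | x ∈ W s}.ncard ≤ n + 1 := by
  classical
  let O : X → Set X := fun x => (⋃ s, {y | y ∈ F s ∧ x ∉ F s})ᶜ ∩ {y | x ∈ A ∨ y ∉ A}
  have hOo : ∀ x, IsOpen (O x) := by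
    intro x
    refine IsOpen.inter ?_ ?_
    · rw [isOpen_compl_iff]
      refine LocallyFinite.isClosed_iUnion (hFlf.subset fun s y hy => hy.1) ?_
      intro s
      by_cases h : x ∈ F s
      · simp [h]
      · simpa [h] using hFc s
    · by_cases h : x ∈ A
      · simp [h]
      · simp only [h, false_or]; exact hA.isOpen_compl
  have hOc : ⋃ x, O x = Set.univ := by
    refine Set.eq_univ_of_forall fun x => Set.mem_iUnion.2 ⟨x, ?_, ?_⟩
    · simp
    · simp only [Set.mem_ofPred_eq]; tauto
  obtain ⟨V₀, hV₀o, hV₀c, hV₀lf, hV₀O⟩ := precise_refinement O hOo hOc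
  obtain ⟨V, hVc, hVo, hVV⟩ := exists_iUnion_eq_closure_subset hV₀o hV₀lf.point_finite hV₀c
  have hVlf : LocallyFinite fun x => closure (V x) := hV₀lf.subset hVV
  let W : S → Set X := fun s => (⋃ x, {y | y ∈ closure (V x) ∧ Disjoint (closure (V x)) (F s)})ᶜ
  have key : ∀ y ∈ A, ∃ x ∈ A, ∀ s, y ∈ W s → x ∈ F s := by
    intro y hy
    have : y ∈ ⋃ x, V x := by rw [hVc]; trivial
    obtain ⟨x, hx⟩ := Set.mem_iUnion.1 this
    have hyO := hV₀O x (hVV x (subset_closure hx))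
    have hxA : x ∈ A := hyO.2.resolve_right (not_not.2 hy)
    refine ⟨x, hxA, ?_⟩
    intro s hs
    by_contra hxs
    apply hs
    refine Set.mem_iUnion.2 ⟨x, subset_closure hx, ?_⟩
    rw [Set.disjoint_left]
    intro z hz hzF
    exact (hV₀O x (hVV x hz)).1 (Set.mem_iUnion.2 ⟨s, hzF, hxs⟩)
  refine ⟨W, ?_, ?_, ?_⟩
  · intro s
    rw [isOpen_compl_iff]
    refine LocallyFinite.isClosed_iUnion (hVlf.subset fun s y hy => hy.1) ?_
    intro x
    by_cases h : Disjoint (closure (V x)) (F s)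
    · simp [h]
    · simp [h]
  · intro s y hy h
    obtain ⟨x, hx⟩ := Set.mem_iUnion.1 h
    exact Set.disjoint_left.1 hx.2 hx.1 hy
  · intro y hy
    obtain ⟨x, hxA, hx⟩ := key y hy
    have hf : {s | x ∈ F s}.Finite := hFlf.point_finite x
    exact ⟨hf.subset hx, (Set.ncard_le_ncard hx hf).trans (hn x hxA)⟩

/-- Dowker theorem in partition of unity form. -/
lemma dowker {X S : Type*} [TopologicalSpace X] [T2Space X] [ParacompactSpace X] {n : ℕ}
    {H A : Set X} (hdim : CovDimLE ↥H n) (hA : IsClosed A) (hAH : A ⊆ H)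
    (U : S → Set X) (hUo : ∀ s, IsOpen (U s)) (hUc : ⋃ s, U s = Set.univ) :
    ∃ p : PartitionOfUnity S X, p.IsSubordinate U ∧
      ∀ x ∈ A, {s | p s x ≠ 0}.ncard ≤ n + 1 := by
  classical
  obtain ⟨q, hq⟩ := PartitionOfUnity.exists_isSubordinate isClosed_univ U hUo hUc.ge
  let P : S → Set X := fun s => Function.support (q s)
  have hPlf : LocallyFinite P := q.locallyFinite
  have hPo : ∀ s, IsOpen (P s) := fun s => (q s).continuous.isOpen_support
  have hPc : ⋃ s, P s = Set.univ := by
    refine Set.eq_univ_of_forall fun x => ?_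
    obtain ⟨s, hs⟩ := q.exists_pos (Set.mem_univ x)
    exact Set.mem_iUnion.2 ⟨s, hs.ne'⟩
  let K : ℕ → Finset S → Set X := fun j T =>
    {x | x ∈ A ∧ (∀ s ∈ T, 1 / ((j : ℝ) + 1) ≤ q s x) ∧ ∀ s ∉ T, q s x = 0}
  have hpos : ∀ j : ℕ, 0 < 1 / ((j : ℝ) + 1) := fun j => by positivity
  have hKc : ∀ j T, IsClosed (K j T) := by
    intro j T
    have : K j T = A ∩ ((⋂ s ∈ T, {x | 1 / ((j : ℝ) + 1) ≤ q s x}) ∩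
        ⋂ s ∈ {s | s ∉ T}, {x | q s x = 0}) := by
      ext x; simp [K]; tauto
    rw [this]
    refine hA.inter (IsClosed.inter ?_ ?_)
    · exact isClosed_biInter fun s _ => isClosed_le continuous_const (q s).continuous
    · exact isClosed_biInter fun s _ => isClosed_eq (q s).continuous continuous_const
  have hKlf : ∀ j, LocallyFinite (K j) := by
    intro j x
    obtain ⟨N, hN, hf⟩ := hPlf x
    refine ⟨N, hN, ?_⟩
    refine (hf.toFinset.powerset.finite_toSet).subset ?_
    rintro T ⟨y, hy, hyN⟩
    simp only [Finset.coe_powerset, Set.mem_preimage, Set.mem_powerset_iff]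
    intro s hs
    simp only [Set.Finite.coe_toFinset]
    exact ⟨y, ((hpos j).trans_le (hy.2.1 s hs)).ne', hyN⟩
  have hKd : ∀ j T T' x, x ∈ K j T → x ∈ K j T' → T = T' := by
    intro j T T' x h h'
    ext s
    constructor
    · intro hs
      by_contra hs'
      have h1 := h.2.1 s hs
      rw [h'.2.2 s hs'] at h1
      exact absurd h1 (not_le.2 (hpos j))
    · intro hs
      by_contra hs'
      have h1 := h'.2.1 s hs
      rw [h.2.2 s hs'] at h1
      exact absurd h1 (not_le.2 (hpos j))
  have step : ∀ (j : ℕ) (V : {V : S → Set X // (∀ s, IsOpen (V s)) ∧ (∀ s, V s ⊆ P s) ∧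
      ⋃ s, V s = Set.univ}), ∃ V' : {V : S → Set X // (∀ s, IsOpen (V s)) ∧ (∀ s, V s ⊆ P s) ∧
      ⋃ s, V s = Set.univ}, (∀ s, closure (V'.1 s) ⊆ V.1 s) ∧
      ∀ T, ∀ x ∈ K j T, {s | x ∈ closure (V'.1 s)}.ncard ≤ n + 1 := by
    rintro j ⟨V, hVo, hVP, hVc⟩
    obtain ⟨V', h1, h2, h3, h4⟩ := shrink_step hdim P hPlf (K j) (hKc j)
      (fun T x hx => hAH hx.1) (hKd j) (fun T s hs x hx h => h (hx.2.2 s hs)) (hKlf j)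
      V hVo hVP hVc
    exact ⟨⟨V', h1, fun s => (subset_closure.trans (h2 s)).trans (hVP s), h3⟩, h2, h4⟩
  choose nxt hnxt1 hnxt2 using step
  let G : ℕ → {V : S → Set X // (∀ s, IsOpen (V s)) ∧ (∀ s, V s ⊆ P s) ∧
      ⋃ s, V s = Set.univ} := fun k => Nat.rec ⟨P, hPo, fun s => le_rfl, hPc⟩ (fun j V => nxt j V) k
  have hG : ∀ j, G (j + 1) = nxt j (G j) := fun j => rfl
  have hG1 : ∀ j s, closure ((G (j + 1)).1 s) ⊆ (G j).1 s := fun j s => by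
    rw [hG]; exact hnxt1 j (G j) s
  have hG2 : ∀ j T, ∀ x ∈ K j T, {s | x ∈ closure ((G (j + 1)).1 s)}.ncard ≤ n + 1 := fun j => by
    rw [hG]; exact hnxt2 j (G j)
  have hanti : ∀ s, Antitone fun j => (G j).1 s := fun s =>
    antitone_nat_of_succ_le fun j => subset_closure.trans (hG1 j s)
  let F : S → Set X := fun s => ⋂ j, closure ((G (j + 1)).1 s)
  have hFP : ∀ s, F s ⊆ P s := fun s x hx => (G 0).2.2.1 s (hG1 0 s (Set.mem_iInter.1 hx 0))
  have hFc : ∀ s, IsClosed (F s) := fun s => isClosed_iInter fun j => isClosed_closure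
  have hFcov : ∀ x, ∃ s, x ∈ F s := by
    intro x
    by_contra! h
    have : ∀ s, ∃ j, x ∉ (G j).1 s := by
      intro s
      by_contra! h'
      exact h s (Set.mem_iInter.2 fun j => subset_closure (h' (j + 1)))
    choose J hJ using this
    have hf : {s | x ∈ P s}.Finite := hPlf.point_finite x
    obtain ⟨s, hs⟩ := Set.mem_iUnion.1 ((G (hf.toFinset.sup J)).2.2.2.ge (Set.mem_univ x))
    have hsP : x ∈ P s := (G _).2.2.1 s hs
    exact hJ s (hanti s (Finset.le_sup (f := J) (hf.mem_toFinset.2 hsP)) hs)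
  have hFn : ∀ x ∈ A, {s | x ∈ F s}.ncard ≤ n + 1 := by
    intro x hx
    have hf : {s | x ∈ P s}.Finite := hPlf.point_finite x
    have : ∃ j : ℕ, ∀ s ∈ hf.toFinset, 1 / ((j : ℝ) + 1) ≤ q s x := by
      have h1 : ∀ s, ∃ j : ℕ, x ∈ P s → 1 / ((j : ℝ) + 1) ≤ q s x := by
        intro s
        by_cases h : x ∈ P s
        · have : 0 < q s x := lt_of_le_of_ne (q.nonneg s x) (Ne.symm h)
          obtain ⟨j, hj⟩ := exists_nat_one_div_lt this
          exact ⟨j, fun _ => hj.le⟩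
        · exact ⟨0, fun h' => absurd h' h⟩
      choose J hJ using h1
      refine ⟨hf.toFinset.sup J, fun s hs => ?_⟩
      refine le_trans ?_ (hJ s (hf.mem_toFinset.1 hs))
      have : J s ≤ hf.toFinset.sup J := Finset.le_sup (f := J) hs
      have : (J s : ℝ) ≤ (hf.toFinset.sup J : ℕ) := by exact_mod_cast this
      gcongr
    obtain ⟨j, hj⟩ := this
    have hxK : x ∈ K j hf.toFinset := by
      refine ⟨hx, hj, fun s hs => ?_⟩
      by_contra h
      exact hs (hf.mem_toFinset.2 h)
    refine le_trans (Set.ncard_le_ncard ?_ ?_) (hG2 j _ x hxK)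
    · intro s hs
      exact Set.mem_iInter.1 hs j
    · exact hf.subset fun s hs => (G j).2.2.1 s (hG1 j s hs)
  obtain ⟨W, hWo, hFW, hWn⟩ := swelling hA F hFc (hPlf.subset hFP) hFn
  obtain ⟨p, hp⟩ := PartitionOfUnity.exists_isSubordinate isClosed_univ (fun s => W s ∩ P s)
    (fun s => (hWo s).inter (hPo s)) (fun x _ => by
      obtain ⟨s, hs⟩ := hFcov x
      exact Set.mem_iUnion.2 ⟨s, hFW s hs, hFP s hs⟩)
  refine ⟨p, fun s => (hp s).trans ?_, ?_⟩
  · exact fun x hx => hq s (subset_tsupport _ hx.2)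
  · intro x hx
    refine le_trans (Set.ncard_le_ncard ?_ (hWn x hx).1) (hWn x hx).2
    intro s hs
    exact (hp s (subset_tsupport _ hs)).1

/-- The simplex spanned by the vertices in `T`. -/
def Smp {S : Type*} (T : Finset S) : Set (S → ℝ) :=
  {t | (∀ s, 0 ≤ t s) ∧ (∀ s ∉ T, t s = 0) ∧ ∑ s ∈ T, t s = 1}

lemma cube_compact (n : ℕ) : IsCompact (cube n) := by
  have : cube n = (EuclideanSpace.equiv (Fin n) ℝ).toHomeomorph ⁻¹'
      (Set.pi Set.univ fun _ => Set.Icc (0 : ℝ) 1) := by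
    ext x; simp only [cube, Set.mem_ofPred_eq, Set.mem_preimage, Set.mem_pi, Set.mem_univ,
      true_imp_iff]; rfl
  rw [this, Homeomorph.isCompact_preimage]
  exact isCompact_univ_pi fun _ => isCompact_Icc

lemma z_approx {E S : Type*} [NormedAddCommGroup E] {n : ℕ} {Y : Set E} {F : Set ↥Y}
    (hF : IsZSet n F) (T : Finset S) (hT : T.card ≤ n + 1) (Φ : (S → ℝ) → E)
    (hΦ : ContinuousOn Φ (Smp T)) (hΦY : ∀ t ∈ Smp T, Φ t ∈ Y) {ε : ℝ} (hε : 0 < ε) :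
    ∃ u : (S → ℝ) → E, ContinuousOn u (Smp T) ∧
      ∀ t ∈ Smp T, u t ∈ Y ∧ u t ∉ Subtype.val '' F ∧ ‖u t - Φ t‖ ≤ ε := by
  classical
  rcases T.eq_empty_or_nonempty with rfl | ⟨s₀, hs₀⟩
  · exact ⟨Φ, hΦ, fun t ht => by simpa using ht.2.2⟩
  let T' := T.erase s₀
  have hT' : T'.card ≤ n := by
    rw [Finset.card_erase_of_mem hs₀]; omega
  have hs₀' : s₀ ∉ T' := Finset.notMem_erase _ _
  have hins : insert s₀ T' = T := Finset.insert_erase hs₀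
  obtain ⟨e⟩ : Nonempty (T' ↪ Fin n) := by
    rw [Function.Embedding.nonempty_iff_card_le]; simpa using hT'
  let a : (S → ℝ) → EuclideanSpace ℝ (Fin n) := fun t =>
    WithLp.toLp 2 fun i => ∑ s : T', if e s = i then t s else 0
  let xx : EuclideanSpace ℝ (Fin n) → S → ℝ := fun x s => if h : s ∈ T' then x (e ⟨s, h⟩) else 0
  let σ : EuclideanSpace ℝ (Fin n) → ℝ := fun x => max 1 (∑ s ∈ T', xx x s)
  let b : EuclideanSpace ℝ (Fin n) → S → ℝ := fun x s =>
    if s ∈ T' then xx x s / σ x else if s = s₀ then 1 - ∑ s ∈ T', xx x s / σ x else 0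
  have hσ : ∀ x, 1 ≤ σ x := fun x => le_max_left _ _
  have hσ0 : ∀ x, σ x ≠ 0 := fun x => (zero_lt_one.trans_le (hσ x)).ne'
  have hac : Continuous a := by
    refine (PiLp.continuous_toLp 2 _).comp (continuous_pi fun i => ?_)
    refine continuous_finsetSum _ fun s _ => ?_
    by_cases h : e s = i
    · simp only [h, if_true]; exact continuous_apply _
    · simp only [h, if_false]; exact continuous_const
  have hxc : ∀ s, Continuous fun x => xx x s := by
    intro s
    by_cases h : s ∈ T'
    · simp only [xx, h, dif_pos]; fun_prop
    · simp only [xx, h, dif_neg, not_false_eq_true]; exact continuous_const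
  have hσc : Continuous σ := continuous_const.max (continuous_finsetSum _ fun s _ => hxc s)
  have hbc : Continuous b := by
    refine continuous_pi fun s => ?_
    by_cases h : s ∈ T'
    · simp only [b, h, if_true]; exact (hxc s).div hσc hσ0
    · by_cases h' : s = s₀
      · simp only [b, h', if_true]
        have : s₀ ∉ T' := hs₀'
        simp only [this, if_false]
        exact continuous_const.sub (continuous_finsetSum _ fun s _ => (hxc s).div hσc hσ0)
      · simp only [b, h, h', if_false]; exact continuous_const
  have hx0 : ∀ x ∈ cube n, ∀ s, 0 ≤ xx x s := by
    intro x hx s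
    by_cases h : s ∈ T'
    · simp only [xx, h, dif_pos]; exact (hx _).1
    · simp [xx, h]
  have hb : ∀ x ∈ cube n, b x ∈ Smp T := by
    intro x hx
    refine ⟨?_, ?_, ?_⟩
    · intro s
      by_cases h : s ∈ T'
      · simp only [b, h, if_true]; exact div_nonneg (hx0 x hx s) (zero_le_one.trans (hσ x))
      · by_cases h' : s = s₀
        · subst h'
          simp only [b, h, if_false, if_true]
          rw [← Finset.sum_div, sub_nonneg, div_le_one (zero_lt_one.trans_le (hσ x))]
          exact le_max_right _ _
        · simp [b, h, h']
    · intro s hs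
      have h1 : s ∉ T' := fun h => hs (Finset.mem_of_mem_erase h)
      have h2 : s ≠ s₀ := by rintro rfl; exact hs hs₀
      simp [b, h1, h2]
    · rw [← hins, Finset.sum_insert hs₀']
      have h1 : ∑ s ∈ T', b x s = ∑ s ∈ T', xx x s / σ x :=
        Finset.sum_congr rfl fun s hs => by simp only [b, hs, if_true]
      rw [h1]
      simp only [b, hs₀', if_false, if_true]
      ring
  have hsum : ∀ t ∈ Smp T, t s₀ + ∑ s ∈ T', t s = 1 := by
    intro t ht
    rw [← Finset.sum_insert hs₀', hins]; exact ht.2.2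
  have ha : ∀ t ∈ Smp T, a t ∈ cube n := by
    intro t ht i
    refine ⟨?_, ?_⟩
    · refine Finset.sum_nonneg fun s _ => ?_
      split_ifs
      · exact ht.1 _
      · exact le_rfl
    · have h1 : (a t) i ≤ ∑ s : T', t s := by
        refine Finset.sum_le_sum fun s _ => ?_
        split_ifs
        · exact le_rfl
        · exact ht.1 _
      have h2 : ∑ s : T', t s = ∑ s ∈ T', t s := Finset.sum_coe_sort T' t
      have h3 := hsum t ht
      have h4 := ht.1 s₀
      linarith
  have hba : ∀ t ∈ Smp T, b (a t) = t := by
    intro t ht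
    have h1 : ∀ s ∈ T', xx (a t) s = t s := by
      intro s hs
      simp only [xx, hs, dif_pos, a]
      rw [Finset.sum_eq_single ⟨s, hs⟩]
      · simp
      · intro s' _ hss
        rw [if_neg]
        intro h
        exact hss (e.injective h)
      · simp
    have h2 : ∑ s ∈ T', xx (a t) s = ∑ s ∈ T', t s := Finset.sum_congr rfl h1
    have h3 : σ (a t) = 1 := by
      simp only [σ]
      rw [h2]
      apply max_eq_left
      have h3 := hsum t ht
      have h4 := ht.1 s₀
      linarith
    ext s
    by_cases h : s ∈ T'
    · simp only [b, h, if_true, h3, h1 s h, div_one]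
    · by_cases h' : s = s₀
      · subst h'
        simp only [b, h, if_false, if_true, h3, div_one]
        rw [h2]
        linarith [hsum t ht]
      · simp only [b, h, h', if_false]
        refine (ht.2.1 s ?_).symm
        rw [← hins, Finset.mem_insert]
        tauto
  have : CompactSpace (cube n) := isCompact_iff_compactSpace.1 (cube_compact n)
  let f : C(cube n, Y) := ⟨fun x => ⟨Φ (b x), hΦY _ (hb x x.2)⟩, by
    refine Continuous.subtype_mk ?_ _
    exact hΦ.comp_continuous (hbc.comp continuous_subtype_val) fun x => hb x x.2⟩
  obtain ⟨v, hvF, hv⟩ := hF.2.exists_dist_lt (BoundedContinuousFunction.mkOfCompact f) hε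
  let u : (S → ℝ) → E := fun t => if h : a t ∈ cube n then (v ⟨a t, h⟩ : E) else 0
  have hu : ∀ t (h : t ∈ Smp T), u t = v ⟨a t, ha t h⟩ := fun t h => by
    simp only [u, ha t h, dif_pos]
  refine ⟨u, ?_, ?_⟩
  · rw [continuousOn_iff_continuous_domRestrict]
    have : (Smp T).domRestrict u = fun t : Smp T => (v ⟨a t, ha t t.2⟩ : E) := by
      funext t; exact hu t.1 t.2
    rw [this]
    exact continuous_subtype_val.comp (v.continuous.comp
      (Continuous.subtype_mk (hac.comp continuous_subtype_val) _))
  · intro t ht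
    rw [hu t ht]
    refine ⟨(v _).2, ?_, ?_⟩
    · rintro ⟨y, hy, hyv⟩
      rw [Subtype.val_injective hyv] at hy
      exact hvF _ hy
    · have h1 := (BoundedContinuousFunction.dist_coe_le_dist (f := BoundedContinuousFunction.mkOfCompact f) (g := v) ⟨a t, ha t ht⟩).trans hv.le
      have h2 : dist (Φ (b (a t))) (v ⟨a t, ha t ht⟩ : E) ≤ ε := h1
      rw [hba t ht, dist_comm, dist_eq_norm] at h2
      exact h2

lemma Smp_sum_le {S : Type*} {T₀ : Finset S} {t : S → ℝ} (ht : t ∈ Smp T₀) (T : Finset S) :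
    ∑ s ∈ T, t s ≤ 1 := by
  classical
  have h1 : ∑ s ∈ T, t s ≤ ∑ s ∈ T ∪ T₀, t s :=
    Finset.sum_le_sum_of_subset_of_nonneg Finset.subset_union_left fun s _ _ => ht.1 s
  have h2 : ∑ s ∈ T₀, t s = ∑ s ∈ T ∪ T₀, t s :=
    Finset.sum_subset Finset.subset_union_right fun s _ h => ht.2.1 s h
  linarith [ht.2.2]

lemma Smp_compact {S : Type*} (T : Finset S) : IsCompact (Smp T) := by
  classical
  refine (isCompact_univ_pi (X := fun _ : S => ℝ)
    (s := fun _ => Set.Icc (0 : ℝ) 1) fun _ => isCompact_Icc).of_isClosed_subset ?_ ?_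
  · have : Smp T = (⋂ s, {t : S → ℝ | 0 ≤ t s}) ∩ ((⋂ s ∈ {s | s ∉ T}, {t : S → ℝ | t s = 0}) ∩
        {t : S → ℝ | ∑ s ∈ T, t s = 1}) := by
      ext t; simp [Smp]
    rw [this]
    refine IsClosed.inter ?_ (IsClosed.inter ?_ ?_)
    · exact isClosed_iInter fun s => isClosed_le continuous_const (continuous_apply s)
    · exact isClosed_biInter fun s _ => isClosed_eq (continuous_apply s) continuous_const
    · exact isClosed_eq (continuous_finsetSum _ fun s _ => continuous_apply s) continuous_const
  · intro t ht s _
    refine ⟨ht.1 s, ?_⟩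
    simpa using Smp_sum_le ht {s}

lemma local_fix {E S : Type*} [NormedAddCommGroup E] [NormedSpace ℝ E] {n : ℕ} {Y : Set E}
    (hYcl : IsClosed Y) {F : Set ↥Y} (hF : IsZSet n F) (T : Finset S) (hne : T.Nonempty)
    (hT : T.card ≤ n + 1) (Φ : (S → ℝ) → E)
    (hΦ : ContinuousOn Φ (Smp T)) (hΦY : ∀ t ∈ Smp T, Φ t ∈ Y)
    (hΦF : ∀ t ∈ Smp T, (∃ s ∈ T, t s = 0) → Φ t ∉ Subtype.val '' F) {ε : ℝ} (hε : 0 < ε) :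
    ∃ (lam : (S → ℝ) → ℝ) (w : (S → ℝ) → E), Continuous lam ∧ (∀ t, 0 ≤ lam t ∧ lam t ≤ 1) ∧
      (∀ T₀, ∀ t ∈ Smp T₀, lam t ≠ 0 → ∀ s ∈ T, 0 < t s ∧ ∀ s' ∉ T, t s' < t s) ∧
      (∀ T₀, ContinuousOn w (Smp T₀)) ∧
      (∀ T₀, ∀ t ∈ Smp T₀, w t ∈ Y ∧ ∃ t' ∈ Smp T, ‖w t - Φ t'‖ ≤ ε) ∧
      ∀ t ∈ Smp T, (1 - lam t) • Φ t + lam t • w t ∉ Subtype.val '' F := by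
  classical
  set F' : Set E := Subtype.val '' F with hF'
  have hF'c : IsClosed F' := hYcl.isClosedEmbedding_subtypeVal.isClosedMap _ hF.1
  let μ : (S → ℝ) → ℝ := fun t => T.inf' hne t
  have hμc : Continuous μ := by
    have : μ = T.inf' hne (fun s (t : S → ℝ) => t s) := by
      funext t; simp [μ, Finset.inf'_apply]
    rw [this]
    exact Continuous.finset_inf' hne fun s _ => continuous_apply s
  have hμ0 : ∀ t ∈ Smp T, 0 ≤ μ t := fun t ht => Finset.le_inf' _ _ fun s _ => ht.1 s
  have hμle : ∀ t, ∀ s ∈ T, μ t ≤ t s := fun t s hs => Finset.inf'_le _ hs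
  obtain ⟨c, hc, hcc⟩ : ∃ c > 0, ∀ t ∈ Smp T, c ≤ μ t ∨ ∀ f ∈ F', c ≤ dist (Φ t) f := by
    rcases F'.eq_empty_or_nonempty with h | h
    · exact ⟨1, one_pos, fun t _ => Or.inr (by simp [h])⟩
    · obtain ⟨c, hc, hcc⟩ := (Smp_compact T).exists_forall_le'
        (f := fun t => μ t + Metric.infDist (Φ t) F') (a := 0)
        (hμc.continuousOn.add ((Metric.continuous_infDist_pt F').comp_continuousOn hΦ)) (by
          intro t ht
          rcases (hμ0 t ht).lt_or_eq with h0 | h0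
          · exact add_pos_of_pos_of_nonneg h0 Metric.infDist_nonneg
          · refine add_pos_of_nonneg_of_pos (hμ0 t ht) ?_
            rw [← hF'c.notMem_iff_infDist_pos h]
            apply hΦF t ht
            obtain ⟨s, hs, hst⟩ := Finset.exists_mem_eq_inf' hne t
            exact ⟨s, hs, by rw [← hst]; exact h0.symm⟩)
      refine ⟨c / 2, half_pos hc, fun t ht => ?_⟩
      by_contra! h'
      obtain ⟨h1, f, hf, h2⟩ := h'
      have h3 : Metric.infDist (Φ t) F' ≤ dist (Φ t) f := Metric.infDist_le_dist_of_mem hf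
      have := hcc t ht
      linarith
  let ε₁ := min ε (c / 2)
  have hε₁ : 0 < ε₁ := lt_min hε (half_pos hc)
  obtain ⟨u, huc, hu⟩ := z_approx hF T hT Φ hΦ hΦY hε₁
  let κ : (S → ℝ) → ℝ := fun t => μ t - (1 - ∑ s ∈ T, t s)
  have hsumc : Continuous fun t : S → ℝ => ∑ s ∈ T, t s :=
    continuous_finsetSum _ fun s _ => continuous_apply s
  have hκc : Continuous κ := hμc.sub (continuous_const.sub hsumc)
  let lam : (S → ℝ) → ℝ := fun t => max 0 (min 1 (κ t / c))
  let ρ : (S → ℝ) → S → ℝ := fun t s => if s ∈ T then t s + (1 - ∑ s ∈ T, t s) / T.card else 0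
  have hρc : Continuous ρ := by
    refine continuous_pi fun s => ?_
    by_cases h : s ∈ T
    · simp only [ρ, h, if_true]
      exact (continuous_apply s).add ((continuous_const.sub hsumc).div_const _)
    · simp only [ρ, h, if_false]; exact continuous_const
  have hcard : (T.card : ℝ) ≠ 0 := by exact_mod_cast hne.card_pos.ne'
  have hρ : ∀ T₀, ∀ t ∈ Smp T₀, ρ t ∈ Smp T := by
    intro T₀ t ht
    refine ⟨?_, ?_, ?_⟩
    · intro s
      by_cases h : s ∈ T
      · simp only [ρ, h, if_true]
        have := Smp_sum_le ht T
        exact add_nonneg (ht.1 s) (div_nonneg (by linarith) (Nat.cast_nonneg _))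
      · simp [ρ, h]
    · intro s h
      simp [ρ, h]
    · have : ∑ s ∈ T, ρ t s = ∑ s ∈ T, (t s + (1 - ∑ s ∈ T, t s) / T.card) :=
        Finset.sum_congr rfl fun s h => by simp only [ρ, h, if_true]
      rw [this, Finset.sum_add_distrib, Finset.sum_const, nsmul_eq_mul]
      field_simp
      ring
  have hρid : ∀ t ∈ Smp T, ρ t = t := by
    intro t ht
    ext s
    by_cases h : s ∈ T
    · simp [ρ, h, ht.2.2]
    · simp [ρ, h, ht.2.1 s h]
  have hlam : ∀ t, 0 ≤ lam t ∧ lam t ≤ 1 := fun t =>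
    ⟨le_max_left _ _, max_le zero_le_one (min_le_left _ _)⟩
  refine ⟨lam, fun t => u (ρ t), ?_, hlam, ?_, ?_, ?_, ?_⟩
  · exact continuous_const.max (continuous_const.min (hκc.div_const _))
  · intro T₀ t ht hl
    have hκ : 0 < κ t := by
      by_contra! h
      apply hl
      apply max_eq_left
      exact (min_le_right _ _).trans (div_nonpos_of_nonpos_of_nonneg h hc.le)
    intro s hs
    have h1 := hμle t s hs
    have h2 := Smp_sum_le ht T
    have h3 : 0 < μ t - (1 - ∑ s ∈ T, t s) := hκ
    refine ⟨by linarith, fun s' hs' => ?_⟩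
    have h4 := Smp_sum_le ht (insert s' T)
    rw [Finset.sum_insert hs'] at h4
    linarith
  · intro T₀
    exact huc.comp hρc.continuousOn (hρ T₀)
  · intro T₀ t ht
    have h := hu _ (hρ T₀ t ht)
    exact ⟨h.1, ρ t, hρ T₀ t ht, h.2.2.trans (min_le_left _ _)⟩
  · intro t ht
    simp only [hρid t ht]
    obtain ⟨h1, h2, h3⟩ := hu t ht
    rcases hcc t ht with h | h
    · have : lam t = 1 := by
        have hκ : κ t = μ t := by simp [κ, ht.2.2]
        simp only [lam, hκ]
        rw [min_eq_left ((one_le_div hc).2 h)]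
        simp
      rw [this]
      simp only [sub_self, zero_smul, one_smul, zero_add]
      exact h2
    · intro hmem
      have h4 := h _ hmem
      rw [dist_eq_norm] at h4
      have h5 : Φ t - ((1 - lam t) • Φ t + lam t • u t) = - (lam t • (u t - Φ t)) := by
        module
      rw [h5, norm_neg, norm_smul, Real.norm_of_nonneg (hlam t).1] at h4
      have h6 : ε₁ ≤ c / 2 := min_le_right _ _
      nlinarith [norm_nonneg (u t - Φ t), hlam t]

lemma skeleton {E S : Type*} [NormedAddCommGroup E] [NormedSpace ℝ E] {n : ℕ} {Y : Set E}
    (hYcl : IsClosed Y) (hYconv : Convex ℝ Y) {F : Set ↥Y} (hF : IsZSet n F)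
    (y : S → E) (hy : ∀ s, y s ∈ Y) (r : S → ℝ) (hr : ∀ s, 0 < r s) (k : ℕ) (hk : k ≤ n + 1) :
    ∃ Φ : (S → ℝ) → E, (∀ T, ContinuousOn Φ (Smp T)) ∧ (∀ T, ∀ t ∈ Smp T, Φ t ∈ Y) ∧
      (∀ T, T.card ≤ k → ∀ t ∈ Smp T, Φ t ∉ Subtype.val '' F) ∧
      ∀ T, ∀ t ∈ Smp T, ∀ (z : E) (ρ : ℝ), (∀ s, t s ≠ 0 → ‖y s - z‖ + k * r s ≤ ρ) →
        ‖Φ t - z‖ ≤ ρ := by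
  classical
  induction k with
  | zero =>
    let Φ : (S → ℝ) → E := fun t => ∑ᶠ s, t s • y s
    have hΦ : ∀ T, ∀ t ∈ Smp T, Φ t = ∑ s ∈ T, t s • y s := by
      intro T t ht
      refine finsum_eq_sum_of_support_subset _ ?_
      intro s hs
      by_contra h
      exact hs (by simp [ht.2.1 s h])
    refine ⟨Φ, ?_, ?_, ?_, ?_⟩
    · intro T
      refine ContinuousOn.congr (f := fun t : S → ℝ => ∑ s ∈ T, t s • y s) ?_ (hΦ T)
      exact (continuous_finsetSum _ fun s _ => (continuous_apply s).smul continuous_const).continuousOn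
    · intro T t ht
      rw [hΦ T t ht]
      exact hYconv.sum_mem (fun s _ => ht.1 s) ht.2.2 fun s _ => hy s
    · intro T hT t ht
      have : T = ∅ := by simpa using hT
      subst this
      simpa using ht.2.2
    · intro T t ht z ρ h
      let T' := T.filter fun s => t s ≠ 0
      have h1 : ∑ s ∈ T', t s = 1 := by rw [Finset.sum_filter_ne_zero, ht.2.2]
      have h2 : Φ t = ∑ s ∈ T', t s • y s := by
        rw [hΦ T t ht]
        symm
        refine Finset.sum_subset (Finset.filter_subset _ _) fun s hs hs' => ?_
        have : t s = 0 := by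
          by_contra h0
          exact hs' (Finset.mem_filter.2 ⟨hs, h0⟩)
        simp [this]
      have h3 : Φ t ∈ Metric.closedBall z ρ := by
        rw [h2]
        refine (convex_closedBall z ρ).sum_mem (fun s _ => ht.1 s) h1 fun s hs => ?_
        rw [Metric.mem_closedBall, dist_eq_norm]
        simpa using h s (Finset.mem_filter.1 hs).2
      rwa [Metric.mem_closedBall, dist_eq_norm] at h3
  | succ k ih =>
    obtain ⟨Φ, hΦc, hΦY, hΦF, hΦe⟩ := ih (by omega)
    have hex : ∀ T : Finset S, ∃ (lam : (S → ℝ) → ℝ) (w : (S → ℝ) → E), Continuous lam ∧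
        (∀ t, 0 ≤ lam t ∧ lam t ≤ 1) ∧
        (∀ T₀, ∀ t ∈ Smp T₀, lam t ≠ 0 → T.card = k + 1 ∧
          ∀ s ∈ T, 0 < t s ∧ ∀ s' ∉ T, t s' < t s) ∧
        (∀ T₀, ContinuousOn w (Smp T₀)) ∧
        (∀ T₀, ∀ t ∈ Smp T₀, w t ∈ Y ∧ (T.card = k + 1 → ∃ ε, (∀ s ∈ T, ε ≤ r s) ∧
          ∃ t' ∈ Smp T, ‖w t - Φ t'‖ ≤ ε)) ∧
        (T.card = k + 1 → ∀ t ∈ Smp T, (1 - lam t) • Φ t + lam t • w t ∉ Subtype.val '' F) := by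
      intro T
      by_cases hT : T.card = k + 1
      · have hne : T.Nonempty := by
          rw [← Finset.card_pos]; omega
        let ε := T.inf' hne r
        have hε : 0 < ε := (Finset.lt_inf'_iff _).2 fun s _ => hr s
        obtain ⟨lam, w, h1, h2, h3, h4, h5, h6⟩ := local_fix hYcl hF T hne (by omega) Φ (hΦc T)
          (hΦY T) (by
            rintro t ht ⟨s, hs, hts⟩
            refine hΦF (T.erase s) (by rw [Finset.card_erase_of_mem hs]; omega) t ⟨ht.1, ?_, ?_⟩
            · intro s' hs'
              by_cases h : s' = s
              · rw [h, hts]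
              · exact ht.2.1 s' fun h' => hs' (Finset.mem_erase.2 ⟨h, h'⟩)
            · rw [Finset.sum_erase _ hts, ht.2.2]) hε
        exact ⟨lam, w, h1, h2, fun T₀ t ht hl => ⟨hT, h3 T₀ t ht hl⟩, h4,
          fun T₀ t ht => ⟨(h5 T₀ t ht).1, fun _ => ⟨ε, fun s hs => Finset.inf'_le _ hs,
            (h5 T₀ t ht).2⟩⟩, fun _ => h6⟩
      · exact ⟨fun _ => 0, Φ, continuous_const, fun t => ⟨le_rfl, zero_le_one⟩,
          fun T₀ t _ h => absurd rfl h, hΦc, fun T₀ t ht => ⟨hΦY T₀ t ht, fun h => absurd h hT⟩,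
          fun h => absurd h hT⟩
    choose lam w hlc hl01 hls hwc hw hav using hex
    let Φ' : (S → ℝ) → E := fun t => Φ t + ∑ᶠ T, lam T t • (w T t - Φ t)
    have hsub : ∀ T₀, ∀ t ∈ Smp T₀, ∀ T, lam T t ≠ 0 → T ⊆ T₀ := by
      intro T₀ t ht T hl s hs
      by_contra h
      have := ((hls T T₀ t ht hl).2 s hs).1
      rw [ht.2.1 s h] at this
      exact lt_irrefl _ this
    have huniq : ∀ T₀, ∀ t ∈ Smp T₀, ∀ T T', lam T t ≠ 0 → lam T' t ≠ 0 → T = T' := by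
      intro T₀ t ht T T' h h'
      obtain ⟨h1, h2⟩ := hls T T₀ t ht h
      obtain ⟨h1', h2'⟩ := hls T' T₀ t ht h'
      by_contra hne
      have h3 : ¬ T ⊆ T' := fun hh => hne (Finset.eq_of_subset_of_card_le hh (by omega))
      have h3' : ¬ T' ⊆ T := fun hh => hne (Finset.eq_of_subset_of_card_le hh (by omega)).symm
      obtain ⟨s, hs, hs'⟩ := Finset.not_subset.1 h3
      obtain ⟨v, hv, hv'⟩ := Finset.not_subset.1 h3'
      exact lt_asymm ((h2 s hs).2 v hv') ((h2' v hv).2 s hs')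
    have hval : ∀ T₀, ∀ t ∈ Smp T₀, ((∀ T, lam T t = 0) ∧ Φ' t = Φ t) ∨
        ∃ T, lam T t ≠ 0 ∧ Φ' t = (1 - lam T t) • Φ t + lam T t • w T t := by
      intro T₀ t ht
      by_cases h : ∀ T, lam T t = 0
      · left
        refine ⟨h, ?_⟩
        simp [Φ', h]
      · right
        push Not at h
        obtain ⟨T, hT⟩ := h
        refine ⟨T, hT, ?_⟩
        have : ∑ᶠ T, lam T t • (w T t - Φ t) = lam T t • (w T t - Φ t) := by
          refine finsum_eq_single _ T fun T' hT' => ?_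
          have : lam T' t = 0 := by
            by_contra h0
            exact hT' (huniq T₀ t ht T' T h0 hT)
          simp [this]
        simp only [Φ', this]
        module
    refine ⟨Φ', ?_, ?_, ?_, ?_⟩
    · intro T₀
      refine ContinuousOn.congr
        (f := fun t => Φ t + ∑ T ∈ T₀.powerset, lam T t • (w T t - Φ t)) ?_ ?_
      · exact (hΦc T₀).add (continuousOn_finsetSum _ fun T _ =>
          (hlc T).continuousOn.smul ((hwc T T₀).sub (hΦc T₀)))
      · intro t ht
        simp only [Φ']
        congr 1
        refine finsum_eq_sum_of_support_subset _ ?_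
        intro T hT
        simp only [Finset.mem_coe, Finset.mem_powerset]
        refine hsub T₀ t ht T ?_
        rintro h
        exact hT (by simp [h])
    · intro T₀ t ht
      rcases hval T₀ t ht with ⟨_, h⟩ | ⟨T, _, h⟩
      · rw [h]; exact hΦY T₀ t ht
      · rw [h]
        exact hYconv (hΦY T₀ t ht) (hw T T₀ t ht).1 (by linarith [(hl01 T t).2]) (hl01 T t).1
          (by ring)
    · intro T₀ hT₀ t ht
      rcases hval T₀ t ht with ⟨h0, h⟩ | ⟨T, h0, h⟩
      · rw [h]
        by_cases hk1 : T₀.card = k + 1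
        · simpa [h0 T₀] using hav T₀ hk1 t ht
        · exact hΦF T₀ (by omega) t ht
      · have h1 := hsub T₀ t ht T h0
        have h2 := (hls T T₀ t ht h0).1
        have h3 : T = T₀ := Finset.eq_of_subset_of_card_le h1 (by omega)
        subst h3
        rw [h]
        exact hav T h2 t ht
    · intro T₀ t ht z ρ hρ
      have hA : ‖Φ t - z‖ ≤ ρ := by
        refine hΦe T₀ t ht z ρ fun s hs => le_trans ?_ (hρ s hs)
        push_cast
        have := hr s
        nlinarith
      rcases hval T₀ t ht with ⟨_, h⟩ | ⟨T, h0, h⟩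
      · rw [h]; exact hA
      · rw [h]
        obtain ⟨hc, hs⟩ := hls T T₀ t ht h0
        obtain ⟨ε, hε, t', ht', hwt⟩ := (hw T T₀ t ht).2 hc
        have h1 : ‖Φ t' - z‖ ≤ ρ - ε := by
          refine hΦe T t' ht' z _ fun s hs' => ?_
          have hsT : s ∈ T := by
            by_contra h'
            exact hs' (ht'.2.1 s h')
          have h2 := hρ s (hs s hsT).1.ne'
          have h3 := hε s hsT
          push_cast at h2
          linarith
        have h2 : ‖w T t - z‖ ≤ ρ := by
          have : w T t - z = (w T t - Φ t') + (Φ t' - z) := by abel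
          rw [this]
          linarith [norm_add_le (w T t - Φ t') (Φ t' - z)]
        have h3 := (convex_closedBall z ρ) (x := Φ t) (y := w T t)
          (by rwa [Metric.mem_closedBall, dist_eq_norm])
          (by rwa [Metric.mem_closedBall, dist_eq_norm])
          (a := 1 - lam T t) (b := lam T t) (by linarith [(hl01 T t).2]) (hl01 T t).1 (by ring)
        rwa [Metric.mem_closedBall, dist_eq_norm] at h3

lemma single_dense {X E : Type*} [TopologicalSpace X] [T2Space X] [ParacompactSpace X]
    [NormedAddCommGroup E] [NormedSpace ℝ E] {n : ℕ} {H A : Set X} (hdim : CovDimLE ↥H n)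
    (hA : IsClosed A) (hAH : A ⊆ H) {Y : Set E} (hYcl : IsClosed Y) (hYconv : Convex ℝ Y)
    {F : Set ↥Y} (hF : IsZSet n F) (g : C(X, ↥Y)) (α : C(X, ℝ)) (hα : ∀ x, 0 < α x) :
    ∃ h : C(X, ↥Y), (∀ x, dist (g x) (h x) ≤ α x) ∧ ∀ x ∈ A, h x ∉ F := by
  classical
  let U : X → Set X := fun x₀ => {x | dist (g x₀) (g x) < α x₀ / 4} ∩ {x | α x₀ / 2 < α x}
  have hUo : ∀ x, IsOpen (U x) := fun x₀ =>
    (isOpen_lt (continuous_const.dist g.continuous) continuous_const).inter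
      (isOpen_lt continuous_const α.continuous)
  have hUc : ⋃ x, U x = Set.univ := by
    refine Set.eq_univ_of_forall fun x => Set.mem_iUnion.2 ⟨x, ?_, ?_⟩
    · simp only [Set.mem_ofPred_eq, dist_self]; linarith [hα x]
    · simp only [Set.mem_ofPred_eq]; linarith [hα x]
  obtain ⟨p, hpU, hpA⟩ := dowker hdim hA hAH U hUo hUc
  let r : X → ℝ := fun x => α x / (4 * ((n : ℝ) + 1))
  have hr : ∀ x, 0 < r x := fun x => div_pos (hα x) (by positivity)
  obtain ⟨Φ, hΦc, hΦY, hΦF, hΦe⟩ := skeleton hYcl hYconv hF (fun x => (g x : E))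
    (fun x => (g x).2) r hr (n + 1) le_rfl
  let P : X → X → ℝ := fun x s => p s x
  have hPc : Continuous P := continuous_pi fun s => (p s).continuous
  have hPS : ∀ x (T : Finset X), p.finsupport x ⊆ T → P x ∈ Smp T := by
    intro x T hT
    refine ⟨fun s => p.nonneg s x, ?_, ?_⟩
    · intro s hs
      by_contra h
      exact hs (hT ((p.mem_finsupport x).2 h))
    · exact p.sum_finsupport' (Set.mem_univ x) hT
  have hcont : Continuous fun x => Φ (P x) := by
    rw [continuous_iff_continuousAt]
    intro x₀
    have hev := p.eventually_finsupport_subset x₀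
    have h1 : ContinuousWithinAt Φ (Smp (p.fintsupport x₀)) (P x₀) :=
      hΦc _ _ (hPS x₀ _ hev.self_of_nhds)
    refine h1.tendsto.comp ?_
    rw [tendsto_nhdsWithin_iff]
    exact ⟨hPc.continuousAt, hev.mono fun x hx => hPS x _ hx⟩
  refine ⟨⟨fun x => ⟨Φ (P x), hΦY _ _ (hPS x _ (Finset.Subset.refl _))⟩,
    hcont.subtype_mk _⟩, ?_, ?_⟩
  · intro x
    rw [dist_comm]
    change dist (Φ (P x)) (g x : E) ≤ α x
    rw [dist_eq_norm]
    refine hΦe _ _ (hPS x _ (Finset.Subset.refl _)) _ _ ?_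
    intro s hs
    have hx : x ∈ U s := hpU s (subset_tsupport _ hs)
    have h1 : dist (g s : E) (g x : E) < α s / 4 := hx.1
    have h2 : α s / 2 < α x := hx.2
    rw [dist_eq_norm] at h1
    have h3 : ((n + 1 : ℕ) : ℝ) * r s = α s / 4 := by
      simp only [r]
      push_cast
      field_simp
    rw [h3]
    linarith
  · intro x hx hmem
    refine hΦF (p.finsupport x) ?_ _ (hPS x _ (Finset.Subset.refl _)) ⟨_, hmem, rfl⟩
    have := hpA x hx
    rw [← Set.ncard_coe_finset]
    rwa [p.coe_finsupport]

lemma single_open {X M : Type*} [TopologicalSpace X] [NormalSpace X] [PseudoMetricSpace M]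
    {A : Set X} (hA : IsClosed A) {F : Set M} (hF : IsClosed F) :
    SLOpen {g : C(X, M) | ∀ x ∈ A, g x ∉ F} := by
  intro g hg
  rcases F.eq_empty_or_nonempty with h | hne
  · exact ⟨ContinuousMap.const X 1, fun x => one_pos, fun h' _ => by simp [h]⟩
  let φ : X → ℝ := fun x => Metric.infDist (g x) F
  have hφ : Continuous φ := (Metric.continuous_infDist_pt F).comp g.continuous
  obtain ⟨f, hf0, hf1, hf⟩ := exists_continuous_zero_one_of_isClosed hA
    (isClosed_eq hφ continuous_const : IsClosed {x | φ x = 0}) (by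
      rw [Set.disjoint_left]
      intro x hx h0
      exact hg x hx ((hF.mem_iff_infDist_zero hne).2 h0))
  refine ⟨⟨fun x => (φ x + f x) / 2, (hφ.add f.continuous).div_const _⟩, ?_, ?_⟩
  · intro x
    have h1 : 0 ≤ φ x := Metric.infDist_nonneg
    have h2 := (hf x).1
    have : 0 < φ x + f x := by
      rcases h1.lt_or_eq with h | h
      · linarith
      · have : f x = 1 := hf1 h.symm
        linarith
    exact half_pos this
  · intro h hh x hx hmem
    have h1 : dist (g x) (h x) ≤ (φ x + f x) / 2 := hh x
    have h2 : f x = 0 := hf0 hx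
    have h3 : φ x ≤ dist (g x) (h x) := Metric.infDist_le_dist_of_mem hmem
    have h4 : 0 < φ x := (hF.notMem_iff_infDist_pos hne).1 (hg x hx)
    linarith

lemma sl_baire {X M : Type*} [TopologicalSpace X] [PseudoMetricSpace M] [CompleteSpace M]
    (D : ℕ → Set C(X, M)) (hDo : ∀ i, SLOpen (D i))
    (hDd : ∀ i, ∀ (g : C(X, M)) (α : C(X, ℝ)), (∀ x, 0 < α x) →
      ∃ h ∈ D i, ∀ x, dist (g x) (h x) ≤ α x) : SLDense (⋂ i, D i) := by
  rintro U hU ⟨g₀, hg₀⟩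
  obtain ⟨α₀, hα₀, hαU⟩ := hU g₀ hg₀
  let St := {q : C(X, M) × C(X, ℝ) // ∀ x, 0 < q.2 x}
  have step : ∀ (i : ℕ) (q : St), ∃ q' : St, (∀ x, dist (q.1.1 x) (q'.1.1 x) ≤ q.1.2 x / 2) ∧
      (∀ x, q'.1.2 x ≤ q.1.2 x / 2) ∧
      {h : C(X, M) | ∀ x, dist (q'.1.1 x) (h x) ≤ q'.1.2 x} ⊆ D i := by
    rintro i ⟨⟨g, α⟩, hα⟩
    obtain ⟨h, hD, hh⟩ := hDd i g ⟨fun x => α x / 2, α.continuous.div_const _⟩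
      (fun x => half_pos (hα x))
    obtain ⟨β, hβ, hβD⟩ := hDo i h hD
    refine ⟨⟨⟨h, ⟨fun x => min (α x / 2) (β x), (α.continuous.div_const _).min β.continuous⟩⟩,
      fun x => lt_min (half_pos (hα x)) (hβ x)⟩, hh, fun x => min_le_left _ _, ?_⟩
    intro h' hh'
    exact hβD fun x => (hh' x).trans (min_le_right _ _)
  choose nxt h1 h2 h3 using step
  let q₀ : St := ⟨⟨g₀, ⟨fun x => min (α₀ x) 1, α₀.continuous.min continuous_const⟩⟩,
    fun x => lt_min (hα₀ x) one_pos⟩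
  let Q : ℕ → St := fun k => Nat.rec q₀ (fun i q => nxt i q) k
  have hQ : ∀ i, Q (i + 1) = nxt i (Q i) := fun i => rfl
  have hd : ∀ i x, dist ((Q i).1.1 x) ((Q (i + 1)).1.1 x) ≤ (Q i).1.2 x / 2 := fun i => by
    rw [hQ]; exact h1 i (Q i)
  have ha : ∀ i x, (Q (i + 1)).1.2 x ≤ (Q i).1.2 x / 2 := fun i => by
    rw [hQ]; exact h2 i (Q i)
  have hb : ∀ i, {h : C(X, M) | ∀ x, dist ((Q (i + 1)).1.1 x) (h x) ≤ (Q (i + 1)).1.2 x} ⊆ D i :=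
    fun i => by rw [hQ]; exact h3 i (Q i)
  -- telescoping bound
  have htel : ∀ i m x, dist ((Q i).1.1 x) ((Q (i + m)).1.1 x) ≤
      (Q i).1.2 x - (Q (i + m)).1.2 x := by
    intro i m x
    induction m with
    | zero => simp
    | succ m ih =>
      have := dist_triangle ((Q i).1.1 x) ((Q (i + m)).1.1 x) ((Q (i + (m + 1))).1.1 x)
      have h4 := hd (i + m) x
      have h5 := ha (i + m) x
      rw [add_assoc] at h4 h5
      linarith
  have hle : ∀ i m x, dist ((Q i).1.1 x) ((Q (i + m)).1.1 x) ≤ (Q i).1.2 x := fun i m x =>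
    (htel i m x).trans (by linarith [(Q (i + m)).2 x])
  have hpow : ∀ i x, (Q i).1.2 x ≤ (1 / 2) ^ i := by
    intro i x
    induction i with
    | zero => exact (min_le_right _ _).trans (by simp)
    | succ i ih =>
      have := ha i x
      rw [pow_succ]
      linarith
  have hlim0 : Filter.Tendsto (fun i : ℕ => ((1 : ℝ) / 2) ^ i) Filter.atTop (𝓝 0) :=
    tendsto_pow_atTop_nhds_zero_of_lt_one (by norm_num) (by norm_num)
  have hcau : ∀ x, CauchySeq fun i => (Q i).1.1 x := by
    intro x
    refine cauchySeq_of_le_tendsto_0' (fun i => ((1 : ℝ) / 2) ^ i) ?_ hlim0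
    intro i m him
    obtain ⟨k, rfl⟩ := Nat.exists_eq_add_of_le him
    exact (hle i k x).trans (hpow i x)
  choose G hG using fun x => cauchySeq_tendsto_of_complete (hcau x)
  have hGle : ∀ i x, dist ((Q i).1.1 x) (G x) ≤ (Q i).1.2 x := by
    intro i x
    refine le_of_tendsto (tendsto_const_nhds.dist ((Filter.tendsto_add_atTop_iff_nat i).2 (hG x))) ?_
    refine Filter.Eventually.of_forall fun m => ?_
    rw [add_comm]
    exact hle i m x
  have hGc : Continuous G := by
    have : TendstoUniformly (fun i => ((Q i).1.1 : X → M)) G Filter.atTop := by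
      rw [Metric.tendstoUniformly_iff]
      intro ε hε
      filter_upwards [hlim0.eventually (gt_mem_nhds hε)] with i hi x
      rw [dist_comm]
      exact ((hGle i x).trans (hpow i x)).trans_lt hi
    exact this.continuous (Filter.Frequently.of_forall fun i => (Q i).1.1.continuous)
  refine ⟨⟨G, hGc⟩, hαU fun x => (hGle 0 x).trans (min_le_left _ _), ?_⟩
  exact Set.mem_iInter.2 fun i => hb i fun x => hGle (i + 1) x

/-- Lemma 4.2. Let `X` be paracompact Hausdorff and `H = ⋃ᵢ Hᵢ ⊆ X` with each
`Hᵢ` closed and `dim H ≤ n`. Let `E` be a Banach space, `Y ⊆ E` closed convex, and `K` a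
`σZ_n`-set in `Y`. Then `{g ∈ C(X, Y) : g(H) ∩ K = ∅}` is dense and `G_δ` in `C(X, Y)` with the
source limitation topology. -/
theorem stmt14 {X E : Type*} [TopologicalSpace X] [T2Space X] [ParacompactSpace X]
    [NormedAddCommGroup E] [NormedSpace ℝ E] [CompleteSpace E]
    (n : ℕ) (H : ℕ → Set X) (hHcl : ∀ i, IsClosed (H i))
    (hdimH : CovDimLE ↥(⋃ i, H i) n)
    (Y : Set E) (hYcl : IsClosed Y) (hYconv : Convex ℝ Y)
    (K : Set ↥Y) (hK : IsSigmaZSet n K) :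
    SLDense {g : C(X, ↥Y) | ∀ x ∈ ⋃ i, H i, g x ∉ K} ∧
    SLGdelta {g : C(X, ↥Y) | ∀ x ∈ ⋃ i, H i, g x ∉ K} := by
  obtain ⟨F, hF, rfl⟩ := hK
  let D : ℕ → Set C(X, ↥Y) := fun k =>
    {g | ∀ x ∈ H (Nat.unpair k).1, g x ∉ F (Nat.unpair k).2}
  have hD : {g : C(X, ↥Y) | ∀ x ∈ ⋃ i, H i, g x ∉ ⋃ i, F i} = ⋂ k, D k := by
    ext g
    simp only [Set.mem_ofPred_eq, Set.mem_iInter, D, Set.mem_iUnion, not_exists]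
    constructor
    · intro h k x hx
      exact h x ⟨_, hx⟩ _
    · rintro h x ⟨i, hi⟩ j
      have := h (Nat.pair i j) x
      rw [Nat.unpair_pair] at this
      exact this hi
  have hDo : ∀ k, SLOpen (D k) := fun k => single_open (hHcl _) (hF _).1
  have : CompleteSpace ↥Y := hYcl.completeSpace_coe
  rw [hD]
  refine ⟨sl_baire D hDo ?_, D, hDo, rfl⟩
  intro k g α hα
  obtain ⟨h, h1, h2⟩ := single_dense hdimH (hHcl (Nat.unpair k).1)
    (Set.subset_iUnion H _) hYcl hYconv (hF (Nat.unpair k).2) g α hα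
  exact ⟨h, h2, h1⟩
end
end

section
/- Let f : X → Y be a perfect surjection of countable functional weight between paracompact Hausdorff spaces with dim f ≤ n and dim Y ≤ m. Let N^{2n+1+m}_{n+m} denote the set of all points of I^{2n+1+m} having at most n + m rational coordinates. Then the set N of all g ∈ C(X, I^{2n+1+m}) such that f × g is an embedding and g(X) ⊂ N^{2n+1+m}_{n+m} is dense and G_δ in C(X, I^{2n+1+m}) with the source limitation topology. -/
open Set Topology

noncomputable section

lemma gp_smooth {ι : Type*} [Fintype ι] {m r : ℕ} {F : Type*} [NormedAddCommGroup F]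
    [NormedSpace ℝ F] [FiniteDimensional ℝ F] (hq : r + m ≤ Module.finrank ℝ F)
    (𝒲 : Set (Submodule ℝ (ι → ℝ))) (h𝒲 : 𝒲.Countable)
    (hr : ∀ W ∈ 𝒲, Module.finrank ℝ W ≤ r)
    (c : (Fin m → ℝ) → ι → F) (hc : ContDiff ℝ 1 c) :
    Dense {b : ι → F | ∀ t, ∀ W ∈ 𝒲, ∀ a ∈ W, a ≠ 0 → ∑ i, a i • (c t i + b i) ≠ 0} := by
  classical
  -- bad set for a given W, i0, a0
  have key : ∀ W ∈ 𝒲, ∀ i0 : ι, ∀ a0 ∈ W, a0 i0 = 1 →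
      dimH {b : ι → F | ∃ t, ∃ a ∈ W, a i0 = 1 ∧ ∑ i, a i • (c t i + b i) = 0} ≤
        ((Module.finrank ℝ (ι → F) - 1 : ℕ) : ENNReal) ∧ 1 ≤ Module.finrank ℝ (ι → F) := by
    intro W hW i0 a0 ha0 h1
    let W0 : Submodule ℝ (ι → ℝ) := W ⊓ LinearMap.ker (LinearMap.proj (R := ℝ) (φ := fun _ : ι => ℝ) i0)
    have hW0 : Module.finrank ℝ W0 < Module.finrank ℝ W := by
      apply Submodule.finrank_lt_finrank_of_lt
      refine lt_of_le_of_ne inf_le_left ?_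
      intro h
      have : a0 ∈ W0 := by rw [h]; exact ha0
      have h2 : a0 i0 = 0 := by simpa using this.2
      rw [h1] at h2
      exact one_ne_zero h2
    let J := {i : ι // i ≠ i0}
    let Φ : ((Fin m → ℝ) × W0 × (J → F)) → (ι → F) := fun p i =>
      if h : i = i0 then
        - c p.1 i0 - ∑ j : J, (a0 j.1 + (p.2.1 : ι → ℝ) j.1) • (c p.1 j.1 + p.2.2 j)
      else p.2.2 ⟨i, h⟩
    have hci : ∀ i, ContDiff ℝ 1 (fun t => c t i) := fun i => contDiff_pi.1 hc i
    have hΦ : ContDiff ℝ 1 Φ := by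
      rw [contDiff_pi]
      intro i
      by_cases h : i = i0
      · simp only [Φ, h, dite_true]
        refine ContDiff.sub ((hci i0).comp contDiff_fst).neg ?_
        refine ContDiff.sum fun j _ => ?_
        refine ContDiff.smul (contDiff_const.add ?_) (ContDiff.add ((hci j.1).comp contDiff_fst) ?_)
        · exact (((ContinuousLinearMap.proj (R := ℝ) (φ := fun _ : ι => ℝ) j.1).comp
            W0.subtypeL).contDiff).comp (contDiff_fst.comp contDiff_snd)
        · exact (contDiff_apply ℝ F j).comp (contDiff_snd.comp contDiff_snd)
      · simp only [Φ, h, dite_false]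
        exact (contDiff_apply ℝ F (⟨i, h⟩ : J)).comp (contDiff_snd.comp contDiff_snd)
    have hcard : Fintype.card J + 1 = Fintype.card ι := by
      have : Fintype.card J = Fintype.card ι - 1 := by
        rw [show Fintype.card J = Fintype.card {i : ι // i ≠ i0} from rfl]
        simp [Fintype.card_subtype_compl]
      have : 0 < Fintype.card ι := Fintype.card_pos_iff.2 ⟨i0⟩
      omega
    have hd1 : Module.finrank ℝ ((Fin m → ℝ) × W0 × (J → F)) =
        m + (Module.finrank ℝ W0 + Fintype.card J * Module.finrank ℝ F) := by
      simp [Module.finrank_prod, Module.finrank_pi_fintype]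
    have hd2 : Module.finrank ℝ (ι → F) =
        Fintype.card J * Module.finrank ℝ F + Module.finrank ℝ F := by
      rw [Module.finrank_pi_fintype]
      simp [← hcard, add_mul]
    have hWr := hr W hW
    refine ⟨?_, by omega⟩
    refine (dimH_mono (t := range Φ) ?_).trans (hΦ.dimH_range_le.trans ?_)
    · rintro b ⟨t, a, haW, hai, hsum⟩
      refine ⟨(t, ⟨a - a0, ⟨W.sub_mem haW ha0, by simp [hai, h1]⟩⟩, fun j => b j.1), ?_⟩
      funext i
      by_cases h : i = i0
      · subst h
        simp only [Φ, dite_true]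
        have : ∑ j : J, a j.1 • (c t j.1 + b j.1) = - (c t i + b i) := by
          rw [← Finset.add_sum_erase _ _ (Finset.mem_univ i)] at hsum
          rw [hai, one_smul] at hsum
          rw [eq_neg_iff_add_eq_zero, ← hsum, add_comm]
          congr 1
          rw [← Finset.sum_subtype (Finset.univ.erase i) (by simp)
            (fun j => a j • (c t j + b j))]
        simp only [Pi.sub_apply, add_sub_cancel]
        rw [this]; abel
      · simp [Φ, h]
    · rw [hd1]
      have : m + (Module.finrank ℝ W0 + Fintype.card J * Module.finrank ℝ F) ≤
        Module.finrank ℝ (ι → F) - 1 := by omega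
      exact_mod_cast this
  let B : Set (ι → F) := ⋃ W ∈ 𝒲, ⋃ i0 : ι,
    {b : ι → F | ∃ t, ∃ a ∈ W, a i0 = 1 ∧ ∑ i, a i • (c t i + b i) = 0}
  by_cases hpos : 1 ≤ Module.finrank ℝ (ι → F)
  swap
  · -- finrank zero: all bad sets are empty
    have : {b : ι → F | ∀ t, ∀ W ∈ 𝒲, ∀ a ∈ W, a ≠ 0 → ∑ i, a i • (c t i + b i) ≠ 0} = univ := by
      rw [eq_univ_iff_forall]
      intro b t W hW a ha hane _
      obtain ⟨i0, hi0⟩ := Function.ne_iff.1 hane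
      exact hpos (key W hW i0 ((a i0)⁻¹ • a) (W.smul_mem _ ha)
        (by simp; exact inv_mul_cancel₀ hi0)).2
    rw [this]; exact dense_univ
  have hB : dimH B < Module.finrank ℝ (ι → F) := by
    refine lt_of_le_of_lt (b := ((Module.finrank ℝ (ι → F) - 1 : ℕ) : ENNReal)) ?_
      (by exact_mod_cast (by omega : Module.finrank ℝ (ι → F) - 1 < Module.finrank ℝ (ι → F)))
    rw [dimH_bUnion h𝒲]
    refine iSup₂_le fun W hW => ?_
    rw [dimH_iUnion]
    refine iSup_le fun i0 => ?_
    by_cases h : ∃ a0 ∈ W, a0 i0 = 1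
    · obtain ⟨a0, ha0, h1⟩ := h
      exact (key W hW i0 a0 ha0 h1).1
    · have : {b : ι → F | ∃ t, ∃ a ∈ W, a i0 = 1 ∧ ∑ i, a i • (c t i + b i) = 0} = ∅ := by
        rw [eq_empty_iff_forall_notMem]
        rintro b ⟨t, a, ha, h1, _⟩
        exact h ⟨a, ha, h1⟩
      rw [this]; simp
  refine (dense_compl_of_dimH_lt_finrank hB).mono ?_
  intro b hb t W hW a ha hane hsum
  apply hb
  obtain ⟨i0, hi0⟩ := Function.ne_iff.1 hane
  simp only [B, mem_iUnion]
  refine ⟨W, hW, i0, t, (a i0)⁻¹ • a, W.smul_mem _ ha, by simp; exact inv_mul_cancel₀ hi0, ?_⟩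
  simp only [Pi.smul_apply, smul_eq_mul, mul_smul]
  rw [← Finset.smul_sum, hsum, smul_zero]

lemma gp_approx {ι : Type*} [Fintype ι] {m r : ℕ} {F : Type*} [NormedAddCommGroup F]
    [NormedSpace ℝ F] [FiniteDimensional ℝ F] (hq : r + m ≤ Module.finrank ℝ F)
    (𝒲 : Set (Submodule ℝ (ι → ℝ))) (h𝒲 : 𝒲.Countable)
    (hr : ∀ W ∈ 𝒲, Module.finrank ℝ W ≤ r)
    {T : Type*} [TopologicalSpace T] [CompactSpace T] (e : T → Fin m → ℝ) (he : Continuous e)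
    (hinj : Function.Injective e) (c : C(T, ι → F)) {ε : ℝ} (hε : 0 < ε) :
    ∃ c' : C(T, ι → F), (∀ t, dist (c' t) (c t) < ε) ∧
      ∀ t, ∀ W ∈ 𝒲, ∀ a ∈ W, a ≠ 0 → ∑ i, a i • c' t i ≠ 0 := by
  have hemb : IsClosedEmbedding e := he.isClosedEmbedding hinj
  have : T2Space T := hemb.isEmbedding.t2Space
  -- continuous extension
  obtain ⟨C, hC⟩ : ∃ C : C(Fin m → ℝ, ι → F), ∀ t, C (e t) = c t := by
    let φ : (ι → F) ≃L[ℝ] (Fin (Module.finrank ℝ (ι → F)) → ℝ) :=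
      ContinuousLinearEquiv.ofFinrankEq (by simp)
    obtain ⟨g, hg⟩ := ContinuousMap.exists_extension' (hemb) ((⟨φ, φ.continuous⟩ : C(_, _)).comp c)
    refine ⟨(⟨φ.symm, φ.symm.continuous⟩ : C(_, _)).comp g, fun t => ?_⟩
    have := congrFun hg t
    simp at this
    simp [this]
  have hK : IsCompact (range e) := isCompact_range he
  have h1 := (ContinuousMap.dense_setOfPred_contDiff (E := Fin m → ℝ) (F := ι → F)) C
  rw [mem_closure_iff_nhds_basis
    (nhds_basis_uniformity Metric.uniformity_basis_dist.compactConvergenceUniformity)] at h1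
  obtain ⟨g, hg, hgC⟩ := h1 (range e, ε / 2) ⟨hK, half_pos hε⟩
  have hg' : ContDiff ℝ 1 g := ContDiff.of_le (n := (⊤ : ℕ∞)) hg (by exact_mod_cast le_top)
  have hgC' : ∀ x ∈ range e, dist (g x) (C x) < ε / 2 := hgC
  have hd := gp_smooth hq 𝒲 h𝒲 hr g hg'
  obtain ⟨b, hb, hb0⟩ := hd.exists_dist_lt 0 (half_pos hε)
  refine ⟨⟨fun t => g (e t) + b, by fun_prop⟩, fun t => ?_, fun t W hW a ha hane => ?_⟩
  · have := hgC' (e t) (mem_range_self t)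
    simp only [hC, ContinuousMap.coe_mk] at this ⊢
    have h2 : dist (g (e t) + b) (g (e t)) < ε / 2 := by
      rw [dist_eq_norm]; rw [dist_eq_norm] at hb0; simpa using hb0
    have h3 : dist (g (e t)) (c t) < ε / 2 := by
      exact this
    linarith [dist_triangle (g (e t) + b) (g (e t)) (c t)]
  · exact hb (e t) W hW a ha hane

lemma CovDimLE.fin {X : Type*} [TopologicalSpace X] {n : ℕ} (h : CovDimLE X n)
    {ι : Type*} [Finite ι] (U : ι → Set X) (hU : ∀ i, IsOpen (U i)) (hc : (⋃ i, U i) = univ) :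
    ∃ V : ι → Set X, (∀ i, IsOpen (V i)) ∧ (∀ i, V i ⊆ U i) ∧ (⋃ i, V i) = univ ∧
      ∀ x : X, {i | x ∈ V i}.ncard ≤ n + 1 := by
  obtain ⟨N, ⟨e⟩⟩ := Finite.exists_equiv_fin ι
  obtain ⟨V, h1, h2, h3, h4⟩ := h (Fin N) (fun j => U (e.symm j)) inferInstance (fun j => hU _)
    (by rw [← hc]; exact e.symm.surjective.iUnion_comp U)
  refine ⟨fun i => V (e i), fun i => h1 _, fun i => ?_, ?_, fun x => ?_⟩
  · simpa using h2 (e i)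
  · rw [← h3]; exact e.surjective.iUnion_comp V
  · have h5 : {i | x ∈ V (e i)} = e ⁻¹' {i | x ∈ V i} := rfl
    rw [h5, ncard_preimage_of_injective_subset_range e.injective (by simp [e.surjective.range_eq])]
    exact_mod_cast h4 x

/-- State of the Zorn argument in Dowker's theorem. -/
structure DState {Y ι S : Type*} [TopologicalSpace Y] (U : ι → Set Y) (C : S → Set Y) (m : ℕ) where
  S' : Set S
  W : ι → Set Y
  op : ∀ i, IsOpen (W i)
  sub : ∀ i, W i ⊆ U i
  cov : (⋃ i, W i) = univ
  ord : ∀ s ∈ S', ∀ y ∈ C s, {i | y ∈ W i}.ncard ≤ m + 1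

instance {Y ι S : Type*} [TopologicalSpace Y] (U : ι → Set Y) (C : S → Set Y) (m : ℕ) :
    Preorder (DState U C m) where
  le a b := a.S' ⊆ b.S' ∧ (∀ i, b.W i ⊆ a.W i) ∧
    ∀ i, ∀ y ∈ a.W i, (∀ s ∈ b.S', s ∉ a.S' → y ∉ C s) → y ∈ b.W i
  le_refl a := ⟨Subset.rfl, fun _ => Subset.rfl, fun _ _ h _ => h⟩
  le_trans a b c h1 h2 := ⟨h1.1.trans h2.1, fun i => (h2.2.1 i).trans (h1.2.1 i),
    fun i y hy h => h2.2.2 i y (h1.2.2 i y hy fun s hs hs' => h s (h2.1 hs) hs')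
      fun s hs hs' => h s hs fun h' => hs' (h1.1 h')⟩

lemma dowker_s15 {Y : Type*} [TopologicalSpace Y] [T2Space Y] [ParacompactSpace Y] {m : ℕ}
    (hdim : CovDimLE Y m) {ι : Type*} (U : ι → Set Y) (hU : ∀ i, IsOpen (U i))
    (hlf : LocallyFinite U) (hc : (⋃ i, U i) = univ) :
    ∃ V : ι → Set Y, (∀ i, IsOpen (V i)) ∧ (∀ i, V i ⊆ U i) ∧ (⋃ i, V i) = univ ∧
      ∀ x : Y, {i | x ∈ V i}.ncard ≤ m + 1 := by
  classical
  -- the closed cover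
  obtain ⟨C, hCcl, hClf, hCcov, hCfin⟩ : ∃ C : Y → Set Y, (∀ s, IsClosed (C s)) ∧
      LocallyFinite C ∧ (⋃ s, C s) = univ ∧ ∀ s, {i | (U i ∩ C s).Nonempty}.Finite := by
    choose O hO hOf using hlf
    obtain ⟨O', hO'o, hO'c, hO'lf, hO'sub⟩ := precise_refinement (fun y => interior (O y))
      (fun y => isOpen_interior)
      (eq_univ_of_forall fun y => mem_iUnion.2 ⟨y, mem_interior_iff_mem_nhds.2 (hO y)⟩)
    obtain ⟨C, hC, hCc, hCs⟩ := exists_iUnion_eq_closed_subset hO'o (fun x => hO'lf.point_finite x) hO'c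
    refine ⟨C, hCc, hO'lf.subset hCs, hC, fun s => (hOf s).subset ?_⟩
    rintro i ⟨y, hy1, hy2⟩
    exact ⟨y, hy1, interior_subset (hO'sub s (hCs s hy2))⟩
  have zorn : ∃ M : DState U C m, IsMax M := by
    have : Nonempty (DState U C m) := ⟨⟨∅, U, hU, fun _ => Subset.rfl, hc, fun s hs => hs.elim⟩⟩
    apply zorn_le_nonempty
    intro c hchain hne
    have : Nonempty c := hne.to_subtype
    have hdir : Directed (· ≤ ·) (fun a : c => a.1) := hchain.directed
    have stab : ∀ y, ∃ c0 ∈ c, ∃ N, IsOpen N ∧ y ∈ N ∧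
        ∀ d ∈ c, ∀ i, ∀ z ∈ N, z ∈ c0.W i → z ∈ d.W i := by
      intro y
      obtain ⟨N, hN, hNf⟩ := hClf y
      obtain ⟨N', hN'N, hN'o, hyN'⟩ := mem_nhds_iff.1 hN
      let Φ := {s // (C s ∩ N).Nonempty ∧ ∃ d ∈ c, s ∈ d.S'}
      have : Finite Φ := hNf.subset fun s hs => hs.1
      have hch : ∀ s : Φ, ∃ d : c, s.1 ∈ d.1.S' := fun s =>
        let ⟨d, hd, hs⟩ := s.2.2
        ⟨⟨d, hd⟩, hs⟩
      choose q hq using hch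
      obtain ⟨z, hz⟩ := hdir.finite_le q
      refine ⟨z.1, z.2, N', hN'o, hyN', fun d hd i w hw hwz => ?_⟩
      rcases hchain.total z.2 hd with h | h
      · refine h.2.2 i w hwz fun s hs hsz hwC => hsz ?_
        exact (hz ⟨s, ⟨w, hwC, hN'N hw⟩, d, hd, hs⟩).1 (hq _)
      · exact h.2.1 i hwz
    let ub : DState U C m :=
      { S' := ⋃ d ∈ c, d.S'
        W := fun i => ⋂ d ∈ c, d.W i
        op := by
          intro i
          rw [isOpen_iff_mem_nhds]
          intro y hy
          obtain ⟨c0, hc0, N, hN, hyN, h⟩ := stab y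
          filter_upwards [hN.mem_nhds hyN, (c0.op i).mem_nhds (mem_iInter₂.1 hy c0 hc0)]
            with z hz1 hz2
          exact mem_iInter₂.2 fun d hd => h d hd i z hz1 hz2
        sub := fun i z hz => hne.elim fun d hd => d.sub i (mem_iInter₂.1 hz d hd)
        cov := by
          refine eq_univ_of_forall fun y => ?_
          obtain ⟨c0, hc0, N, hN, hyN, h⟩ := stab y
          obtain ⟨i, hi⟩ := mem_iUnion.1 (c0.cov.ge (mem_univ y))
          exact mem_iUnion.2 ⟨i, mem_iInter₂.2 fun d hd => h d hd i y hyN hi⟩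
        ord := by
          intro s hs y hy
          obtain ⟨d, hd, hsd⟩ := mem_iUnion₂.1 hs
          refine le_trans (ncard_le_ncard (fun i hi => mem_iInter₂.1 hi d hd) ?_) (d.ord s hsd y hy)
          exact (hlf.point_finite y).subset fun i hi => d.sub i hi }
    refine ⟨ub, fun d hd => ⟨fun s hs => mem_iUnion₂.2 ⟨d, hd, hs⟩,
      fun i z hz => mem_iInter₂.1 hz d hd, fun i z hz h => mem_iInter₂.2 fun d' hd' => ?_⟩⟩
    rcases hchain.total hd hd' with h' | h'
    · exact h'.2.2 i z hz fun s hs hs' => h s (mem_iUnion₂.2 ⟨d', hd', hs⟩) hs'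
    · exact h'.2.1 i hz
  obtain ⟨M, hM⟩ := zorn
  refine ⟨M.W, M.op, M.sub, M.cov, fun y => ?_⟩
  obtain ⟨s, hs⟩ := mem_iUnion.1 (hCcov.ge (mem_univ y))
  by_contra hcon
  have hsM : s ∉ M.S' := fun h => hcon (M.ord s h y hs)
  let Fs := {i // (U i ∩ C s).Nonempty}
  have : Finite Fs := (hCfin s)
  have hmem : ∀ i z, z ∈ M.W i → z ∈ C s → (U i ∩ C s).Nonempty :=
    fun i z h1 h2 => ⟨z, M.sub i h1, h2⟩
  obtain ⟨V, hV1, hV2, hV3, hV4⟩ := hdim.fin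
    (fun o : Option Fs => o.elim (C s)ᶜ (fun i => M.W i.1))
    (by rintro (_ | i)
        · exact (hCcl s).isOpen_compl
        · exact M.op _)
    (by refine eq_univ_of_forall fun z => ?_
        by_cases hz : z ∈ C s
        · obtain ⟨i, hi⟩ := mem_iUnion.1 (M.cov.ge (mem_univ z))
          exact mem_iUnion.2 ⟨some ⟨i, hmem i z hi hz⟩, hi⟩
        · exact mem_iUnion.2 ⟨none, hz⟩)
  let V' : ι → Set Y := fun i => if h : (U i ∩ C s).Nonempty then V (some ⟨i, h⟩) else ∅
  have hV'o : ∀ i, IsOpen (V' i) := by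
    intro i; simp only [V']; split_ifs
    · exact hV1 _
    · exact isOpen_empty
  have hV's : ∀ i, V' i ⊆ M.W i := by
    intro i; simp only [V']; split_ifs with h
    · exact hV2 (some ⟨i, h⟩)
    · exact empty_subset _
  have hWo : ∀ i z, z ∈ C s → (z ∈ V' i ∪ (M.W i \ C s) ↔ z ∈ V' i) := by
    intro i z hz
    simp [hz]
  have hWs : ∀ i, V' i ∪ (M.W i \ C s) ⊆ M.W i := fun i => union_subset (hV's i) sdiff_subset
  have hWn : ∀ z ∈ C s, {i | z ∈ V' i ∪ (M.W i \ C s)}.ncard ≤ m + 1 := by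
    intro z hz
    have : {i | z ∈ V' i ∪ (M.W i \ C s)} = (fun o : Fs => o.1) '' {i | z ∈ V (some i)} := by
      ext i
      rw [mem_ofPred_eq, hWo i z hz]
      simp only [V', mem_image, mem_ofPred_eq]
      constructor
      · intro h
        split_ifs at h with h'
        · exact ⟨⟨i, h'⟩, h, rfl⟩
        · exact h.elim
      · rintro ⟨o, ho, rfl⟩
        rw [dif_pos o.2]; exact ho
    rw [this]
    refine (ncard_image_le (toFinite _)).trans ?_
    refine le_trans ?_ (hV4 z)
    rw [← ncard_image_of_injective _ (Option.some_injective Fs)]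
    refine ncard_le_ncard ?_ (toFinite _)
    rintro _ ⟨i, hi, rfl⟩
    exact hi
  let M' : DState U C m :=
    { S' := insert s M.S'
      W := fun i => V' i ∪ (M.W i \ C s)
      op := fun i => (hV'o i).union ((M.op i).sdiff (hCcl s))
      sub := fun i => (hWs i).trans (M.sub i)
      cov := by
        refine eq_univ_of_forall fun z => ?_
        by_cases hz : z ∈ C s
        · obtain ⟨o, ho⟩ := mem_iUnion.1 (hV3.ge (mem_univ z))
          rcases o with _ | i
          · exact absurd hz (hV2 none ho)
          · refine mem_iUnion.2 ⟨i.1, Or.inl ?_⟩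
            simp only [V']; rw [dif_pos i.2]; exact ho
        · obtain ⟨i, hi⟩ := mem_iUnion.1 (M.cov.ge (mem_univ z))
          exact mem_iUnion.2 ⟨i, Or.inr ⟨hi, hz⟩⟩
      ord := by
        rintro s' (rfl | hs') z hz
        · exact hWn z hz
        · refine le_trans (ncard_le_ncard (fun i hi => hWs i hi) ?_) (M.ord s' hs' z hz)
          exact (hlf.point_finite z).subset fun i hi => M.sub i hi }
  have hle : M ≤ M' := by
    refine ⟨subset_insert _ _, hWs, fun i z hz h => Or.inr ⟨hz, h s (mem_insert _ _) hsM⟩⟩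
  exact hsM ((hM hle).1 (mem_insert _ _))

/-- The face of the infinite simplex spanned by the vertices in `σ`. -/
def Dl {A : Type*} (σ : Finset A) : Set (A → ℝ) :=
  {t | (∀ a, 0 ≤ t a) ∧ (∀ a, a ∉ σ → t a = 0) ∧ ∑ a ∈ σ, t a = 1}

lemma Dl.le_one {A : Type*} {σ : Finset A} {t : A → ℝ} (ht : t ∈ Dl σ) (a : A) : t a ≤ 1 := by
  by_cases ha : a ∈ σ
  · rw [← ht.2.2]; exact Finset.single_le_sum (fun i _ => ht.1 i) ha
  · rw [ht.2.1 a ha]; exact zero_le_one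

lemma Dl.isClosed {A : Type*} (σ : Finset A) : IsClosed (Dl σ) := by
  have h : Dl σ = (⋂ a, {t : A → ℝ | 0 ≤ t a}) ∩ ((⋂ a, ⋂ (_ : a ∉ σ), {t : A → ℝ | t a = 0}) ∩
      {t : A → ℝ | ∑ a ∈ σ, t a = 1}) := by
    ext t; simp [Dl]
  rw [h]
  refine IsClosed.inter (isClosed_iInter fun a => isClosed_le continuous_const (continuous_apply a))
    (IsClosed.inter (isClosed_iInter fun a => isClosed_iInter fun _ =>
      isClosed_eq (continuous_apply a) continuous_const) (isClosed_eq ?_ continuous_const))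
  exact continuous_finsetSum _ fun a _ => continuous_apply a

lemma Dl.isCompact {A : Type*} (σ : Finset A) : IsCompact (Dl σ) := by
  refine IsCompact.of_isClosed_subset (isCompact_univ_pi (s := fun _ : A => Icc (0:ℝ) 1)
    (fun _ => isCompact_Icc)) (Dl.isClosed σ) ?_
  intro t ht a _
  exact ⟨ht.1 a, Dl.le_one ht a⟩

lemma Dl.mono {A : Type*} {σ τ : Finset A} (h : σ ⊆ τ) : Dl σ ⊆ Dl τ := by
  intro t ht
  refine ⟨ht.1, fun a ha => ht.2.1 a fun h' => ha (h h'), ?_⟩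
  rw [← ht.2.2]
  exact (Finset.sum_subset h fun a _ ha => ht.2.1 a ha).symm

lemma Dl.of_zero {A : Type*} {σ τ : Finset A} (h : τ ⊆ σ) {t : A → ℝ} (ht : t ∈ Dl σ)
    (h0 : ∀ a ∈ σ, a ∉ τ → t a = 0) : t ∈ Dl τ := by
  refine ⟨ht.1, fun a ha => ?_, ?_⟩
  · by_cases h' : a ∈ σ
    · exact h0 a h' ha
    · exact ht.2.1 a h'
  · rw [← ht.2.2]
    exact Finset.sum_subset h h0

lemma Dl.nonempty {A : Type*} {σ : Finset A} {t : A → ℝ} (ht : t ∈ Dl σ) : σ.Nonempty := by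
  rw [Finset.nonempty_iff_ne_empty]
  rintro rfl
  simpa using ht.2.2

lemma Dl.exists_coord {A : Type*} (σ : Finset A) {m : ℕ} (h : σ.card ≤ m + 1) :
    ∃ e : Dl σ → Fin m → ℝ, Continuous e ∧ Function.Injective e := by
  classical
  by_cases hσ : σ.Nonempty
  swap
  · have : IsEmpty (Dl σ) := ⟨fun t => hσ (Dl.nonempty t.2)⟩
    exact ⟨fun _ => 0, continuous_const, fun t => isEmptyElim t⟩
  obtain ⟨a0, ha0⟩ := hσ
  have hcard : (σ.erase a0).card ≤ m := by
    rw [Finset.card_erase_of_mem ha0]; omega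
  obtain ⟨q, hq⟩ : ∃ q : Fin m → A, ∀ a ∈ σ.erase a0, ∃ i, q i = a := by
    refine ⟨fun i => if h : i.1 < (σ.erase a0).card then
      ((σ.erase a0).equivFin.symm ⟨i.1, h⟩ : A) else a0, fun a ha => ?_⟩
    let j := (σ.erase a0).equivFin ⟨a, ha⟩
    refine ⟨⟨j.1, lt_of_lt_of_le j.2 hcard⟩, ?_⟩
    simp [j]
  refine ⟨fun t i => t.1 (q i), ?_, ?_⟩
  · exact continuous_pi fun i => (continuous_apply (q i)).comp continuous_subtype_val
  · intro t t' h
    have h1 : ∀ a ∈ σ.erase a0, t.1 a = t'.1 a := by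
      intro a ha
      obtain ⟨i, rfl⟩ := hq a ha
      exact congrFun h i
    ext a
    by_cases ha : a ∈ σ
    · by_cases haa : a = a0
      · subst haa
        have h2 := t.2.2.2
        have h3 := t'.2.2.2
        rw [← Finset.add_sum_erase _ _ ha] at h2 h3
        rw [Finset.sum_congr rfl h1] at h2
        linarith
      · exact h1 a (Finset.mem_erase.2 ⟨haa, ha⟩)
    · rw [t.2.2.1 a ha, t'.2.2.1 a ha]

def ZProp.{u, v} {E : Type v} [PseudoMetricSpace E] (m : ℕ) (G : Set E) : Prop :=
  ∀ (T : Type u) [TopologicalSpace T] [CompactSpace T] (e : T → Fin m → ℝ), Continuous e →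
    Function.Injective e → ∀ (u : C(T, E)) (ε : ℝ), 0 < ε →
    ∃ u' : C(T, E), (∀ t, dist (u' t) (u t) < ε) ∧ ∀ t, u' t ∈ G

def clamp01 (x : ℝ) : ℝ := max 0 (min 1 x)

lemma clamp01_continuous : Continuous clamp01 := by unfold clamp01; fun_prop
lemma clamp01_nonneg (x : ℝ) : 0 ≤ clamp01 x := le_max_left _ _
lemma clamp01_le (x : ℝ) : clamp01 x ≤ 1 := max_le zero_le_one (min_le_left _ _)
lemma clamp01_zero {x : ℝ} (h : x ≤ 0) : clamp01 x = 0 := by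
  unfold clamp01; exact max_eq_left ((min_le_right _ _).trans h)
lemma clamp01_one {x : ℝ} (h : 1 ≤ x) : clamp01 x = 1 := by
  unfold clamp01; rw [min_eq_left h]; exact max_eq_right zero_le_one

lemma Dl.continuousOn_biUnion {A E : Type*} [TopologicalSpace E] (u : (A → ℝ) → E)
    (S : Set (Finset A)) (hS : S.Finite) (h : ∀ τ ∈ S, ContinuousOn u (Dl τ)) :
    ContinuousOn u (⋃ τ ∈ S, Dl τ) := by
  induction S, hS using Set.Finite.induction_on with
  | empty => simp
  | @insert a s ha hs ih =>
    rw [biUnion_insert]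
    refine ContinuousOn.union_of_isClosed (h a (mem_insert _ _))
      (ih fun τ hτ => h τ (mem_insert_of_mem _ hτ)) (Dl.isClosed a) ?_
    exact hs.isClosed_biUnion fun τ _ => Dl.isClosed τ

lemma simplex_extend.{u, v} {A : Type u} {E : Type v} [NormedAddCommGroup E] [NormedSpace ℝ E]
    {m : ℕ} {G B : Set E} (hG : IsOpen G) (hB : IsOpen B) (hBc : Convex ℝ B) (hBn : B.Nonempty)
    (hZ : ZProp.{u} m G) (σ : Finset A) (hσ : σ.card ≤ m + 1) (hσn : σ.Nonempty)
    (u : (A → ℝ) → E)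
    (hu : ∀ τ ⊂ σ, ContinuousOn u (Dl τ) ∧ ∀ t ∈ Dl τ, u t ∈ B ∩ G) :
    ∃ w : (A → ℝ) → E, ContinuousOn w (Dl σ) ∧
      (∀ t ∈ Dl σ, (∃ a ∈ σ, t a = 0) → w t = u t) ∧ ∀ t ∈ Dl σ, w t ∈ B ∩ G := by
  classical
  obtain ⟨e0, he0⟩ := hBn
  let T := Dl σ
  have : CompactSpace T := isCompact_iff_compactSpace.1 (Dl.isCompact σ)
  let μ : T → ℝ := fun t => (σ.card : ℝ) * σ.inf' hσn t.1
  have hμc : Continuous μ := by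
    refine continuous_const.mul ?_
    exact Continuous.finset_inf'_apply hσn
      (fun a _ => (continuous_apply a).comp continuous_subtype_val)
  have hμle : ∀ (t : T), ∀ a ∈ σ, σ.inf' hσn t.1 ≤ t.1 a := fun t a ha => Finset.inf'_le _ ha
  let r : T → A → ℝ := fun t a => if a ∈ σ then (t.1 a - σ.inf' hσn t.1) / (1 - μ t) else 0
  have hrm : ∀ t : T, μ t < 1 → ∃ a ∈ σ, r t ∈ Dl (σ.erase a) := by
    intro t ht
    obtain ⟨a, ha, hmin⟩ := Finset.exists_mem_eq_inf' hσn t.1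
    refine ⟨a, ha, ?_⟩
    have hpos : 0 < 1 - μ t := by linarith
    have h1 : r t ∈ Dl σ := by
      refine ⟨fun b => ?_, fun b hb => if_neg hb, ?_⟩
      · simp only [r]; split_ifs with hb
        · exact div_nonneg (sub_nonneg.2 (hμle t b hb)) hpos.le
        · exact le_rfl
      · have : ∑ b ∈ σ, r t b = ∑ b ∈ σ, (t.1 b - σ.inf' hσn t.1) / (1 - μ t) :=
          Finset.sum_congr rfl fun b hb => if_pos hb
        rw [this, ← Finset.sum_div, Finset.sum_sub_distrib, t.2.2.2]
        simp only [Finset.sum_const, nsmul_eq_mul]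
        exact div_self hpos.ne'
    refine Dl.of_zero (Finset.erase_subset _ _) h1 fun b hb hb' => ?_
    have : b = a := by
      by_contra hne; exact hb' (Finset.mem_erase.2 ⟨hne, hb⟩)
    subst this
    simp [r, hmin]
  let bd : Set (A → ℝ) := ⋃ τ ∈ {τ : Finset A | τ ⊂ σ}, Dl τ
  have hfin : {τ : Finset A | τ ⊂ σ}.Finite :=
    (Finset.finite_toSet σ.powerset).subset fun τ hτ => by
      simpa using (show τ ⊂ σ from hτ).1
  have hubd : ContinuousOn u bd := Dl.continuousOn_biUnion u _ hfin fun τ hτ => (hu τ hτ).1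
  have hrbd : ∀ t : T, μ t < 1 → r t ∈ bd := by
    intro t ht
    obtain ⟨a, ha, h⟩ := hrm t ht
    exact mem_biUnion (show σ.erase a ∈ {τ : Finset A | τ ⊂ σ} from Finset.erase_ssubset ha) h
  have hubg : ∀ t : T, μ t < 1 → u (r t) ∈ B ∩ G := by
    intro t ht
    obtain ⟨a, ha, h⟩ := hrm t ht
    exact (hu _ (Finset.erase_ssubset ha)).2 _ h
  have hrc : ContinuousOn r {t | μ t ≤ 3 / 4} := by
    refine continuousOn_pi.2 fun a => ?_
    by_cases ha : a ∈ σ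
    · simp only [r, ha, if_true]
      refine ContinuousOn.div ?_ (continuous_const.sub hμc).continuousOn ?_
      · refine (Continuous.sub ((continuous_apply a).comp continuous_subtype_val) ?_).continuousOn
        exact Continuous.finset_inf'_apply hσn
          (fun a _ => (continuous_apply a).comp continuous_subtype_val)
      · intro t ht
        have : μ t ≤ 3 / 4 := ht
        linarith
    · simp only [r, ha, if_false]
      exact continuousOn_const
  let ψ : T → ℝ := fun t => clamp01 (4 * μ t - 2)
  have hψc : Continuous ψ := clamp01_continuous.comp (by fun_prop)
  let v : T → E := fun t => (1 - ψ t) • u (r t) + ψ t • e0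
  have hv1 : ∀ t, 3 / 4 ≤ μ t → v t = e0 := by
    intro t ht
    have : ψ t = 1 := clamp01_one (by linarith)
    simp [v, this]
  have hv0 : ∀ t, μ t ≤ 1 / 2 → v t = u (r t) := by
    intro t ht
    have : ψ t = 0 := clamp01_zero (by linarith)
    simp [v, this]
  have hvc : Continuous v := by
    rw [← continuousOn_univ]
    have : (univ : Set T) = {t | μ t ≤ 3 / 4} ∪ {t | 3 / 4 ≤ μ t} := by
      ext t; simp [le_total]
    rw [this]
    refine ContinuousOn.union_of_isClosed ?_ ?_ (isClosed_le hμc continuous_const)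
      (isClosed_le continuous_const hμc)
    · refine ContinuousOn.add (ContinuousOn.smul (continuous_const.sub hψc).continuousOn ?_)
        (hψc.smul continuous_const).continuousOn
      refine hubd.comp hrc fun t ht => hrbd t ?_
      have : μ t ≤ 3 / 4 := ht
      linarith
    · exact continuousOn_const.congr fun t ht => hv1 t ht
  have hvB : ∀ t, v t ∈ B := by
    intro t
    rcases le_total (3 / 4) (μ t) with h | h
    · rw [hv1 t h]; exact he0
    · exact hBc (hubg t (by linarith)).1 he0 (by linarith [clamp01_le (4 * μ t - 2)])
        (clamp01_nonneg _) (by simp)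
  obtain ⟨δ1, hδ1, hδB⟩ := (isCompact_range hvc).exists_thickening_subset_open hB
    (by rintro _ ⟨t, rfl⟩; exact hvB t)
  have hKc : IsCompact (v '' {t | μ t ≤ 1 / 2}) :=
    ((isClosed_le hμc continuous_const).isCompact).image hvc
  obtain ⟨δ2, hδ2, hδG⟩ := hKc.exists_thickening_subset_open hG
    (by rintro _ ⟨t, ht, rfl⟩
        have ht' : μ t ≤ 1 / 2 := ht
        rw [hv0 t ht']; exact (hubg t (by linarith)).2)
  obtain ⟨e, he, hei⟩ := Dl.exists_coord σ hσ
  obtain ⟨v', hv'd, hv'G⟩ := hZ T e he hei ⟨v, hvc⟩ (min δ1 δ2) (lt_min hδ1 hδ2)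
  let θ : T → ℝ := fun t => clamp01 (4 * μ t - 1)
  have hθc : Continuous θ := clamp01_continuous.comp (by fun_prop)
  let w : T → E := fun t => v t + θ t • (v' t - v t)
  have hwc : Continuous w := by
    have := v'.continuous
    fun_prop
  have hwd : ∀ t, dist (w t) (v t) < min δ1 δ2 := by
    intro t
    refine lt_of_le_of_lt ?_ (hv'd t)
    simp only [w, dist_eq_norm, add_sub_cancel_left, norm_smul, ContinuousMap.coe_mk]
    refine mul_le_of_le_one_left (norm_nonneg _) ?_
    rw [Real.norm_of_nonneg (clamp01_nonneg _)]
    exact clamp01_le _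
  have hwB : ∀ t, w t ∈ B := fun t => hδB (Metric.mem_thickening_iff.2
    ⟨v t, mem_range_self t, (hwd t).trans_le (min_le_left _ _)⟩)
  have hwG : ∀ t, w t ∈ G := by
    intro t
    rcases le_total (μ t) (1 / 2) with h | h
    · exact hδG (Metric.mem_thickening_iff.2
        ⟨v t, mem_image_of_mem _ h, (hwd t).trans_le (min_le_right _ _)⟩)
    · have : θ t = 1 := clamp01_one (by linarith)
      have : w t = v' t := by simp [w, this]
      rw [this]; exact hv'G t
  refine ⟨fun t => if h : t ∈ Dl σ then w ⟨t, h⟩ else 0, ?_, ?_, ?_⟩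
  · rw [continuousOn_iff_continuous_domRestrict]
    convert hwc using 1
    ext t
    simp
  · rintro t ht ⟨a, ha, hta⟩
    simp only [ht, dite_true]
    have hinf : σ.inf' hσn t = 0 := by
      apply le_antisymm
      · rw [← hta]; exact Finset.inf'_le _ ha
      · exact Finset.le_inf' _ _ fun b _ => ht.1 b
    have hμ0 : μ ⟨t, ht⟩ = 0 := by simp [μ, hinf]
    have hr : r ⟨t, ht⟩ = t := by
      funext b
      by_cases hb : b ∈ σ
      · simp [r, hb, hinf, hμ0]
      · simp [r, hb, ht.2.1 b hb]
    have hθ : θ ⟨t, ht⟩ = 0 := clamp01_zero (by rw [hμ0]; norm_num)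
    simp only [w, hθ, zero_smul, add_zero]
    rw [hv0 _ (by rw [hμ0]; norm_num), hr]
  · intro t ht
    simp only [ht, dite_true]
    exact ⟨hwB _, hwG _⟩

/-- push-forward of weights along a map of vertices -/
def push {B A : Type*} (π : B → A) (t : B → ℝ) (a : A) : ℝ :=
  open Classical in ∑ᶠ b, if π b = a then t b else 0

open Classical in
lemma push_eq {B A : Type*} (π : B → A) {τ : Finset B} {t : B → ℝ} (ht : t ∈ Dl τ) (a : A) :
    push π t a = ∑ b ∈ τ, if π b = a then t b else 0 := by
  unfold push
  refine finsum_eq_sum_of_support_subset _ fun b hb => ?_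
  by_contra h
  apply hb
  simp [ht.2.1 b h]

open Classical in
lemma push_mem {B A : Type*} (π : B → A) {τ : Finset B} {t : B → ℝ} (ht : t ∈ Dl τ) :
    push π t ∈ Dl (τ.image π) := by
  refine ⟨fun a => ?_, fun a ha => ?_, ?_⟩
  · rw [push_eq π ht]
    refine Finset.sum_nonneg fun b _ => ?_
    split_ifs
    · exact ht.1 b
    · exact le_rfl
  · rw [push_eq π ht]
    refine Finset.sum_eq_zero fun b hb => if_neg ?_
    rintro rfl
    exact ha (Finset.mem_image_of_mem _ hb)
  · simp_rw [push_eq π ht]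
    rw [Finset.sum_comm, ← ht.2.2]
    refine Finset.sum_congr rfl fun b hb => ?_
    rw [Finset.sum_ite_eq, if_pos (Finset.mem_image_of_mem _ hb)]

lemma push_cont {B A : Type*} (π : B → A) (τ : Finset B) : ContinuousOn (push π) (Dl τ) := by
  classical
  refine continuousOn_pi.2 fun a => ?_
  refine ContinuousOn.congr (f := fun t : B → ℝ => ∑ b ∈ τ, if π b = a then t b else 0) ?_
    fun t ht => push_eq π ht a
  refine (continuous_finsetSum _ fun b _ => ?_).continuousOn
  split_ifs
  · exact continuous_apply b
  · exact continuous_const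

lemma push_inj {B A : Type*} (π : B → A) {τ : Finset B} {t : B → ℝ} (ht : t ∈ Dl τ)
    (hinj : Set.InjOn π τ) {b : B} (hb : b ∈ τ) : push π t (π b) = t b := by
  classical
  rw [push_eq π ht, Finset.sum_eq_single b]
  · simp
  · intro b' hb' hne
    exact if_neg fun h => hne (hinj hb' hb h)
  · exact fun h => (h hb).elim

/-- Partial selection on the `k`-vertex skeleton of the nerve of some cover. -/
def SkelProp.{u, v} {Y : Type u} {E : Type v} [TopologicalSpace Y] [TopologicalSpace E]
    (B G : Set (Y × E)) (k : ℕ) : Prop :=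
  ∃ (A : Type u) (V : A → Set Y) (u : (A → ℝ) → E), (∀ a, IsOpen (V a)) ∧ LocallyFinite V ∧
    (⋃ a, V a) = univ ∧ ∀ σ : Finset A, σ.card ≤ k → ∀ y, (∀ a ∈ σ, y ∈ closure (V a)) →
      ContinuousOn u (Dl σ) ∧ ∀ t ∈ Dl σ, (y, u t) ∈ B ∩ G

lemma skel_zero.{u, v} {Y : Type u} {E : Type v} [TopologicalSpace Y] [TopologicalSpace E]
    [Nonempty E] (B G : Set (Y × E)) : SkelProp B G 0 := by
  refine ⟨PUnit, fun _ => univ, fun _ => Classical.arbitrary E, fun _ => isOpen_univ,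
    locallyFinite_of_finite _, by simp [iUnion_const], fun σ hσ y _ => ?_⟩
  refine ⟨continuousOn_const, fun t ht => ?_⟩
  have := Dl.nonempty ht
  rw [← Finset.card_pos] at this
  omega

lemma skel_succ.{u, v} {Y : Type u} {E : Type v} [TopologicalSpace Y] [T2Space Y]
    [ParacompactSpace Y] [Nonempty Y] [NormedAddCommGroup E] [NormedSpace ℝ E]
    {B G : Set (Y × E)} (hB : IsOpen B) (hG : IsOpen G)
    (hBc : ∀ y, Convex ℝ {e | (y, e) ∈ B}) (hBn : ∀ y, {e | (y, e) ∈ B}.Nonempty) {m : ℕ}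
    (hZ : ∀ y, ZProp.{u} m {e | (y, e) ∈ G}) {k : ℕ} (hk : k ≤ m) (h : SkelProp B G k) :
    SkelProp B G (k + 1) := by
  classical
  obtain ⟨A, V, u, hVo, hVlf, hVc, hu⟩ := h
  have ext : ∀ (y : Y) (σ : Finset A), ∃ (w : (A → ℝ) → E) (O : Set Y), IsOpen O ∧ y ∈ O ∧
      ((∀ a ∈ σ, y ∈ closure (V a)) → σ.card = k + 1 → ContinuousOn w (Dl σ) ∧
        (∀ t ∈ Dl σ, (∃ a ∈ σ, t a = 0) → w t = u t) ∧
        ∀ y' ∈ O, ∀ t ∈ Dl σ, (y', w t) ∈ B ∩ G) := by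
    intro y σ
    by_cases h : (∀ a ∈ σ, y ∈ closure (V a)) ∧ σ.card = k + 1
    swap
    · exact ⟨u, univ, isOpen_univ, mem_univ _, fun h1 h2 => (h ⟨h1, h2⟩).elim⟩
    obtain ⟨h1, h2⟩ := h
    have hcont : Continuous (fun e : E => (y, e)) := by fun_prop
    obtain ⟨w, hw1, hw2, hw3⟩ := simplex_extend (m := m) (G := {e | (y, e) ∈ G})
      (B := {e | (y, e) ∈ B}) (hG.preimage hcont) (hB.preimage hcont) (hBc y) (hBn y) (hZ y) σ
      (by omega) (by rw [← Finset.card_pos]; omega) u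
      (fun τ hτ => hu τ (by have := Finset.card_lt_card hτ; omega) y fun a ha => h1 a (hτ.1 ha))
    have hcomp : IsCompact (w '' Dl σ) := (Dl.isCompact σ).image_of_continuousOn hw1
    obtain ⟨O, O', hO, hO', hyO, hwO', hsub⟩ := generalized_tube_lemma (s := {y}) isCompact_singleton
      hcomp (hB.inter hG) (by
        rintro ⟨y', e⟩ ⟨hy', t, ht, hte⟩
        have : y' = y := hy'
        subst this
        have h3 := hw3 t ht
        simp only at hte
        rw [hte] at h3
        exact h3)
    refine ⟨w, O, hO, hyO rfl, fun _ _ => ⟨hw1, hw2, fun y' hy' t ht => hsub ⟨hy', hwO' ⟨t, ht, rfl⟩⟩⟩⟩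
  choose w O hOo hyO hw using ext
  have hN : ∀ y, ∃ N : Set Y, IsOpen N ∧ y ∈ N ∧
      (∀ z ∈ N, ∀ a, z ∈ closure (V a) → y ∈ closure (V a)) ∧
      ∀ σ : Finset A, (∀ a ∈ σ, y ∈ closure (V a)) → N ⊆ O y σ := by
    intro y
    have hfin := hVlf.closure.point_finite y
    have h1 := hVlf.closure.eventually_subset (fun a => isClosed_closure) y
    obtain ⟨N1, hN1, hN1o, hyN1⟩ := mem_nhds_iff.1 h1
    let P := hfin.toFinset.powerset
    refine ⟨N1 ∩ ⋂ σ ∈ P, O y σ, hN1o.inter (isOpen_biInter_finset fun σ _ => hOo y σ),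
      ⟨hyN1, mem_iInter₂.2 fun σ _ => hyO y σ⟩, fun z hz a ha => hN1 hz.1 ha, fun σ hσ z hz => ?_⟩
    refine mem_iInter₂.1 hz.2 σ ?_
    rw [Finset.mem_powerset]
    intro a ha
    simpa using hσ a ha
  choose N hNo hyN hNcl hNO using hN
  obtain ⟨W', hW'o, hW'c, hW'lf, hW's⟩ := precise_refinement (fun b : Y × A => N b.1 ∩ V b.2)
    (fun b => (hNo _).inter (hVo _)) (by
      refine eq_univ_of_forall fun y => ?_
      obtain ⟨a, ha⟩ := mem_iUnion.1 (hVc.ge (mem_univ y))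
      exact mem_iUnion.2 ⟨(y, a), hyN y, ha⟩)
  obtain ⟨W, hWc, hWo, hWs⟩ := exists_iUnion_eq_closure_subset hW'o
    (fun x => hW'lf.point_finite x) hW'c
  let π : Y × A → A := Prod.snd
  let yc : Set (Y × A) → Y := fun s => if h : s.Nonempty then h.choose.1 else Classical.arbitrary Y
  let sf : Set A → Finset A := fun s => if h : s.Finite then h.toFinset else ∅
  let u' : (Y × A → ℝ) → E := fun t =>
    if (Function.support (push π t)).ncard ≤ k then u (push π t)
    else w (yc (Function.support t)) (sf (Function.support (push π t))) (push π t)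
  refine ⟨Y × A, W, u', hWo, hW'lf.subset fun b => subset_closure.trans (hWs b), hWc, ?_⟩
  intro τ hτ z hz
  have hzV : ∀ b ∈ τ, z ∈ V b.2 := fun b hb => (hW's b (hWs b (hz b hb))).2
  have hzN : ∀ b ∈ τ, z ∈ N b.1 := fun b hb => (hW's b (hWs b (hz b hb))).1
  have hzc : ∀ a ∈ τ.image π, z ∈ closure (V a) := by
    intro a ha
    obtain ⟨b, hb, rfl⟩ := Finset.mem_image.1 ha
    exact subset_closure (hzV b hb)
  have hsupp : ∀ t ∈ Dl τ, Function.support (push π t) ⊆ ↑(τ.image π) := by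
    intro t ht a ha
    by_contra h
    exact ha ((push_mem π ht).2.1 a h)
  have hmaps : MapsTo (push π) (Dl τ) (Dl (τ.image π)) := fun t ht => push_mem π ht
  by_cases hcard : (τ.image π).card ≤ k
  · have heq : ∀ t ∈ Dl τ, u' t = u (push π t) := by
      intro t ht
      refine if_pos (le_trans ?_ hcard)
      rw [← Set.ncard_coe_finset]
      exact Set.ncard_le_ncard (hsupp t ht) (Finset.finite_toSet _)
    obtain ⟨h1, h2⟩ := hu _ hcard z hzc
    refine ⟨(h1.comp (push_cont π τ) hmaps).congr heq, fun t ht => ?_⟩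
    rw [heq t ht]
    exact h2 _ (hmaps ht)
  · have hle : (τ.image π).card ≤ τ.card := Finset.card_image_le
    have hc1 : (τ.image π).card = k + 1 := by omega
    have hinj : Set.InjOn π τ := Finset.card_image_iff.1 (by omega)
    have hτn : (τ : Set (Y × A)).Nonempty := by
      rw [Finset.coe_nonempty, ← Finset.card_pos]; omega
    obtain ⟨b, hb, hyb⟩ : ∃ b ∈ τ, yc τ = b.1 := by
      refine ⟨hτn.choose, hτn.choose_spec, ?_⟩
      simp only [yc]
      rw [dif_pos hτn]
    set y := yc τ with hy
    set σ := τ.image π with hσ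
    have hyσ : ∀ a ∈ σ, y ∈ closure (V a) := fun a ha => hNcl y z (hyb ▸ hzN b hb) a (hzc a ha)
    obtain ⟨h1, h2, h3⟩ := hw y σ hyσ hc1
    have heq : ∀ t ∈ Dl τ, u' t = w y σ (push π t) := by
      intro t ht
      by_cases hs : (Function.support (push π t)).ncard ≤ k
      · have e1 : u' t = u (push π t) := if_pos hs
        rw [e1, h2 _ (hmaps ht)]
        by_contra hcon
        push Not at hcon
        have : (σ : Set A) ⊆ Function.support (push π t) := fun a ha => hcon a ha
        have := Set.ncard_le_ncard this ((Finset.finite_toSet _).subset (hsupp t ht))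
        rw [Set.ncard_coe_finset] at this
        omega
      · have e1 : u' t = w (yc (Function.support t)) (sf (Function.support (push π t))) (push π t) :=
          if_neg hs
        have e2 : Function.support (push π t) = σ := by
          refine Set.eq_of_subset_of_ncard_le (hsupp t ht) ?_ (Finset.finite_toSet _)
          rw [Set.ncard_coe_finset]; omega
        have e3 : Function.support t = τ := by
          ext b'
          constructor
          · intro hb'
            by_contra h
            exact hb' (ht.2.1 b' h)
          · intro hb'
            have : π b' ∈ Function.support (push π t) := by
              rw [e2]; exact Finset.mem_image_of_mem _ hb'
            rwa [Function.mem_support, push_inj π ht hinj hb'] at this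
        have e4 : sf (σ : Set A) = σ := by
          simp only [sf]
          rw [dif_pos (Finset.finite_toSet σ)]
          simp
        rw [e1, e2, e3, e4]
    refine ⟨(h1.comp (push_cont π τ) hmaps).congr heq, fun t ht => ?_⟩
    rw [heq t ht]
    exact h3 z (hNO y σ hyσ (hyb ▸ hzN b hb)) _ (hmaps ht)

theorem selection.{u, v} {Y : Type u} {E : Type v} [TopologicalSpace Y] [T2Space Y]
    [ParacompactSpace Y] [Nonempty Y] [NormedAddCommGroup E] [NormedSpace ℝ E]
    {B G : Set (Y × E)} (hB : IsOpen B) (hG : IsOpen G)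
    (hBc : ∀ y, Convex ℝ {e | (y, e) ∈ B}) (hBn : ∀ y, {e | (y, e) ∈ B}.Nonempty) {m : ℕ}
    (hZ : ∀ y, ZProp.{u} m {e | (y, e) ∈ G}) (hdim : CovDimLE Y m) :
    ∃ s : C(Y, E), ∀ y, (y, s y) ∈ B ∩ G := by
  classical
  have hk : ∀ k, k ≤ m + 1 → SkelProp B G k := by
    intro k
    induction k with
    | zero => exact fun _ => skel_zero B G
    | succ k ih => exact fun h => skel_succ hB hG hBc hBn hZ (by omega) (ih (by omega))
  obtain ⟨A, V, u, hVo, hVlf, hVc, hu⟩ := hk (m + 1) le_rfl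
  obtain ⟨V', hV'o, hV's, hV'c, hV'n⟩ := dowker_s15 hdim V hVo hVlf hVc
  have hV'lf : LocallyFinite V' := hVlf.subset hV's
  obtain ⟨ρ, hρ⟩ := PartitionOfUnity.exists_isSubordinate_of_locallyFinite isClosed_univ V' hV'o
    hV'lf (by rw [hV'c])
  have hmemV : ∀ a y, ρ a y ≠ 0 → y ∈ V' a := fun a y h => hρ a (subset_tsupport _ h)
  -- support
  have hfin : ∀ y, {a | y ∈ V' a}.Finite := fun y => hV'lf.point_finite y
  have hmem : ∀ y, (fun a => ρ a y) ∈ Dl (hfin y).toFinset := by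
    intro y
    refine ⟨fun a => ρ.nonneg a y, fun a ha => ?_, ?_⟩
    · by_contra h
      exact ha (by simpa using hmemV a y h)
    · rw [← ρ.sum_eq_one (mem_univ y)]
      refine (finsum_eq_sum_of_support_subset _ fun a ha => ?_).symm
      simpa using hmemV a y ha
  have hcard : ∀ y, (hfin y).toFinset.card ≤ m + 1 := by
    intro y
    rw [← ncard_eq_toFinset_card _ (hfin y)]
    exact hV'n y
  have hcl : ∀ y, ∀ a ∈ (hfin y).toFinset, y ∈ closure (V a) := by
    intro y a ha
    exact subset_closure (hV's a (by simpa using ha))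
  have hcont : Continuous fun y => u (fun a => ρ a y) := by
    rw [continuous_iff_continuousAt]
    intro y0
    obtain ⟨N, hN, hNf⟩ := hV'lf y0
    let S : Set (Finset A) := {σ | ∃ y ∈ N, σ = (hfin y).toFinset}
    have hS : S.Finite := by
      refine (Finset.finite_toSet (hNf.toFinset.powerset)).subset ?_
      rintro σ ⟨y, hy, rfl⟩
      simp only [Finset.coe_powerset, mem_preimage, mem_powerset_iff]
      intro a ha
      have : y ∈ V' a := by simpa using ha
      simpa using ⟨y, this, hy⟩
    have h1 : ContinuousOn u (⋃ τ ∈ S, Dl τ) := by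
      refine Dl.continuousOn_biUnion u S hS ?_
      rintro σ ⟨y, hy, rfl⟩
      exact (hu _ (hcard y) y (hcl y)).1
    have h2 : ContinuousOn (fun y => u (fun a => ρ a y)) N := by
      refine h1.comp (t := ⋃ τ ∈ S, Dl τ) ?_ ?_
      · exact (continuous_pi fun a => (ρ a).continuous).continuousOn
      · intro y hy
        exact mem_biUnion (show (hfin y).toFinset ∈ S from ⟨y, hy, rfl⟩) (hmem y)
    exact h2.continuousAt hN
  exact ⟨⟨_, hcont⟩, fun y => (hu _ (hcard y) y (hcl y)).2 _ (hmem y)⟩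

/-- tube lemma for perfect maps -/
lemma fiber_tube {X Y : Type*} [TopologicalSpace X] [TopologicalSpace Y] [T2Space Y] {f : X → Y}
    (hf : IsProperMap f) {P : Set (X × X)} (hP : IsClosed P) (hPf : ∀ z ∈ P, f z.1 = f z.2)
    {φ : X × X → ℝ} (hφ : Continuous φ) {y : Y} (hy : ∀ z ∈ P, f z.1 = y → 0 < φ z) :
    ∃ ε : ℝ, 0 < ε ∧ ∀ᶠ y' in 𝓝 y, ∀ z ∈ P, f z.1 = y' → ε < φ z := by
  have hff : IsProperMap (Prod.map f f) := hf.prodMap hf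
  have hcomp : IsCompact (P ∩ (Prod.map f f) ⁻¹' {(y, y)}) :=
    (hff.isCompact_preimage isCompact_singleton).inter_left hP
  have hε : ∃ ε : ℝ, 0 < ε ∧ ∀ z ∈ P, f z.1 = y → ε < φ z := by
    rcases (P ∩ (Prod.map f f) ⁻¹' {(y, y)}).eq_empty_or_nonempty with h | h
    · refine ⟨1, one_pos, fun z hz hzy => ?_⟩
      have : z ∈ P ∩ (Prod.map f f) ⁻¹' {(y, y)} := by
        refine ⟨hz, ?_⟩
        have := hPf z hz
        simp [Prod.map, ← this, hzy]
      rw [h] at this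
      exact this.elim
    · obtain ⟨z0, hz0, hmin⟩ := hcomp.exists_isMinOn h hφ.continuousOn
      have hz0y : f z0.1 = y := congrArg Prod.fst hz0.2
      have hpos := hy z0 hz0.1 hz0y
      refine ⟨φ z0 / 2, by positivity, fun z hz hzy => ?_⟩
      have : z ∈ P ∩ (Prod.map f f) ⁻¹' {(y, y)} := by
        refine ⟨hz, ?_⟩
        have := hPf z hz
        simp [Prod.map, ← this, hzy]
      have h2 : φ z0 ≤ φ z := hmin this
      linarith
  obtain ⟨ε, hε0, hε⟩ := hε
  refine ⟨ε, hε0, ?_⟩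
  have hC : IsClosed (P ∩ {z | φ z ≤ ε}) := hP.inter (isClosed_le hφ continuous_const)
  have hI : IsClosed ((fun y : Y => (y, y)) ⁻¹' (Prod.map f f '' (P ∩ {z | φ z ≤ ε}))) :=
    (hff.isClosedMap _ hC).preimage (by fun_prop)
  have hmem : ((fun y : Y => (y, y)) ⁻¹' (Prod.map f f '' (P ∩ {z | φ z ≤ ε})))ᶜ ∈ 𝓝 y := by
    refine hI.isOpen_compl.mem_nhds ?_
    rintro ⟨z, ⟨hz1, hz2⟩, hz3⟩
    have := hε z hz1 (congrArg Prod.fst hz3)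
    have hz2' : φ z ≤ ε := hz2
    linarith
  filter_upwards [hmem] with y' hy' z hz hzy
  by_contra hcon
  refine hy' ⟨z, ⟨hz, not_lt.1 hcon⟩, ?_⟩
  have := hPf z hz
  simp [Prod.map, ← this, hzy]

/-- goodness of `g` over the fiber of `y` -/
def GoodAt {X Y F : Type*} (f : X → Y) (P : Set (X × X)) (D : F → F → ℝ) (y : Y) (g : X → F) :
    Prop := ∀ z ∈ P, f z.1 = y → 0 < D (g z.1) (g z.2)

lemma goodAt_isOpen {X Y F : Type*} [TopologicalSpace X] [TopologicalSpace Y] [T2Space Y]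
    [NormedAddCommGroup F] {f : X → Y} (hf : IsProperMap f) {P : Set (X × X)} (hP : IsClosed P)
    (hPf : ∀ z ∈ P, f z.1 = f z.2) {D : F → F → ℝ} (hDc : Continuous fun z : F × F => D z.1 z.2)
    (hD : ∀ u v u' v', |D u v - D u' v'| ≤ dist u u' + dist v v') :
    IsOpen {q : Y × BoundedContinuousFunction X F | GoodAt f P D q.1 q.2} := by
  rw [isOpen_iff_mem_nhds]
  rintro ⟨y, g⟩ hg
  obtain ⟨ε, hε, hev⟩ := fiber_tube hf hP hPf (φ := fun z => D (g z.1) (g z.2))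
    (hDc.comp ((g.continuous.comp continuous_fst).prodMk (g.continuous.comp continuous_snd))) hg
  filter_upwards [prod_mem_nhds hev (Metric.ball_mem_nhds g (half_pos hε))]
  rintro ⟨y', g'⟩ ⟨h1, h2⟩ z hz hzy
  have h3 := h1 z hz hzy
  have h4 := hD (g z.1) (g z.2) (g' z.1) (g' z.2)
  have h5 : dist (g z.1) (g' z.1) ≤ dist g g' := BoundedContinuousFunction.dist_coe_le_dist _
  have h6 : dist (g z.2) (g' z.2) ≤ dist g g' := BoundedContinuousFunction.dist_coe_le_dist _
  have h7 : dist g g' < ε / 2 := by rw [dist_comm]; exact h2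
  have h8 := le_abs_self (D (g z.1) (g z.2) - D (g' z.1) (g' z.2))
  simp only at h3 ⊢
  linarith

/-- the underlying map to `ℝ^p` with the sup metric -/
def unc {X : Type*} [TopologicalSpace X] {p : ℕ} (g : C(X, ↥(cube p))) (x : X) : Fin p → ℝ :=
  fun i => (g x : EuclideanSpace ℝ (Fin p)) i

lemma unc_continuous {X : Type*} [TopologicalSpace X] {p : ℕ} (g : C(X, ↥(cube p))) :
    Continuous (unc g) :=
  (PiLp.continuous_ofLp 2 _).comp (continuous_subtype_val.comp g.continuous)

lemma unc_dist {X : Type*} [TopologicalSpace X] {p : ℕ} (g h : C(X, ↥(cube p))) (x : X) :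
    dist (unc g x) (unc h x) ≤ dist (g x) (h x) := by
  rw [dist_pi_le_iff dist_nonneg]
  intro i
  have := PiLp.norm_apply_le ((g x : EuclideanSpace ℝ (Fin p)) - (h x : EuclideanSpace ℝ (Fin p))) i
  rw [Subtype.dist_eq, dist_eq_norm, dist_eq_norm]
  exact this

lemma unc_mem {X : Type*} [TopologicalSpace X] {p : ℕ} (g : C(X, ↥(cube p))) (x : X) (i : Fin p) :
    unc g x i ∈ Icc (0:ℝ) 1 := (g x).2 i

lemma good_SLOpen {X Y : Type*} [TopologicalSpace X] [TopologicalSpace Y] [T2Space Y]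
    [ParacompactSpace Y] {f : X → Y} (hf : IsProperMap f) {P : Set (X × X)} (hP : IsClosed P)
    (hPf : ∀ z ∈ P, f z.1 = f z.2) {p : ℕ} {D : (Fin p → ℝ) → (Fin p → ℝ) → ℝ}
    (hDc : Continuous fun z : (Fin p → ℝ) × (Fin p → ℝ) => D z.1 z.2)
    (hD : ∀ u v u' v', |D u v - D u' v'| ≤ dist u u' + dist v v') :
    SLOpen {g : C(X, ↥(cube p)) | ∀ y, GoodAt f P D y (unc g)} := by
  intro g hg
  have hφ : Continuous fun z : X × X => D (unc g z.1) (unc g z.2) :=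
    hDc.comp (((unc_continuous g).comp continuous_fst).prodMk
      ((unc_continuous g).comp continuous_snd))
  obtain ⟨β, hβ⟩ := exists_continuous_forall_mem_convex_of_local_const (X := Y) (E := ℝ)
    (t := fun y => {b | 0 < b ∧ ∀ z ∈ P, f z.1 = y → 2 * b < D (unc g z.1) (unc g z.2)}) (by
      intro y b hb c hc s t hs ht hst
      simp only [mem_ofPred_eq, smul_eq_mul] at *
      refine ⟨?_, fun z hz hzy => ?_⟩
      · have := convex_Ioi (𝕜 := ℝ) (0:ℝ) hb.1 hc.1 hs ht hst
        simpa using this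
      · have h1 : b < D (unc g z.1) (unc g z.2) / 2 := by linarith [hb.2 z hz hzy]
        have h2 : c < D (unc g z.1) (unc g z.2) / 2 := by linarith [hc.2 z hz hzy]
        have := convex_Iio (𝕜 := ℝ) (D (unc g z.1) (unc g z.2) / 2) h1 h2 hs ht hst
        simp only [mem_Iio, smul_eq_mul] at this
        linarith) (by
      intro y
      obtain ⟨ε, hε, hev⟩ := fiber_tube hf hP hPf hφ (hg y)
      refine ⟨ε / 2, ?_⟩
      filter_upwards [hev] with y' hy'
      refine ⟨by positivity, fun z hz hzy => ?_⟩
      have := hy' z hz hzy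
      linarith)
  refine ⟨⟨fun x => β (f x), β.continuous.comp hf.continuous⟩, fun x => (hβ (f x)).1, ?_⟩
  intro h hh y z hz hzy
  have h1 := (hβ (f z.1)).2 z hz rfl
  have h2 : dist (g z.1) (h z.1) ≤ β (f z.1) := hh z.1
  have h3 : dist (g z.2) (h z.2) ≤ β (f z.2) := hh z.2
  rw [← hPf z hz] at h3
  have h4 := hD (unc g z.1) (unc g z.2) (unc h z.1) (unc h z.2)
  have h8 := le_abs_self (D (unc g z.1) (unc g z.2) - D (unc h z.1) (unc h z.2))
  have h5 := unc_dist g h z.1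
  have h6 := unc_dist g h z.2
  linarith

lemma good_dense.{u, v} {X : Type v} {Y : Type u} [TopologicalSpace X] [TopologicalSpace Y]
    [T2Space X] [T2Space Y]
    [ParacompactSpace Y] {f : X → Y} (hf : IsProperMap f) {P : Set (X × X)} (hP : IsClosed P)
    (hPf : ∀ z ∈ P, f z.1 = f z.2) {p : ℕ} {D : (Fin p → ℝ) → (Fin p → ℝ) → ℝ}
    (hDc : Continuous fun z : (Fin p → ℝ) × (Fin p → ℝ) => D z.1 z.2)
    (hD : ∀ u v u' v', |D u v - D u' v'| ≤ dist u u' + dist v v') {m : ℕ}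
    (hdim : CovDimLE Y m)
    (hZ : ∀ y, ZProp.{u} m {g : BoundedContinuousFunction X (Fin p → ℝ) | GoodAt f P D y g})
    (g : C(X, ↥(cube p))) (α : C(X, ℝ)) (hα : ∀ x, 0 < α x) :
    ∃ g' : C(X, ↥(cube p)), (∀ x, dist (g x) (g' x) ≤ α x) ∧ ∀ y, GoodAt f P D y (unc g') := by
  rcases isEmpty_or_nonempty Y with hY | hY
  · refine ⟨g, fun x => hY.elim (f x), fun y => hY.elim y⟩
  obtain ⟨β, hβ⟩ := exists_continuous_forall_mem_convex_of_local_const (X := Y) (E := ℝ)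
    (t := fun y => {b | (0 < b ∧ b < 1) ∧ ∀ x, f x = y → (p + 1) * b < α x}) (by
      intro y b hb c hc s t hs ht hst
      simp only [mem_ofPred_eq, smul_eq_mul] at *
      refine ⟨?_, fun x hx => ?_⟩
      · have := convex_Ioo (𝕜 := ℝ) (0:ℝ) 1 hb.1 hc.1 hs ht hst
        simpa using this
      · have hp : (0:ℝ) < p + 1 := by positivity
        have h1 : b < α x / (p + 1) := by rw [lt_div_iff₀ hp, mul_comm]; exact hb.2 x hx
        have h2 : c < α x / (p + 1) := by rw [lt_div_iff₀ hp, mul_comm]; exact hc.2 x hx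
        have := convex_Iio (𝕜 := ℝ) (α x / (p + 1)) h1 h2 hs ht hst
        simp only [mem_Iio, smul_eq_mul] at this
        rw [lt_div_iff₀ hp, mul_comm] at this
        exact this) (by
      intro y
      obtain ⟨ε, hε, hev⟩ := fiber_tube hf (P := {z : X × X | z.1 = z.2})
        (isClosed_eq continuous_fst continuous_snd)
        (fun z hz => congrArg f hz) (φ := fun z => α z.1) (α.continuous.comp continuous_fst)
        (y := y) (fun z _ _ => hα _)
      have hp : (0:ℝ) < p + 1 := by positivity
      refine ⟨min (1 / 2) (ε / (p + 1)), ?_⟩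
      filter_upwards [hev] with y' hy'
      refine ⟨⟨by positivity, lt_of_le_of_lt (min_le_left _ _) (by norm_num)⟩, fun x hx => ?_⟩
      have h1 : ε < α x := hy' (x, x) rfl hx
      refine lt_of_le_of_lt ?_ h1
      calc (p + 1) * min (1 / 2) (ε / (p + 1)) ≤ (p + 1) * (ε / (p + 1)) := by
            gcongr; exact min_le_right _ _
        _ = ε := by field_simp)
  have hfc := hf.continuous
  let g1 : BoundedContinuousFunction X (Fin p → ℝ) := BoundedContinuousFunction.ofNormedAddCommGroup
    (fun x i => (1 - β (f x)) * unc g x i + β (f x) / 2)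
    (by
      refine continuous_pi fun i => ?_
      have h1 : Continuous fun x => unc g x i := (continuous_apply i).comp (unc_continuous g)
      fun_prop) 1 (by
      intro x
      rw [pi_norm_le_iff_of_nonneg zero_le_one]
      intro i
      have h1 := unc_mem g x i
      have h2 := (hβ (f x)).1
      rw [Real.norm_eq_abs, abs_le]
      constructor <;> nlinarith [h1.1, h1.2, h2.1, h2.2])
  have hg1 : ∀ x i, g1 x i = (1 - β (f x)) * unc g x i + β (f x) / 2 := fun x i => rfl
  obtain ⟨s, hs⟩ := selection (Y := Y) (E := BoundedContinuousFunction X (Fin p → ℝ))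
    (B := {q | dist q.2 g1 < β q.1 / 2})
    (G := {q | GoodAt f P D q.1 q.2})
    (isOpen_lt (by fun_prop) (by fun_prop))
    (goodAt_isOpen hf hP hPf hDc hD) (fun y => convex_ball g1 (β y / 2))
    (fun y => ⟨g1, by simpa using (hβ y).1.1⟩) hZ hdim
  have hsd : ∀ x i, |s (f x) x i - g1 x i| ≤ β (f x) / 2 := by
    intro x i
    have h1 : dist (s (f x)) g1 < β (f x) / 2 := (hs (f x)).1
    have h2 : dist (s (f x) x) (g1 x) ≤ dist (s (f x)) g1 :=
      BoundedContinuousFunction.dist_coe_le_dist _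
    have h3 := dist_le_pi_dist (s (f x) x) (g1 x) i
    rw [Real.dist_eq] at h3
    linarith
  have hcont : Continuous fun x => s (f x) x :=
    Continuous.eval (s.continuous.comp hfc) continuous_id
  have hcube : ∀ x, WithLp.toLp 2 (s (f x) x) ∈ cube p := by
      intro x i
      have h1 := hsd x i
      rw [hg1] at h1
      rw [abs_le] at h1
      have h2 := unc_mem g x i
      have h3 := (hβ (f x)).1
      show s (f x) x i ∈ Icc (0:ℝ) 1
      constructor <;> nlinarith [h1.1, h1.2, h2.1, h2.2]
  let g' : C(X, ↥(cube p)) := ⟨fun x => ⟨WithLp.toLp 2 (s (f x) x), hcube x⟩,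
    Continuous.subtype_mk ((PiLp.continuous_toLp 2 _).comp hcont) hcube⟩
  have hug : ∀ x, unc g' x = s (f x) x := fun x => rfl
  refine ⟨g', fun x => ?_, fun y z hz hzy => ?_⟩
  · have hb := (hβ (f x)).1
    refine le_trans ?_ ((hβ (f x)).2 x rfl).le
    rw [Subtype.dist_eq, EuclideanSpace.dist_eq]
    refine Real.sqrt_le_iff.2 ⟨by have := hb.1; positivity, ?_⟩
    have h1 : ∀ i : Fin p, dist ((g x : EuclideanSpace ℝ (Fin p)).ofLp i)
        ((g' x : EuclideanSpace ℝ (Fin p)).ofLp i) ^ 2 ≤ β (f x) ^ 2 := by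
      intro i
      have h1 := hsd x i
      rw [hg1] at h1
      rw [abs_le] at h1
      have h2 := unc_mem g x i
      have h4 : dist (unc g x i) (s (f x) x i) ≤ β (f x) := by
        rw [Real.dist_eq, abs_le]
        constructor <;> nlinarith [h1.1, h1.2, h2.1, h2.2]
      have h5 : dist ((g x : EuclideanSpace ℝ (Fin p)).ofLp i)
        ((g' x : EuclideanSpace ℝ (Fin p)).ofLp i) ≤ β (f x) := h4
      have h6 : (0:ℝ) ≤ dist ((g x : EuclideanSpace ℝ (Fin p)).ofLp i)
        ((g' x : EuclideanSpace ℝ (Fin p)).ofLp i) := dist_nonneg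
      exact pow_le_pow_left₀ h6 h5 2
    refine (Finset.sum_le_sum fun i _ => h1 i).trans ?_
    simp only [Finset.sum_const, Finset.card_univ, Fintype.card_fin, nsmul_eq_mul]
    have hp : (0:ℝ) ≤ p := by positivity
    nlinarith [sq_nonneg (β (f x)), mul_nonneg hp (sq_nonneg (β (f x))),
      mul_nonneg (mul_nonneg hp hp) (sq_nonneg (β (f x)))]
  · have h := (hs y).2 z hz hzy
    rw [hug, hug, ← hPf z hz, hzy]
    exact h

/-- coordinatewise truncation -/
def truncPi {p : ℕ} (d : ℝ) (v : Fin p → ℝ) : Fin p → ℝ := fun i => max (-d) (min d (v i))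

lemma truncPi_lip {p : ℕ} (d : ℝ) : LipschitzWith 1 (truncPi (p := p) d) := by
  refine LipschitzWith.mk_one fun v w => ?_
  rw [dist_pi_le_iff dist_nonneg]
  intro i
  refine le_trans ?_ (dist_le_pi_dist v w i)
  have := ((LipschitzWith.id (α := ℝ)).const_min d).const_max (-d)
  simpa [truncPi] using this.dist_le_mul (v i) (w i)

lemma truncPi_norm {p : ℕ} {d : ℝ} (hd : 0 ≤ d) (v : Fin p → ℝ) : ‖truncPi d v‖ ≤ d := by
  rw [pi_norm_le_iff_of_nonneg hd]
  intro i
  rw [Real.norm_eq_abs, abs_le]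
  exact ⟨le_max_left _ _, max_le (by linarith) (min_le_left _ _)⟩

lemma truncPi_eq {p : ℕ} {d : ℝ} {v : Fin p → ℝ} (hv : ‖v‖ ≤ d) : truncPi d v = v := by
  funext i
  have h := (norm_le_pi_norm v i).trans hv
  rw [Real.norm_eq_abs, abs_le] at h
  simp [truncPi, h.1, h.2]

/-- bounded linear combinations of scalar functions with vector coefficients -/
def lcomb {X ι F : Type*} [TopologicalSpace X] [Fintype ι] [NormedAddCommGroup F] [NormedSpace ℝ F]
    (φ : ι → BoundedContinuousFunction X ℝ) : (ι → F) →ₗ[ℝ] BoundedContinuousFunction X F where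
  toFun a := ∑ j, BoundedContinuousFunction.ofNormedAddCommGroup (fun x => φ j x • a j)
    ((φ j).continuous.smul continuous_const) (‖φ j‖ * ‖a j‖) (fun x => by
      rw [norm_smul]; gcongr; exact (φ j).norm_coe_le_norm x)
  map_add' a b := by
    ext x : 1
    simp [BoundedContinuousFunction.sum_apply, Finset.sum_add_distrib]
  map_smul' r a := by
    ext x : 1
    simp only [BoundedContinuousFunction.sum_apply, BoundedContinuousFunction.coe_ofNormedAddCommGroup,
      BoundedContinuousFunction.coe_smul, Pi.smul_apply, RingHom.id_apply, Finset.smul_sum]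
    exact Finset.sum_congr rfl fun j _ => smul_comm _ _ _

lemma lcomb_apply {X ι F : Type*} [TopologicalSpace X] [Fintype ι] [NormedAddCommGroup F]
    [NormedSpace ℝ F] (φ : ι → BoundedContinuousFunction X ℝ) (a : ι → F) (x : X) :
    lcomb φ a x = ∑ j, φ j x • a j := by
  simp [lcomb, BoundedContinuousFunction.sum_apply]

lemma bary_approx {X T : Type*} [TopologicalSpace X] [T2Space X] [NormalSpace X]
    [TopologicalSpace T] [CompactSpace T] {n p : ℕ} {K : Set X} (hK : IsCompact K)
    (hdim : CovDimLE K n) (W : X → Set X) (hWo : ∀ x, IsOpen (W x)) (hW : ∀ x, x ∈ W x)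
    (u : C(T, BoundedContinuousFunction X (Fin p → ℝ))) {δ : ℝ} (hδ : 0 < δ) :
    ∃ (I : Finset X) (φ : I → X → ℝ) (c : C(T, I → Fin p → ℝ)),
      (∀ x ∈ K, ∑ i, φ i x = 1) ∧ (∀ x ∈ K, {i | φ i x ≠ 0}.ncard ≤ n + 1) ∧
      (∀ i, ∀ x ∈ K, φ i x ≠ 0 → x ∈ W i) ∧
      ∀ c' : C(T, I → Fin p → ℝ), (∀ t, dist (c' t) (c t) < δ) →
        ∃ u' : C(T, BoundedContinuousFunction X (Fin p → ℝ)), (∀ t, dist (u' t) (u t) ≤ 2 * δ) ∧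
          ∀ t, ∀ x ∈ K, u' t x = ∑ i, φ i x • c' t i := by
  classical
  have hO : ∀ x : X, ∃ O : Set X, IsOpen O ∧ x ∈ O ∧ O ⊆ W x ∧
      ∀ x' ∈ O, ∀ t, dist (u t x) (u t x') < δ := by
    intro x
    have h1 : ∀ᶠ x' in 𝓝 x, ∀ t ∈ (univ : Set T), dist (u t x) (u t x') < δ := by
      refine isCompact_univ.eventually_forall_of_forall_eventually fun t _ => ?_
      have hc : Continuous fun z : X × T => dist (u z.2 x) (u z.2 z.1) := by
        refine Continuous.dist ?_ ?_
        · exact Continuous.eval (u.continuous.comp continuous_snd) continuous_const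
        · exact Continuous.eval (u.continuous.comp continuous_snd) continuous_fst
      exact hc.continuousAt.eventually_lt_const (by simpa using hδ)
    obtain ⟨O, hO1, hO2, hO3⟩ := mem_nhds_iff.1 (Filter.inter_mem h1 ((hWo x).mem_nhds (hW x)))
    exact ⟨O, hO2, hO3, fun x' hx' => (hO1 hx').2, fun x' hx' t => (hO1 hx').1 t (mem_univ _)⟩
  choose O hOo hOx hOW hOd using hO
  obtain ⟨I, hI⟩ := hK.elim_nhds_subcover O (fun x _ => (hOo x).mem_nhds (hOx x))
  have : CompactSpace K := isCompact_iff_compactSpace.1 hK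
  obtain ⟨V, hVo, hVs, hVc, hVn⟩ := hdim.fin (fun i : I => ((↑) : K → X) ⁻¹' O i)
    (fun i => (hOo i).preimage continuous_subtype_val) (by
      rw [eq_univ_iff_forall]
      intro x
      obtain ⟨i, hi, hx⟩ := mem_iUnion₂.1 (hI.2 x.2)
      exact mem_iUnion.2 ⟨⟨i, hi⟩, hx⟩)
  obtain ⟨ρ, hρ⟩ := PartitionOfUnity.exists_isSubordinate_of_locallyFinite isClosed_univ V hVo
    (locallyFinite_of_finite _) (by rw [hVc])
  have hext : ∀ i : I, ∃ ψ : BoundedContinuousFunction X ℝ, ∀ x : K, ψ x = ρ i x := by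
    intro i
    obtain ⟨ψ, _, h⟩ := BoundedContinuousFunction.exists_norm_eq_domRestrict_eq_of_closed
      (BoundedContinuousFunction.mkOfCompact (ρ i)) hK.isClosed
    exact ⟨ψ, fun x => DFunLike.congr_fun h x⟩
  choose ψ hψ using hext
  have hV' : ∀ i, ∀ x (hx : x ∈ K), ψ i x ≠ 0 → (⟨x, hx⟩ : K) ∈ V i := by
    intro i x hx h
    refine hρ i (subset_tsupport _ ?_)
    rw [Function.mem_support, ← hψ i ⟨x, hx⟩]
    exact h
  have hsum : ∀ x ∈ K, ∑ i, ψ i x = 1 := by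
    intro x hx
    rw [← ρ.sum_eq_one (mem_univ (⟨x, hx⟩ : K)), finsum_eq_sum_of_fintype]
    exact Finset.sum_congr rfl fun i _ => hψ i ⟨x, hx⟩
  have hnn : ∀ i, ∀ x ∈ K, 0 ≤ ψ i x := by
    intro i x hx
    rw [hψ i ⟨x, hx⟩]
    exact ρ.nonneg i _
  have hψO : ∀ i, ∀ x ∈ K, ψ i x ≠ 0 → x ∈ O i := fun i x hx h => hVs i (hV' i x hx h)
  refine ⟨I, fun i => ψ i, ⟨fun t i => u t i, ?_⟩, hsum, ?_, fun i x hx h => hOW _ (hψO i x hx h), ?_⟩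
  · exact continuous_pi fun i => Continuous.eval u.continuous continuous_const
  · intro x hx
    refine le_trans (ncard_le_ncard (fun i hi => ?_) (toFinite _)) (hVn ⟨x, hx⟩)
    exact hV' i x hx hi
  · intro c' hc'
    have hL : Continuous (lcomb (F := Fin p → ℝ) ψ) := LinearMap.continuous_of_finiteDimensional _
    let κ := truncPi (p := p) (2 * δ)
    refine ⟨⟨fun t => u t + BoundedContinuousFunction.comp κ (truncPi_lip _) (lcomb ψ (c' t) - u t),
      ?_⟩, fun t => ?_, fun t x hx => ?_⟩
    · exact u.continuous.add ((BoundedContinuousFunction.continuous_comp (truncPi_lip _)).comp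
        ((hL.comp c'.continuous).sub u.continuous))
    · rw [BoundedContinuousFunction.dist_le (by positivity)]
      intro x
      simp only [ContinuousMap.coe_mk, BoundedContinuousFunction.coe_add, Pi.add_apply,
        dist_eq_norm, add_sub_cancel_left]
      exact truncPi_norm (by positivity) _
    · have h1 : ‖lcomb ψ (c' t) x - u t x‖ ≤ 2 * δ := by
        have h2 : lcomb ψ (c' t) x - u t x = ∑ i, ψ i x • (c' t i - u t x) := by
          simp only [smul_sub, Finset.sum_sub_distrib, lcomb_apply, ← Finset.sum_smul, hsum x hx,
            one_smul]
        rw [h2]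
        refine (norm_sum_le _ _).trans ?_
        calc ∑ i, ‖ψ i x • (c' t i - u t x)‖ ≤ ∑ i, ψ i x * (2 * δ) := by
              refine Finset.sum_le_sum fun i _ => ?_
              rw [norm_smul, Real.norm_eq_abs, abs_of_nonneg (hnn i x hx)]
              by_cases h : ψ i x = 0
              · simp [h]
              · refine mul_le_mul_of_nonneg_left ?_ (hnn i x hx)
                have h3 : dist (u t i) (u t x) < δ := by
                  exact hOd _ _ (hψO i x hx h) t
                have h4 := hc' t
                rw [dist_pi_lt_iff hδ] at h4
                have h5 : dist (c' t i) (u t i) < δ := h4 i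
                rw [← dist_eq_norm]
                refine (dist_triangle _ (u t i) _).trans ?_
                exact (add_lt_add h5 h3).le.trans (by linarith)
          _ = 2 * δ := by rw [← Finset.sum_mul, hsum x hx, one_mul]
      show u t x + truncPi (2 * δ) (lcomb ψ (c' t) x - u t x) = _
      rw [truncPi_eq h1, lcomb_apply]
      abel

/-- vectors supported in `s` -/
def suppIn {ι : Type*} (s : Finset ι) : Submodule ℝ (ι → ℝ) where
  carrier := {a | ∀ i, i ∉ s → a i = 0}
  zero_mem' := fun i _ => rfl
  add_mem' := fun {a b} ha hb i hi => by simp [ha i hi, hb i hi]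
  smul_mem' := fun r a ha i hi => by simp [ha i hi]

lemma suppIn_finrank {ι : Type*} [Fintype ι] (s : Finset ι) :
    Module.finrank ℝ (suppIn s) ≤ s.card := by
  let L : suppIn s →ₗ[ℝ] (s → ℝ) :=
    (LinearMap.funLeft ℝ ℝ (fun i : s => (i : ι))).comp (suppIn s).subtype
  have hL : Function.Injective L := by
    intro a b hab
    ext i
    by_cases hi : i ∈ s
    · exact congrFun hab ⟨i, hi⟩
    · rw [a.2 i hi, b.2 i hi]
  have := LinearMap.finrank_le_finrank_of_injective hL
  simpa using this

/-- vectors supported in `s` with vanishing sum -/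
def suppIn0 {ι : Type*} [Fintype ι] (s : Finset ι) : Submodule ℝ (ι → ℝ) where
  carrier := {a | (∀ i, i ∉ s → a i = 0) ∧ ∑ i, a i = 0}
  zero_mem' := ⟨fun i _ => rfl, by simp⟩
  add_mem' := fun {a b} ha hb => ⟨fun i hi => by simp [ha.1 i hi, hb.1 i hi], by
    simp [Finset.sum_add_distrib, ha.2, hb.2]⟩
  smul_mem' := fun r a ha => ⟨fun i hi => by simp [ha.1 i hi], by
    simp [← Finset.mul_sum, ha.2]⟩

lemma suppIn0_finrank {ι : Type*} [Fintype ι] (s : Finset ι) :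
    Module.finrank ℝ (suppIn0 s) ≤ s.card - 1 := by
  classical
  have hle : suppIn0 s ≤ suppIn s := fun a ha => ha.1
  rcases s.eq_empty_or_nonempty with rfl | ⟨j, hj⟩
  · exact (Submodule.finrank_mono hle).trans (suppIn_finrank _)
  · have hlt : suppIn0 s < suppIn s := by
      refine lt_of_le_of_ne hle fun h => ?_
      have h1 : (Pi.single j 1 : ι → ℝ) ∈ suppIn s := by
        intro i hi
        refine Pi.single_eq_of_ne ?_ _
        rintro rfl
        exact hi hj
      rw [← h] at h1
      have := h1.2
      simp at this
    have h2 := Submodule.finrank_lt_finrank_of_lt hlt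
    have h3 := suppIn_finrank s
    omega

lemma zprop_emb {X Y H : Type*} [TopologicalSpace X] [T2Space X] [NormalSpace X]
    [PseudoMetricSpace H]
    {f : X → Y} {y : Y} (hK : IsCompact (f ⁻¹' {y})) {n m p : ℕ} (hp : 2 * n + 1 + m = p)
    (hdim : CovDimLE (f ⁻¹' {y}) n) {h : X → H} (hh : Continuous h) {η : ℝ} (hη : 0 < η) :
    ZProp m {g : BoundedContinuousFunction X (Fin p → ℝ) |
      GoodAt f {z : X × X | f z.1 = f z.2 ∧ η ≤ dist (h z.1) (h z.2)}
        (fun u v => dist u v) y g} := by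
  classical
  intro T _ _ e he hinj u ε hε
  obtain ⟨I, φ, c, hs, hn, hW, hc⟩ := bary_approx hK hdim
    (fun x => {x' | dist (h x) (h x') < η / 2})
    (fun x => isOpen_lt (by fun_prop) continuous_const) (fun x => by simpa using hη) u
    (δ := ε / 4) (by positivity)
  obtain ⟨c', hc1, hc2⟩ := gp_approx (ι := I) (m := m) (r := 2 * n + 1) (F := Fin p → ℝ)
    (by simp; omega) {V | ∃ s : Finset I, s.card ≤ 2 * n + 2 ∧ V = suppIn0 s}
    (((Set.toFinite {s : Finset I | s.card ≤ 2 * n + 2}).image suppIn0).countable.mono (by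
      rintro V ⟨s, hs, rfl⟩
      exact ⟨s, hs, rfl⟩))
    (by
      rintro V ⟨s, hs, rfl⟩
      have := suppIn0_finrank s
      omega) e he hinj c (ε := ε / 4) (by positivity)
  obtain ⟨u', hu1, hu2⟩ := hc c' hc1
  refine ⟨u', fun t => lt_of_le_of_lt (hu1 t) (by linarith), fun t z hz hzy => ?_⟩
  have hz1 : z.1 ∈ f ⁻¹' {y} := hzy
  have hz2 : z.2 ∈ f ⁻¹' {y} := by
    have := hz.1
    show f z.2 = y
    rw [← this, hzy]
  rw [dist_pos]
  intro heq
  rw [hu2 t _ hz1, hu2 t _ hz2, ← sub_eq_zero, ← Finset.sum_sub_distrib] at heq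
  simp only [← sub_smul] at heq
  have hdisj : ∀ i, φ i z.1 ≠ 0 → φ i z.2 = 0 := by
    intro i hi
    by_contra hi'
    have h1 : dist (h i) (h z.1) < η / 2 := hW i _ hz1 hi
    have h2 : dist (h i) (h z.2) < η / 2 := hW i _ hz2 hi'
    have h3 := dist_triangle_left (h z.1) (h z.2) (h i)
    linarith [hz.2]
  refine hc2 t _ ⟨Finset.univ.filter (fun i => φ i z.1 ≠ 0) ∪
    Finset.univ.filter (fun i => φ i z.2 ≠ 0), ?_, rfl⟩ (fun i => φ i z.1 - φ i z.2) ⟨?_, ?_⟩ ?_ heq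
  · have h1 := hn _ hz1
    have h2 := hn _ hz2
    rw [Set.ncard_eq_toFinset_card'] at h1 h2
    simp only [Set.toFinset_ofPred] at h1 h2
    refine (Finset.card_union_le _ _).trans ?_
    omega
  · intro i hi
    simp only [Finset.mem_union, Finset.mem_filter, Finset.mem_univ, true_and, not_or,
      not_not] at hi
    simp [hi.1, hi.2]
  · simp only [Finset.sum_sub_distrib]
    rw [hs _ hz1, hs _ hz2, sub_self]
  · intro h0
    have h1 : ∃ i, φ i z.1 ≠ 0 := by
      by_contra hcon
      push Not at hcon
      have := hs _ hz1
      simp [hcon] at this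
    obtain ⟨i, hi⟩ := h1
    have := congrFun h0 i
    simp only [hdisj i hi, sub_zero, Pi.zero_apply] at this
    exact hi this

lemma zprop_plane {X Y : Type*} [TopologicalSpace X] [T2Space X] [NormalSpace X]
    {f : X → Y} {y : Y} (hK : IsCompact (f ⁻¹' {y})) {n m p : ℕ}
    (hdim : CovDimLE (f ⁻¹' {y}) n) (S : Finset (Fin p)) (hS : S.card = n + m + 1)
    (r : Fin p → ℝ) :
    ZProp m {g : BoundedContinuousFunction X (Fin p → ℝ) |
      GoodAt f {z : X × X | z.1 = z.2}
        (fun u _ => dist (fun i : S => u i) (fun i : S => r i)) y g} := by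
  classical
  intro T _ _ e he hinj u ε hε
  obtain ⟨I, φ, c, hs, hn, hW, hc⟩ := bary_approx hK hdim
    (fun x => univ) (fun x => isOpen_univ) (fun x => mem_univ _) u
    (δ := ε / 4) (by positivity)
  have hcc : ∀ j i, Continuous fun t => c t j i := fun j i =>
    (continuous_apply i).comp ((continuous_apply j).comp c.continuous)
  obtain ⟨c', hc1, hc2⟩ := gp_approx (ι := I) (m := m) (r := n + 1) (F := S → ℝ)
    (by simp; omega) {V | ∃ s : Finset I, s.card ≤ n + 1 ∧ V = suppIn s}
    (((Set.toFinite {s : Finset I | s.card ≤ n + 1}).image suppIn).countable.mono (by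
      rintro V ⟨s, hs, rfl⟩
      exact ⟨s, hs, rfl⟩))
    (by
      rintro V ⟨s, hs, rfl⟩
      have := suppIn_finrank s
      omega) e he hinj ⟨fun t j i => c t j i - r i, by
        exact continuous_pi fun j => continuous_pi fun i => (hcc j i).sub continuous_const⟩
    (ε := ε / 4) (by positivity)
  have hcc' : ∀ j i, Continuous fun t => c' t j i := fun j i =>
    (continuous_apply i).comp ((continuous_apply j).comp c'.continuous)
  have hδ : 0 < ε / 4 := by positivity
  obtain ⟨u', hu1, hu2⟩ := hc ⟨fun t j i => if hi : i ∈ S then c' t j ⟨i, hi⟩ + r i else c t j i, by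
      refine continuous_pi fun j => continuous_pi fun i => ?_
      by_cases hi : i ∈ S
      · simp only [hi, dite_true]
        exact (hcc' j _).add continuous_const
      · simp only [hi, dite_false]
        exact hcc j i⟩ (by
      intro t
      rw [dist_pi_lt_iff hδ]
      intro j
      rw [dist_pi_lt_iff hδ]
      intro i
      simp only [ContinuousMap.coe_mk]
      by_cases hi : i ∈ S
      · simp only [hi, dite_true]
        have h1 := hc1 t
        rw [dist_pi_lt_iff hδ] at h1
        have h2 := h1 j
        rw [dist_pi_lt_iff hδ] at h2
        have h3 := h2 ⟨i, hi⟩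
        simp only [ContinuousMap.coe_mk, Real.dist_eq] at h3 ⊢
        convert h3 using 2
        ring
      · simp only [hi, dite_false, dist_self]
        exact hδ)
  refine ⟨u', fun t => lt_of_le_of_lt (hu1 t) (by linarith), fun t z hz hzy => ?_⟩
  have hz1 : z.1 ∈ f ⁻¹' {y} := hzy
  rw [dist_pos]
  intro heq
  refine hc2 t _ ⟨Finset.univ.filter (fun i => φ i z.1 ≠ 0), ?_, rfl⟩ (fun i => φ i z.1) ?_ ?_ ?_
  · have h1 := hn _ hz1
    rw [Set.ncard_eq_toFinset_card'] at h1
    simpa only [Set.toFinset_ofPred] using h1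
  · intro i hi
    simpa using hi
  · intro h0
    have h2 := hs _ hz1
    have h3 : ∀ i, φ i z.1 = 0 := fun i => congrFun h0 i
    simp [h3] at h2
  · funext i
    have h1 := congrFun heq i
    simp only [hu2 t _ hz1, Finset.sum_apply, Pi.smul_apply, ContinuousMap.coe_mk, i.2, dite_true,
      smul_eq_mul, mul_add, Finset.sum_add_distrib, ← Finset.sum_mul, hs _ hz1, one_mul,
      Subtype.coe_eta] at h1
    simp only [Finset.sum_apply, Pi.smul_apply, smul_eq_mul, Pi.zero_apply]
    linarith

lemma sl_baire_s15 {X M : Type*} [TopologicalSpace X] [MetricSpace M] [CompleteSpace M]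
    (F : ℕ → Set C(X, M)) (hF : ∀ i, SLOpen (F i))
    (hd : ∀ i, ∀ (g : C(X, M)) (α : C(X, ℝ)), (∀ x, 0 < α x) →
      ∃ g' ∈ F i, ∀ x, dist (g x) (g' x) ≤ α x)
    (g : C(X, M)) (α : C(X, ℝ)) (hα : ∀ x, 0 < α x) :
    ∃ g' ∈ ⋂ i, F i, ∀ x, dist (g x) (g' x) ≤ α x := by
  let St := {q : C(X, M) × C(X, ℝ) // ∀ x, 0 < q.2 x}
  have step : ∀ (i : ℕ) (q : St), ∃ q' : St,
      (∀ x, dist (q.1.1 x) (q'.1.1 x) ≤ (1 / 2) * (1 / 2) ^ i) ∧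
      (∀ x, dist (q.1.1 x) (q'.1.1 x) + q'.1.2 x ≤ q.1.2 x) ∧
      (∀ h : C(X, M), (∀ x, dist (q'.1.1 x) (h x) ≤ q'.1.2 x) → h ∈ F i) := by
    rintro i ⟨⟨g, α⟩, hα⟩
    simp only at hα
    obtain ⟨g', hg', hgd⟩ := hd i g ⟨fun x => min (α x) ((1 / 2) ^ i) / 2, by fun_prop⟩ (by
      intro x
      have := hα x
      simp only [ContinuousMap.coe_mk]
      positivity)
    obtain ⟨γ, hγ, hγF⟩ := hF i g' hg'
    refine ⟨⟨⟨g', ⟨fun x => min (γ x) (α x / 2), by fun_prop⟩⟩, fun x => ?_⟩, fun x => ?_, fun x => ?_,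
      fun h hh => hγF fun x => (hh x).trans (min_le_left _ _)⟩
    · have := hα x
      have := hγ x
      simp only [ContinuousMap.coe_mk]
      positivity
    · have h1 := hgd x
      have h2 := min_le_right (α x) ((1 / 2) ^ i)
      simp only [ContinuousMap.coe_mk] at h1 ⊢
      linarith
    · have h1 := hgd x
      have h2 := min_le_left (α x) ((1 / 2) ^ i)
      have h3 := min_le_right (γ x) (α x / 2)
      simp only [ContinuousMap.coe_mk] at h1 ⊢
      linarith
  choose nxt h1 h2 h3 using step
  let sq : ℕ → St := fun i => Nat.rec ⟨⟨g, α⟩, hα⟩ (fun i q => nxt i q) i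
  have hsq : ∀ i, sq (i + 1) = nxt i (sq i) := fun i => rfl
  have hgeo : ∀ x i, dist ((sq i).1.1 x) ((sq (i + 1)).1.1 x) ≤ (1 / 2) * (1 / 2) ^ i := by
    intro x i
    rw [hsq]
    exact h1 i (sq i) x
  have hlim : ∀ x, ∃ a, Filter.Tendsto (fun i => (sq i).1.1 x) Filter.atTop (𝓝 a) := fun x =>
    cauchySeq_tendsto_of_complete
      (cauchySeq_of_le_geometric (1 / 2) (1 / 2) (by norm_num) (hgeo x))
  choose G hG using hlim
  have hGd : ∀ x i, dist ((sq i).1.1 x) (G x) ≤ (1 / 2) ^ i := by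
    intro x i
    have := dist_le_of_le_geometric_of_tendsto (1 / 2) (1 / 2) (by norm_num) (hgeo x) (hG x) i
    refine this.trans (le_of_eq ?_)
    ring
  have hunif : TendstoUniformly (fun i x => (sq i).1.1 x) G Filter.atTop := by
    rw [Metric.tendstoUniformly_iff]
    intro ε hε
    have h0 := tendsto_pow_atTop_nhds_zero_of_lt_one (r := (1 / 2 : ℝ)) (by norm_num) (by norm_num)
    filter_upwards [h0.eventually_lt_const hε] with i hi x
    rw [dist_comm]
    exact (hGd x i).trans_lt hi
  have hGc : Continuous G := hunif.continuous (Filter.Frequently.of_forall fun i => (sq i).1.1.continuous)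
  have hnest : ∀ x i j, dist ((sq i).1.1 x) ((sq (i + j)).1.1 x) + (sq (i + j)).1.2 x ≤
      (sq i).1.2 x := by
    intro x i j
    induction j with
    | zero => simp
    | succ j ih =>
      have h4 := h2 (i + j) (sq (i + j)) x
      rw [← hsq] at h4
      have h5 := dist_triangle ((sq i).1.1 x) ((sq (i + j)).1.1 x) ((sq (i + j + 1)).1.1 x)
      rw [← add_assoc]
      linarith
  have hball : ∀ x i, dist ((sq i).1.1 x) (G x) ≤ (sq i).1.2 x := by
    intro x i
    have h6 : Filter.Tendsto (fun j => dist ((sq i).1.1 x) ((sq (j + i)).1.1 x)) Filter.atTop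
        (𝓝 (dist ((sq i).1.1 x) (G x))) :=
      tendsto_const_nhds.dist ((Filter.tendsto_add_atTop_iff_nat i).2 (hG x))
    refine le_of_tendsto' h6 fun j => ?_
    have h7 := hnest x i j
    have h8 := (sq (i + j)).2 x
    rw [add_comm j i]
    linarith
  refine ⟨⟨G, hGc⟩, mem_iInter.2 fun i => ?_, fun x => hball x 0⟩
  refine h3 i (sq i) ⟨G, hGc⟩ fun x => ?_
  rw [← hsq]
  exact hball x (i + 1)

lemma cube_complete (p : ℕ) : CompleteSpace ↥(cube p) := by
  have : IsClosed (cube p) := by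
    have h : cube p = ⋂ i, {x : EuclideanSpace ℝ (Fin p) | x i ∈ Icc (0:ℝ) 1} := by
      ext x; simp [cube]
    rw [h]
    refine isClosed_iInter fun i => ?_
    exact isClosed_Icc.preimage ((continuous_apply i).comp (PiLp.continuous_ofLp 2 _))
  exact this.completeSpace_coe

/-- the test sets -/
def tst {X Y H : Type*} [TopologicalSpace X] [TopologicalSpace Y] [PseudoMetricSpace H] (f : X → Y)
    (h : X → H) (p k : ℕ) : ℕ ⊕ (Finset (Fin p) × (Fin p → ℚ)) → Set C(X, ↥(cube p))
  | .inl i => {g | ∀ y, GoodAt f {z : X × X | f z.1 = f z.2 ∧ 1 / ((i : ℝ) + 1) ≤ dist (h z.1) (h z.2)}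
        (fun u v => dist u v) y (unc g)}
  | .inr q => {g | q.1.card = k → ∀ y, GoodAt f {z : X × X | z.1 = z.2}
        (fun u _ => dist (fun i : q.1 => u i) (fun i : q.1 => (q.2 i : ℝ))) y (unc g)}

lemma plane_lip {p : ℕ} (S : Finset (Fin p)) (r : Fin p → ℝ) (u v u' v' : Fin p → ℝ) :
    |dist (fun i : S => u i) (fun i : S => r i) - dist (fun i : S => u' i) (fun i : S => r i)| ≤
      dist u u' + dist v v' := by
  have h1 := abs_dist_sub_le (fun i : S => u i) (fun i : S => u' i) (fun i : S => r i)
  have h2 : dist (fun i : S => u i) (fun i : S => u' i) ≤ dist u u' := by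
    rw [dist_pi_le_iff dist_nonneg]
    exact fun i => dist_le_pi_dist u u' i
  have h3 : (0:ℝ) ≤ dist v v' := dist_nonneg
  linarith

lemma emb_lip {F : Type*} [PseudoMetricSpace F] (u v u' v' : F) :
    |dist u v - dist u' v'| ≤ dist u u' + dist v v' := by
  have := dist_dist_dist_le u v u' v'
  rwa [Real.dist_eq] at this

lemma tst_eq {X Y H : Type*} [TopologicalSpace X] [TopologicalSpace Y] [T2Space Y]
    [MetricSpace H] {f : X → Y} (hf : IsProperMap f) {h : X → H}
    (hinj : Function.Injective (fun x => (f x, h x))) (p k : ℕ) :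
    {g : C(X, ↥(cube p)) | IsEmbedding (fun x => (f x, g x) : X → Y × ↥(cube p)) ∧
        ∀ x : X, ({i : Fin p | ∃ r : ℚ, (g x : EuclideanSpace ℝ (Fin p)) i = (r : ℝ)}).ncard ≤ k} =
      ⋂ j, tst f h p (k + 1) j := by
  classical
  ext g
  constructor
  · rintro ⟨hemb, hn⟩
    refine mem_iInter.2 ?_
    rintro (i | ⟨S, r⟩)
    · intro y z hz hzy
      have hz2 : 1 / ((i : ℝ) + 1) ≤ dist (h z.1) (h z.2) := hz.2
      have hpos : (0:ℝ) < 1 / ((i : ℝ) + 1) := by positivity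
      refine dist_pos.2 fun heq => ?_
      have h1 : g z.1 = g z.2 := by
        apply Subtype.ext
        ext i
        exact congrFun heq i
      have h2 : z.1 = z.2 := hemb.injective (Prod.ext hz.1 h1)
      rw [h2, dist_self] at hz2
      linarith
    · intro hS y z hz hzy
      refine dist_pos.2 fun heq => ?_
      have h1 : (S : Set (Fin p)) ⊆
          {i : Fin p | ∃ r : ℚ, (g z.1 : EuclideanSpace ℝ (Fin p)) i = (r : ℝ)} := by
        intro i hi
        exact ⟨r i, congrFun heq ⟨i, hi⟩⟩
      have h2 := ncard_le_ncard h1 (toFinite _)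
      rw [Set.ncard_coe_finset] at h2
      have h3 := hn z.1
      simp only at hS
      omega
  · intro hg
    rw [mem_iInter] at hg
    refine ⟨?_, fun x => ?_⟩
    · have hc : Continuous (fun x => (f x, g x) : X → Y × ↥(cube p)) :=
        hf.continuous.prodMk g.continuous
      have hprop : IsProperMap (fun x => (f x, g x) : X → Y × ↥(cube p)) :=
        isProperMap_of_comp_of_t2 hc continuous_fst hf
      refine (IsClosedEmbedding.of_continuous_injective_isClosedMap hc ?_
        hprop.isClosedMap).isEmbedding
      intro x x' hxx
      have hfx : f x = f x' := congrArg Prod.fst hxx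
      have hgx : g x = g x' := congrArg Prod.snd hxx
      by_contra hne
      have hh : h x ≠ h x' := fun hh => hne (hinj (Prod.ext hfx hh))
      obtain ⟨i, hi⟩ := exists_nat_one_div_lt (dist_pos.2 hh)
      have h1 := hg (.inl i) (f x) (x, x') ⟨hfx, hi.le⟩ rfl
      refine h1.ne' (dist_eq_zero.2 ?_)
      funext i
      simp only [unc, hgx]
    · by_contra hcon
      push Not at hcon
      rw [Set.ncard_eq_toFinset_card'] at hcon
      obtain ⟨S, hS, hSc⟩ := Finset.exists_subset_card_eq (Nat.succ_le_of_lt hcon)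
      have hr : ∀ i, ∃ r : ℚ, i ∈ S → (g x : EuclideanSpace ℝ (Fin p)) i = (r : ℝ) := by
        intro i
        by_cases hi : i ∈ S
        · have := hS hi
          simp only [Set.mem_toFinset, mem_ofPred_eq] at this
          obtain ⟨r, hr⟩ := this
          exact ⟨r, fun _ => hr⟩
        · exact ⟨0, fun h => (hi h).elim⟩
      choose r hr using hr
      have h1 := hg (.inr (S, r)) hSc (f x) (x, x) rfl rfl
      refine h1.ne' (dist_eq_zero.2 ?_)
      funext i
      exact hr i i.2

lemma plane_cont {p : ℕ} (S : Finset (Fin p)) (r : Fin p → ℝ) :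
    Continuous fun z : (Fin p → ℝ) × (Fin p → ℝ) =>
      dist (fun i : S => z.1 i) (fun i : S => r i) := by
  fun_prop

lemma plane_open {X Y : Type*} [TopologicalSpace X] [TopologicalSpace Y] [T2Space X] [T2Space Y]
    [ParacompactSpace Y] {f : X → Y} (hf : IsProperMap f) {p : ℕ} (S : Finset (Fin p))
    (r : Fin p → ℝ) :
    SLOpen {g : C(X, ↥(cube p)) | ∀ y, GoodAt f {z : X × X | z.1 = z.2}
      (fun u _ => dist (fun i : S => u i) (fun i : S => r i)) y (unc g)} :=
  good_SLOpen hf (isClosed_eq continuous_fst continuous_snd) (fun _ hz => congrArg f hz)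
    (plane_cont S r) (plane_lip S r)

lemma plane_dense {X Y : Type*} [TopologicalSpace X] [TopologicalSpace Y] [T2Space X] [T2Space Y]
    [ParacompactSpace X] [ParacompactSpace Y] {f : X → Y} (hf : IsProperMap f) {n m p : ℕ}
    (hdimf : ∀ y : Y, CovDimLE ↥(f ⁻¹' {y}) n) (hdimY : CovDimLE Y m)
    (S : Finset (Fin p)) (hS : S.card = n + m + 1) (r : Fin p → ℝ)
    (g : C(X, ↥(cube p))) (α : C(X, ℝ)) (hα : ∀ x, 0 < α x) :
    ∃ g' : C(X, ↥(cube p)), (∀ x, dist (g x) (g' x) ≤ α x) ∧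
      ∀ y, GoodAt f {z : X × X | z.1 = z.2}
        (fun u _ => dist (fun i : S => u i) (fun i : S => r i)) y (unc g') :=
  good_dense hf (isClosed_eq continuous_fst continuous_snd) (fun _ hz => congrArg f hz)
    (plane_cont S r) (plane_lip S r) hdimY
    (fun y => zprop_plane (hf.isCompact_preimage isCompact_singleton) (hdimf y) S hS r) g α hα

/-- generalized Nöbeling–Pontryagin–Lefschetz theorem. Under the hypotheses of
Theorem 1.1(i), the set of all `g ∈ C(X, I^{2n+1+m})` such that `f × g` is an embedding and
`g(X) ⊆ N^{2n+1+m}_{n+m}` (points with at most `n+m` rational coordinates) is dense and `G_δ` in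
`C(X, I^{2n+1+m})` with the source limitation topology. -/
theorem stmt15 {X Y : Type*} [TopologicalSpace X] [TopologicalSpace Y]
    [T2Space X] [T2Space Y] [ParacompactSpace X] [ParacompactSpace Y]
    (n m : ℕ) (f : X → Y) (hperf : IsPerfectMap f) (hsurj : Function.Surjective f)
    (hw : HasCountableFunctionalWeight f)
    (hdimf : ∀ y : Y, CovDimLE ↥(f ⁻¹' {y}) n)
    (hdimY : CovDimLE Y m) :
    SLDense {g : C(X, ↥(cube (2*n+1+m))) |
        IsEmbedding (fun x => (f x, g x) : X → Y × ↥(cube (2*n+1+m))) ∧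
        ∀ x : X, ({i : Fin (2*n+1+m) |
            ∃ r : ℚ, (g x : EuclideanSpace ℝ (Fin (2*n+1+m))) i = (r : ℝ)}).ncard ≤ n + m} ∧
    SLGdelta {g : C(X, ↥(cube (2*n+1+m))) |
        IsEmbedding (fun x => (f x, g x) : X → Y × ↥(cube (2*n+1+m))) ∧
        ∀ x : X, ({i : Fin (2*n+1+m) |
            ∃ r : ℚ, (g x : EuclideanSpace ℝ (Fin (2*n+1+m))) i = (r : ℝ)}).ncard ≤ n + m} := by
  have hf : IsProperMap f := isProperMap_iff_isClosedMap_and_compact_fibers.2 hperf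
  obtain ⟨h, hh⟩ := hw
  rw [tst_eq hf (h := fun x => h x) hh.injective (2 * n + 1 + m) (n + m)]
  obtain ⟨e, he⟩ := exists_surjective_nat
    (ℕ ⊕ (Finset (Fin (2*n+1+m)) × (Fin (2*n+1+m) → ℚ)))
  rw [← he.iInter_comp]
  have hP1 : ∀ i : ℕ, IsClosed {z : X × X | f z.1 = f z.2 ∧ 1 / ((i : ℝ) + 1) ≤ dist (h z.1) (h z.2)} := by
    intro i
    have hfc := hf.continuous
    have h1 : Continuous fun z : X × X => dist (h z.1) (h z.2) := by fun_prop
    exact (isClosed_eq (hfc.comp continuous_fst) (hfc.comp continuous_snd)).inter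
      (isClosed_le continuous_const h1)
  have hop : ∀ j, SLOpen (tst f (fun x => h x) (2*n+1+m) (n + m + 1) j) := by
    rintro (i | ⟨S, r⟩)
    · exact good_SLOpen hf (hP1 i) (fun z hz => hz.1) continuous_dist emb_lip
    · by_cases hS : S.card = n + m + 1
      · have := plane_open hf S (fun i => (r i : ℝ))
        simpa only [tst, hS, forall_const] using this
      · intro g _
        exact ⟨⟨fun _ => 1, continuous_const⟩, fun _ => one_pos, fun g' _ h' => (hS h').elim⟩
  have hdn : ∀ j, ∀ (g : C(X, ↥(cube (2*n+1+m)))) (α : C(X, ℝ)), (∀ x, 0 < α x) →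
      ∃ g' ∈ tst f (fun x => h x) (2*n+1+m) (n + m + 1) j, ∀ x, dist (g x) (g' x) ≤ α x := by
    rintro (i | ⟨S, r⟩) g α hα
    · obtain ⟨g', h1, h2⟩ := good_dense hf (hP1 i) (fun z hz => hz.1) continuous_dist emb_lip hdimY
        (fun y => zprop_emb (hperf.2.2 y) rfl (hdimf y) h.continuous (by positivity)) g α hα
      exact ⟨g', h2, h1⟩
    · by_cases hS : S.card = n + m + 1
      · obtain ⟨g', h1, h2⟩ := plane_dense hf hdimf hdimY S hS (fun i => (r i : ℝ)) g α hα
        exact ⟨g', fun _ => h2, h1⟩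
      · exact ⟨g, fun h' => (hS h').elim, fun x => by rw [dist_self]; exact (hα x).le⟩
  refine ⟨?_, fun i => tst f (fun x => h x) (2*n+1+m) (n + m + 1) (e i), fun i => hop _, rfl⟩
  rintro U hU ⟨g, hg⟩
  obtain ⟨α, hα, hαU⟩ := hU g hg
  have := cube_complete (2*n+1+m)
  obtain ⟨g', h1, h2⟩ := sl_baire_s15 (fun i => tst f (fun x => h x) (2*n+1+m) (n + m + 1) (e i))
    (fun i => hop _) (fun i => hdn _) g α hα
  exact ⟨g', hαU h2, h1⟩
end
end

section
/- For integers n, m ≥ 0 and 0 ≤ k ≤ 2n, every k-plane Π in R^{2n+1+m} intersected with I^{2n+1+m} is a Z_{m+2n−k}-set in I^{2n+1+m}; consequently the union Π(k) of all rational k-planes in R^{2n+1+m}, intersected with I^{2n+1+m}, is a σZ_{m+2n−k}-set in I^{2n+1+m}. -/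
open Set Topology

noncomputable section

theorem cube_isCompact (q : ℕ) : IsCompact (cube q) := by
  have h : cube q = (WithLp.toLp 2) '' (Set.univ.pi fun _ : Fin q => Set.Icc (0:ℝ) 1) := by
    ext x
    constructor
    · intro hx
      exact ⟨WithLp.ofLp x, fun i _ => hx i, rfl⟩
    · rintro ⟨y, hy, rfl⟩ i
      exact hy i (Set.mem_univ i)
  rw [h]
  exact (isCompact_univ_pi fun _ => isCompact_Icc).image (PiLp.continuous_toLp 2 _)

def smoothSub (q : ℕ) : Subalgebra ℝ C(↥(cube q), ℝ) where
  carrier := {f | ∃ g : EuclideanSpace ℝ (Fin q) → ℝ, ContDiff ℝ 1 g ∧ ∀ z, f z = g z}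
  mul_mem' := by
    rintro f f' ⟨g, hg, h⟩ ⟨g', hg', h'⟩
    exact ⟨fun x => g x * g' x, hg.mul hg', fun z => by simp [h, h']⟩
  add_mem' := by
    rintro f f' ⟨g, hg, h⟩ ⟨g', hg', h'⟩
    exact ⟨fun x => g x + g' x, hg.add hg', fun z => by simp [h, h']⟩
  algebraMap_mem' := by
    intro r
    exact ⟨fun _ => r, contDiff_const, fun z => by simp [algebraMap_apply]⟩

theorem smooth_approx (q : ℕ) (f : ↥(cube q) → ℝ) (hf : Continuous f) (ε : ℝ) (hε : 0 < ε) :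
    ∃ g : EuclideanSpace ℝ (Fin q) → ℝ, ContDiff ℝ 1 g ∧ ∀ z : ↥(cube q), |g z - f z| < ε := by
  haveI : CompactSpace ↥(cube q) := isCompact_iff_compactSpace.mp (cube_isCompact q)
  have hsep : (smoothSub q).SeparatesPoints := by
    intro x y hxy
    have : ∃ i, (x : EuclideanSpace ℝ (Fin q)) i ≠ (y : EuclideanSpace ℝ (Fin q)) i := by
      by_contra! hc
      exact hxy (Subtype.ext (PiLp.ext hc))
    obtain ⟨i, hi⟩ := this
    refine ⟨_, ⟨⟨fun z => (z : EuclideanSpace ℝ (Fin q)) i, by fun_prop⟩,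
      ⟨fun z => z i, by fun_prop, fun z => rfl⟩, rfl⟩, hi⟩
  obtain ⟨⟨g, g', hg', h⟩, hg⟩ :=
    ContinuousMap.exists_mem_subalgebra_near_continuous_of_separatesPoints
      (smoothSub q) hsep f hf ε hε
  refine ⟨g', hg', fun z => ?_⟩
  have := hg z
  rw [← h z]
  simpa [Real.norm_eq_abs] using this

theorem zset_aux (p q : ℕ) (s : Finset (Fin p)) (r : Fin p → ℝ) (hs : q < s.card) :
    IsZSet q {x : ↥(cube p) | ∀ i ∈ s, (x : EuclideanSpace ℝ (Fin p)) i = r i} := by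
  constructor
  · have : {x : ↥(cube p) | ∀ i ∈ s, (x : EuclideanSpace ℝ (Fin p)) i = r i} =
      ⋂ i ∈ s, {x : ↥(cube p) | (x : EuclideanSpace ℝ (Fin p)) i = r i} := by
      ext x; simp
    rw [this]
    exact isClosed_biInter fun i _ => isClosed_eq (by fun_prop) continuous_const
  · haveI : CompactSpace ↥(cube q) := isCompact_iff_compactSpace.mp (cube_isCompact q)
    rw [Metric.dense_iff]
    intro u ε hε
    have hp : (0:ℝ) < p + 1 := by positivity
    obtain ⟨η, hη, hη1, hη2⟩ : ∃ η : ℝ, 0 < η ∧ η ≤ 1 / 2 ∧ (p + 1) * (2 * η) < ε := by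
      refine ⟨min (1/2) (ε / (4 * (p + 1))), by positivity, min_le_left _ _, ?_⟩
      have h1 := min_le_right (1/2 : ℝ) (ε / (4 * (p + 1)))
      calc ((p:ℝ) + 1) * (2 * min (1/2) (ε / (4 * (p + 1))))
          ≤ (p + 1) * (2 * (ε / (4 * (p + 1)))) := by gcongr
        _ = ε / 2 := by field_simp; norm_num
        _ < ε := by linarith
    have hu : ∀ z i, (u z : EuclideanSpace ℝ (Fin p)) i ∈ Set.Icc (0:ℝ) 1 :=
      fun z i => (u z).2 i
    have huc : Continuous u := u.continuous
    choose g hg hgu using fun i : Fin p => smooth_approx q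
      (fun z => (1 - 2 * η) * (u z : EuclideanSpace ℝ (Fin p)) i + η) (by fun_prop) (η / 2)
      (by positivity)
    have hG : ContDiff ℝ 1 (fun x : EuclideanSpace ℝ (Fin q) => fun i : s => g i x) :=
      contDiff_pi.2 fun i => hg i
    have hd := hG.dense_compl_range_of_finrank_lt_finrank (by simpa using hs)
    obtain ⟨w, hwr, hw⟩ := Metric.dense_iff.1 hd (fun i : s => r i) (η / 2) (by positivity)
    rw [Metric.mem_ball, dist_pi_lt_iff (by positivity)] at hwr
    let v : Fin p → ℝ := fun i => if h : i ∈ s then w ⟨i, h⟩ - r i else 0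
    have hv : ∀ i, |v i| ≤ η / 2 := by
      intro i
      by_cases h : i ∈ s
      · have := hwr ⟨i, h⟩
        simp only [v, h, dif_pos]
        rw [Real.dist_eq] at this
        exact this.le
      · simp only [v, h, dif_neg, not_false_eq_true, abs_zero]
        positivity
    have hmem : ∀ z : ↥(cube q), WithLp.toLp 2 (fun i => g i z - v i) ∈ cube p := by
      intro z i
      have h1 := abs_le.1 (hgu i z).le
      have h2 := abs_le.1 (hv i)
      have h3 := hu z i
      have h4 := h3.1
      have h5 := h3.2
      change g i z - v i ∈ Set.Icc (0:ℝ) 1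
      constructor <;> nlinarith
    have hgc : ∀ i, Continuous (g i) := fun i => (hg i).continuous
    let H : C(↥(cube q), ↥(cube p)) := ⟨fun z => ⟨_, hmem z⟩, by fun_prop⟩
    refine ⟨BoundedContinuousFunction.mkOfCompact H, ?_, ?_⟩
    · rw [Metric.mem_ball]
      refine lt_of_le_of_lt ((BoundedContinuousFunction.dist_le (by positivity)).2 ?_) hη2
      intro z
      rw [Subtype.dist_eq, EuclideanSpace.dist_eq]
      apply Real.sqrt_le_iff.2
      refine ⟨by positivity, ?_⟩
      calc _ ≤ ∑ i : Fin p, (2 * η) ^ 2 := by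
            refine Finset.sum_le_sum fun i _ => ?_
            refine pow_le_pow_left₀ dist_nonneg ?_ 2
            have h1 := abs_le.1 (hgu i z).le
            have h2 := abs_le.1 (hv i)
            have h3 := hu z i
            have h4 := h3.1
            have h5 := h3.2
            rw [Real.dist_eq]
            change |g i z - v i - (u z : EuclideanSpace ℝ (Fin p)) i| ≤ 2 * η
            rw [abs_le]
            constructor <;> nlinarith
        _ = p * (2 * η) ^ 2 := by simp
        _ ≤ _ := by
            rw [mul_pow ((p:ℝ) + 1)]
            refine mul_le_mul_of_nonneg_right ?_ (sq_nonneg _)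
            nlinarith [(Nat.cast_nonneg p : (0:ℝ) ≤ p)]
    · intro z hz
      apply hw
      refine ⟨z, ?_⟩
      ext i
      have h1 : g i z - v i = r i := hz i i.2
      simp only [v, i.2, dif_pos] at h1
      change g i z = w i
      have : w ⟨i, i.2⟩ = w i := rfl
      linarith

theorem stmt16 (n m k : ℕ) (hk : k ≤ 2*n) :
    (∀ P : Set (EuclideanSpace ℝ (Fin (2*n+1+m))), IsPlane (2*n+1+m) k P →
      IsZSet (m + 2*n - k)
        {x : ↥(cube (2*n+1+m)) | (x : EuclideanSpace ℝ (Fin (2*n+1+m))) ∈ P}) ∧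
    IsSigmaZSet (m + 2*n - k)
      {x : ↥(cube (2*n+1+m)) | ∃ P : Set (EuclideanSpace ℝ (Fin (2*n+1+m))),
        IsRatPlane (2*n+1+m) k P ∧ (x : EuclideanSpace ℝ (Fin (2*n+1+m))) ∈ P} := by
  constructor
  · rintro P ⟨s, r, hs, rfl⟩
    exact zset_aux _ _ s r (by omega)
  · obtain ⟨s₀, -, hs₀⟩ := Finset.exists_subset_card_eq
      (s := (Finset.univ : Finset (Fin (2*n+1+m)))) (n := 2*n+1+m-k) (by simp)
    haveI : Nonempty ({s : Finset (Fin (2*n+1+m)) // s.card = 2*n+1+m-k} ×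
      (Fin (2*n+1+m) → ℚ)) := ⟨⟨⟨s₀, hs₀⟩, 0⟩⟩
    obtain ⟨e, he⟩ := exists_surjective_nat
      ({s : Finset (Fin (2*n+1+m)) // s.card = 2*n+1+m-k} × (Fin (2*n+1+m) → ℚ))
    refine ⟨fun j => {x | ∀ i ∈ (e j).1.1,
      (x : EuclideanSpace ℝ (Fin (2*n+1+m))) i = (((e j).2 i : ℚ) : ℝ)}, fun j => ?_, ?_⟩
    · have := (e j).1.2
      exact zset_aux _ _ (e j).1.1 (fun i => (((e j).2 i : ℚ) : ℝ)) (by omega)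
    · ext x
      simp only [Set.mem_setOf_eq, Set.mem_iUnion]
      constructor
      · rintro ⟨P, ⟨s, r, hs, rfl⟩, hx⟩
        obtain ⟨j, hj⟩ := he ⟨⟨s, hs⟩, r⟩
        refine ⟨j, ?_⟩
        rw [hj]
        exact hx
      · rintro ⟨j, hj⟩
        exact ⟨_, ⟨(e j).1.1, (e j).2, (e j).1.2, rfl⟩, hj⟩
end
end
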